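/- Let k and C be arbitrary real numbers with C > 0, and let A_k = ∏_p (1 + ((1 - 1/p)^k − 1)/(p − 1)), the product being over all primes p. Then there is a constant K (depending only on C and k) such that for all x ≥ 2, |Σ_{p ≤ x} (φ(p-1)/(p-1))^k − A_k · Li(x)| ≤ K · x / (log x)^C, where the sum is over primes p ≤ x. -/

import Mathlib

open Real Set Filter Topology MeasureTheory Finset

namespace ATR

/-- Error in the partial sums. -/
noncomputable def Er (a : ℕ → ℂ) (c : ℂ) (u : ℝ) : ℂ := ∑ k ∈ Finset.Icc 1 ⌊u⌋₊, a k - c * u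

/-- The regular part of the Dirichlet series. -/
noncomputable def HH (a : ℕ → ℂ) (c : ℂ) (s : ℂ) : ℂ :=
  c + s * ∫ u in Set.Ioi (1 : ℝ), Er a c u * (u : ℂ) ^ (-(s + 1))

lemma measurable_Er (a : ℕ → ℂ) (c : ℂ) : Measurable (Er a c) := by
  unfold Er
  have h1 : Measurable (fun n : ℕ => ∑ k ∈ Finset.Icc 1 n, a k) := measurable_from_nat
  have h2 : Measurable (fun u : ℝ => ∑ k ∈ Finset.Icc 1 ⌊u⌋₊, a k) := h1.comp Nat.measurable_floor
  fun_prop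

/-- integrability of bounded times power on a half line -/
lemma integrableOn_Er {a : ℕ → ℂ} {c : ℂ} {Q : ℝ} (hQ : ∀ u : ℝ, 1 ≤ u → ‖Er a c u‖ ≤ Q)
    {s : ℂ} (hs : 0 < s.re) {N : ℝ} (hN : 1 ≤ N) :
    IntegrableOn (fun u : ℝ => Er a c u * (u : ℂ) ^ (-(s + 1))) (Set.Ioi N) := by
  have hN0 : 0 < N := by linarith
  have h1 : IntegrableOn (fun u : ℝ => Q * u ^ (-(s.re + 1))) (Set.Ioi N) :=
    (integrableOn_Ioi_rpow_of_lt (by linarith) hN0).const_mul Q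
  refine Integrable.mono' h1 ?_ ?_
  · refine ((measurable_Er a c).mul ?_).aestronglyMeasurable
    fun_prop
  · refine (ae_restrict_iff' measurableSet_Ioi).2 (Eventually.of_forall fun u hu => ?_)
    have hu' : N < u := hu
    rw [norm_mul, Complex.norm_cpow_eq_rpow_re_of_pos (by linarith)]
    simp only [Complex.neg_re, Complex.add_re, Complex.one_re]
    exact mul_le_mul_of_nonneg_right (hQ u (by linarith)) (rpow_nonneg (by linarith) _)

lemma norm_integral_Er_le {a : ℕ → ℂ} {c : ℂ} {Q : ℝ} (hQ : ∀ u : ℝ, 1 ≤ u → ‖Er a c u‖ ≤ Q)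
    {s : ℂ} (hs : 0 < s.re) {N : ℝ} (hN : 1 ≤ N) :
    ‖∫ u in Set.Ioi N, Er a c u * (u : ℂ) ^ (-(s + 1))‖ ≤ Q * N ^ (-s.re) / s.re := by
  have hN0 : 0 < N := by linarith
  have h1 : IntegrableOn (fun u : ℝ => Q * u ^ (-(s.re + 1))) (Set.Ioi N) :=
    (integrableOn_Ioi_rpow_of_lt (by linarith) hN0).const_mul Q
  have h2 : ‖∫ u in Set.Ioi N, Er a c u * (u : ℂ) ^ (-(s + 1))‖ ≤
      ∫ u in Set.Ioi N, Q * u ^ (-(s.re + 1)) := by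
    refine norm_integral_le_of_norm_le h1 ?_
    refine (ae_restrict_iff' measurableSet_Ioi).2 (Eventually.of_forall fun u hu => ?_)
    have hu' : N < u := hu
    rw [norm_mul, Complex.norm_cpow_eq_rpow_re_of_pos (by linarith)]
    simp only [Complex.neg_re, Complex.add_re, Complex.one_re]
    exact mul_le_mul_of_nonneg_right (hQ u (by linarith)) (rpow_nonneg (by linarith) _)
  refine h2.trans (le_of_eq ?_)
  rw [integral_const_mul, integral_Ioi_rpow_of_lt (by linarith) hN0]
  have : -(s.re + 1) + 1 = -s.re := by ring
  rw [this]
  field_simp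

lemma norm_HH_le {a : ℕ → ℂ} {c : ℂ} {Q : ℝ} (hQ : ∀ u : ℝ, 1 ≤ u → ‖Er a c u‖ ≤ Q)
    {s : ℂ} (hs : 0 < s.re) : ‖HH a c s‖ ≤ ‖c‖ + ‖s‖ * Q / s.re := by
  unfold HH
  refine (norm_add_le _ _).trans ?_
  rw [norm_mul]
  have := norm_integral_Er_le hQ hs le_rfl
  rw [one_rpow, mul_one] at this
  rw [mul_div_assoc]
  gcongr

lemma differentiableAt_HH {a : ℕ → ℂ} {c : ℂ} {Q : ℝ} (hQ : ∀ u : ℝ, 1 ≤ u → ‖Er a c u‖ ≤ Q)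
    {s : ℂ} (hs : 0 < s.re) : DifferentiableAt ℂ (HH a c) s := by
  set f : ℝ → ℂ := (Set.Ioi (1 : ℝ)).indicator (Er a c) with hf
  have hfm : Measurable f := (measurable_Er a c).indicator measurableSet_Ioi
  have hQ0 : 0 ≤ Q := (norm_nonneg _).trans (hQ 1 le_rfl)
  have hfb : ∀ u, ‖f u‖ ≤ Q := by
    intro u
    rw [hf]
    by_cases hu : u ∈ Set.Ioi (1 : ℝ)
    · rw [Set.indicator_of_mem hu]; exact hQ u (le_of_lt hu)
    · rw [Set.indicator_of_notMem hu]; simpa using hQ0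
  have hmel : ∀ z : ℂ, ∫ u in Set.Ioi (1 : ℝ), Er a c u * (u : ℂ) ^ (-(z + 1)) = mellin f (-z) := by
    intro z
    rw [mellin]
    rw [← integral_indicator measurableSet_Ioi, ← integral_indicator measurableSet_Ioi]
    congr 1
    ext u
    by_cases hu : u ∈ Set.Ioi (1 : ℝ)
    · have hu0 : u ∈ Set.Ioi (0 : ℝ) := lt_trans zero_lt_one (Set.mem_Ioi.1 hu)
      rw [Set.indicator_of_mem hu, Set.indicator_of_mem hu0, hf, Set.indicator_of_mem hu, smul_eq_mul,
        mul_comm]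
      congr 2; ring
    · rw [Set.indicator_of_notMem hu]
      by_cases hu0 : u ∈ Set.Ioi (0 : ℝ)
      · rw [Set.indicator_of_mem hu0, hf, Set.indicator_of_notMem hu, smul_zero]
      · rw [Set.indicator_of_notMem hu0]
  have hli : LocallyIntegrableOn f (Set.Ioi 0) := by
    apply LocallyIntegrable.locallyIntegrableOn
    have hc : LocallyIntegrable (fun _ : ℝ => Q) := locallyIntegrable_const _
    refine hc.mono hfm.aestronglyMeasurable (Eventually.of_forall fun u => ?_)
    rw [Real.norm_of_nonneg hQ0]; exact hfb u
  have htop : f =O[atTop] fun x => x ^ (-(0 : ℝ)) := by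
    refine Asymptotics.IsBigO.of_bound Q (Eventually.of_forall fun u => ?_)
    simpa using hfb u
  have hbot : f =O[𝓝[>] 0] fun x => x ^ (-(-s.re - 1)) := by
    refine Asymptotics.IsBigO.of_bound 0 ?_
    have : ∀ᶠ u : ℝ in 𝓝[>] 0, u < 1 := by
      apply eventually_nhdsWithin_of_eventually_nhds
      exact eventually_lt_nhds one_pos
    filter_upwards [this] with u hu
    rw [hf, Set.indicator_of_notMem (by simp; linarith)]
    simp
  have hd : DifferentiableAt ℂ (mellin f) (-s) :=
    mellin_differentiableAt_of_isBigO_rpow hli htop (by simpa using hs) hbot (by simp)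
  have hd2 : DifferentiableAt ℂ (fun z => mellin f (-z)) s := by
    exact DifferentiableAt.comp s (f := fun z : ℂ => -z) hd (by fun_prop)
  have : HH a c = fun z => c + z * mellin f (-z) := by
    ext z; rw [HH, hmel]
  rw [this]
  fun_prop

lemma integral_cpow_aux {s : ℂ} (hs : 1 < s.re) :
    ∫ u in Set.Ioi (1 : ℝ), (u : ℂ) ^ (-s) = 1 / (s - 1) := by
  rw [integral_Ioi_cpow_of_lt (by simpa using hs) one_pos]
  have : s - 1 ≠ 0 := by
    intro h
    have := congrArg Complex.re h
    simp at this; linarith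
  have h2 : -s + 1 ≠ 0 := by
    intro h; apply this; linear_combination -h
  simp
  rw [neg_div, ← div_neg, ← one_div]; congr 1; ring

lemma LSeries_eq_HH {a : ℕ → ℂ} {c : ℂ} {Q : ℝ} (ha : ∀ n, ‖a n‖ ≤ 1)
    (hQ : ∀ u : ℝ, 1 ≤ u → ‖Er a c u‖ ≤ Q)
    {s : ℂ} (hs : 1 < s.re) : LSeries a s = c / (s - 1) + HH a c s := by
  have hne : s - 1 ≠ 0 := by
    intro h
    have := congrArg Complex.re h
    simp at this; linarith
  have hO : (fun n : ℕ => ∑ k ∈ Finset.Icc 1 n, ‖a k‖) =O[atTop] fun n : ℕ => (n : ℝ) ^ (1 : ℝ) := by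
    refine Asymptotics.IsBigO.of_bound 1 (Eventually.of_forall fun n => ?_)
    rw [Real.norm_of_nonneg (Finset.sum_nonneg fun _ _ => norm_nonneg _), rpow_one, one_mul,
      Real.norm_of_nonneg (Nat.cast_nonneg _)]
    calc ∑ k ∈ Finset.Icc 1 n, ‖a k‖ ≤ ∑ k ∈ Finset.Icc 1 n, (1 : ℝ) := Finset.sum_le_sum fun k _ => ha k
      _ = n := by simp
  rw [LSeries_eq_mul_integral' a zero_le_one hs hO, HH]
  have hI1 := integrableOn_Er hQ (s := s) (by linarith) le_rfl
  have hI2 : IntegrableOn (fun u : ℝ => c * (u : ℂ) ^ (-s)) (Set.Ioi 1) := by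
    apply Integrable.const_mul
    exact integrableOn_Ioi_cpow_of_lt (by simpa using hs) one_pos
  have : ∫ t in Set.Ioi (1 : ℝ), (∑ k ∈ Finset.Icc 1 ⌊t⌋₊, a k) * (t : ℂ) ^ (-(s + 1)) =
      ∫ t in Set.Ioi (1 : ℝ), (Er a c t * (t : ℂ) ^ (-(s + 1)) + c * (t : ℂ) ^ (-s)) := by
    refine setIntegral_congr_fun measurableSet_Ioi fun t ht => ?_
    have ht0 : (t : ℂ) ≠ 0 := by
      have : (1 : ℝ) < t := ht
      exact_mod_cast (by linarith : t ≠ 0)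
    simp only [Er]
    have h3 : (t : ℂ) ^ (-s) = t * (t : ℂ) ^ (-(s + 1)) := by
      rw [show -s = 1 + (-(s + 1)) by ring, Complex.cpow_add _ _ ht0, Complex.cpow_one]
    rw [h3]; ring
  rw [this, integral_add hI1 hI2, integral_const_mul, integral_cpow_aux hs]
  field_simp
  ring

end ATR

namespace ATR

lemma HH_eq_trunc {a : ℕ → ℂ} {c : ℂ} {Q : ℝ} (hQ : ∀ u : ℝ, 1 ≤ u → ‖Er a c u‖ ≤ Q)
    {s : ℂ} (hs : 0 < s.re) {N : ℕ} (hN : 1 ≤ N) :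
    HH a c s = ∑ n ∈ Finset.Icc 1 N, a n * (n : ℂ) ^ (-s)
      - (∑ n ∈ Finset.Icc 1 N, a n) * (N : ℂ) ^ (-s)
      + (c - c * s * ∫ u in Set.Ioc (1 : ℝ) N, (u : ℂ) ^ (-s))
      + s * ∫ u in Set.Ioi (N : ℝ), Er a c u * (u : ℂ) ^ (-(s + 1)) := by
  have hN1 : (1 : ℝ) ≤ N := by exact_mod_cast hN
  have hs0 : -s ≠ 0 := by
    intro h; rw [neg_eq_zero.1 h] at hs; simp at hs
  have hI1 := integrableOn_Er hQ hs le_rfl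
  have hsplit : ∫ u in Set.Ioi (1 : ℝ), Er a c u * (u : ℂ) ^ (-(s + 1)) =
      (∫ u in Set.Ioc (1 : ℝ) N, Er a c u * (u : ℂ) ^ (-(s + 1))) +
        ∫ u in Set.Ioi (N : ℝ), Er a c u * (u : ℂ) ^ (-(s + 1)) := by
    rw [← setIntegral_union (Set.Ioc_disjoint_Ioi le_rfl) measurableSet_Ioi
      (hI1.mono_set Set.Ioc_subset_Ioi_self) (hI1.mono_set (Set.Ioi_subset_Ioi hN1)),
      Set.Ioc_union_Ioi_eq_Ioi hN1]
  have hcont : ∀ r : ℂ, ContinuousOn (fun u : ℝ => (u : ℂ) ^ r) (Set.Icc 1 N) := by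
    intro r u hu
    exact (Complex.continuousAt_ofReal_cpow_const u _ (Or.inr (by linarith [hu.1]))).continuousWithinAt
  have hcI : IntegrableOn (fun u : ℝ => (u : ℂ) ^ (-s)) (Set.Ioc 1 N) :=
    ((hcont _).integrableOn_compact isCompact_Icc).mono_set Set.Ioc_subset_Icc_self
  set a' : ℕ → ℂ := fun n => if n = 0 then 0 else a n with ha'
  have hsum : ∀ n : ℕ, ∑ k ∈ Finset.Icc 0 n, a' k = ∑ k ∈ Finset.Icc 1 n, a k := by
    intro n
    rw [← Finset.add_sum_Ioc_eq_sum_Icc (Nat.zero_le n)]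
    simp only [ha', if_true, zero_add]
    refine Finset.sum_congr (by ext; simp [Nat.succ_le_iff, Nat.pos_iff_ne_zero]) fun k hk => ?_
    rw [if_neg]; simp at hk; omega
  have hder : ∀ t ∈ Set.Icc (1 : ℝ) N, HasDerivAt (fun u : ℝ => (u : ℂ) ^ (-s))
      (-s * (t : ℂ) ^ (-s - 1)) t := fun t ht =>
    hasDerivAt_ofReal_cpow_const (by linarith [ht.1]) hs0
  have habel := sum_mul_eq_sub_sub_integral_mul a' (f := fun u : ℝ => (u : ℂ) ^ (-s))
    zero_le_one hN1 (fun t ht => (hder t ht).differentiableAt) (by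
      refine IntegrableOn.congr_fun (f := fun t : ℝ => -s * (t : ℂ) ^ (-s - 1)) ?_
        (fun t ht => (hder t ht).deriv.symm) measurableSet_Icc
      exact ((hcont _).integrableOn_compact isCompact_Icc).const_mul _)
  have hIntg : ∫ t in Set.Ioc (1 : ℝ) N, deriv (fun u : ℝ => (u : ℂ) ^ (-s)) t *
      ∑ k ∈ Finset.Icc 0 ⌊t⌋₊, a' k =
      -s * (∫ t in Set.Ioc (1 : ℝ) N, Er a c t * (t : ℂ) ^ (-(s + 1)))
        - s * c * ∫ t in Set.Ioc (1 : ℝ) N, (t : ℂ) ^ (-s) := by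
    rw [← integral_const_mul, ← integral_const_mul, ← integral_sub]
    · refine setIntegral_congr_fun measurableSet_Ioc fun t ht => ?_
      have ht0 : (t : ℂ) ≠ 0 := by
        exact_mod_cast (by linarith [ht.1] : t ≠ 0)
      rw [(hder t ⟨ht.1.le, ht.2⟩).deriv, hsum, Er]
      have h3 : (t : ℂ) ^ (-s) = t * (t : ℂ) ^ (-(s + 1)) := by
        rw [show -s = 1 + (-(s + 1)) by ring, Complex.cpow_add _ _ ht0, Complex.cpow_one]
      rw [h3, show -s - 1 = -(s + 1) by ring]; ring
    · exact (hI1.mono_set Set.Ioc_subset_Ioi_self).const_mul _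
    · exact hcI.const_mul _
  rw [hIntg] at habel
  simp only [hsum, Nat.floor_one, Nat.floor_natCast, Finset.Icc_self, Finset.sum_singleton,
    Complex.ofReal_natCast, Complex.ofReal_one, Complex.one_cpow] at habel
  have hS : ∑ n ∈ Finset.Icc 1 N, a n * (n : ℂ) ^ (-s) =
      a 1 + ∑ k ∈ Finset.Ioc 1 N, (k : ℂ) ^ (-s) * a' k := by
    rw [← Finset.add_sum_Ioc_eq_sum_Icc hN]
    simp only [Nat.cast_one, Complex.one_cpow, mul_one]
    congr 1
    refine Finset.sum_congr rfl fun k hk => ?_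
    simp only [ha']
    rw [if_neg, mul_comm]; simp at hk; omega
  rw [hS, HH, hsplit, habel]
  ring

lemma norm_HH_le_rpow {ε : ℝ} (hε : 0 < ε) (hε2 : ε ≤ 1 / 2) :
    ∃ K : ℝ, 1 ≤ K ∧ ∀ (a : ℕ → ℂ) (c : ℂ) (Q : ℝ), (∀ n, ‖a n‖ ≤ 1) → ‖c‖ ≤ 1 → 1 ≤ Q →
      (∀ u : ℝ, 1 ≤ u → ‖Er a c u‖ ≤ Q) → ∀ s : ℂ, 1 - ε ≤ s.re → s.re ≤ 3 →
        ‖HH a c s‖ ≤ K * (Q * (1 + |s.im|)) ^ (2 * ε) := by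
  refine ⟨30 * (1 + 1 / ε), ?_, ?_⟩
  · have : 0 < 1 / ε := by positivity
    linarith
  intro a c Q ha hc hQ1 hQ s hs1 hs3
  have hs0 : 0 < s.re := by linarith
  set X : ℝ := Q * (1 + |s.im|) with hX
  have hX1 : 1 ≤ X := by nlinarith [abs_nonneg s.im]
  set N : ℕ := ⌈X⌉₊ with hN
  have hNX : X ≤ N := Nat.le_ceil X
  have hN1r : (1 : ℝ) ≤ N := hX1.trans hNX
  have hN1 : 1 ≤ N := by exact_mod_cast hN1r
  have hN2 : (N : ℝ) ≤ 2 * X := by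
    have := Nat.ceil_lt_add_one (by linarith : 0 ≤ X)
    linarith
  have hN0 : (0 : ℝ) < N := by linarith
  have hNε : 1 ≤ (N : ℝ) ^ ε := one_le_rpow hN1r hε.le
  have hlog0 : 0 ≤ Real.log N := Real.log_nonneg hN1r
  set B : ℝ := (N : ℝ) ^ ε * (1 + Real.log N) with hB
  have hNB : (N : ℝ) ^ ε ≤ B := by nlinarith
  have hB1 : 1 ≤ B := hNε.trans hNB
  have hpow : ∀ u : ℝ, 1 ≤ u → u ≤ N → u ^ (-s.re) ≤ (N : ℝ) ^ ε * u⁻¹ := by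
    intro u hu hu2
    have hu0 : 0 < u := by linarith
    calc u ^ (-s.re) ≤ u ^ (ε + -1) := rpow_le_rpow_of_exponent_le hu (by linarith)
      _ = u ^ ε * u⁻¹ := by rw [rpow_add hu0, rpow_neg_one]
      _ ≤ _ := by gcongr
  have hpowN : (N : ℝ) ^ (-s.re) * N ≤ (N : ℝ) ^ ε := by
    have := hpow N hN1r le_rfl
    calc (N : ℝ) ^ (-s.re) * N ≤ (N : ℝ) ^ ε * (N : ℝ)⁻¹ * N := by gcongr
      _ = _ := by field_simp
  -- term 1
  have t1 : ‖∑ n ∈ Finset.Icc 1 N, a n * (n : ℂ) ^ (-s)‖ ≤ B := by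
    calc ‖∑ n ∈ Finset.Icc 1 N, a n * (n : ℂ) ^ (-s)‖
        ≤ ∑ n ∈ Finset.Icc 1 N, ‖a n * (n : ℂ) ^ (-s)‖ := norm_sum_le _ _
      _ ≤ ∑ n ∈ Finset.Icc 1 N, (N : ℝ) ^ ε * (n : ℝ)⁻¹ := by
          refine Finset.sum_le_sum fun n hn => ?_
          rw [Finset.mem_Icc] at hn
          have hn1 : (1 : ℝ) ≤ n := by exact_mod_cast hn.1
          have hn2 : (n : ℝ) ≤ N := by exact_mod_cast hn.2
          rw [norm_mul, Complex.norm_natCast_cpow_of_pos (by omega)]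
          calc ‖a n‖ * (n : ℝ) ^ (-s).re ≤ 1 * ((N : ℝ) ^ ε * (n : ℝ)⁻¹) := by
                gcongr
                · exact ha n
                · exact hpow n hn1 hn2
            _ = _ := one_mul _
      _ = (N : ℝ) ^ ε * ∑ n ∈ Finset.Icc 1 N, (n : ℝ)⁻¹ := by rw [Finset.mul_sum]
      _ ≤ B := by
          rw [hB]; gcongr
          have := harmonic_le_one_add_log N
          rw [harmonic_eq_sum_Icc] at this
          push_cast at this
          exact this
  have t2 : ‖(∑ n ∈ Finset.Icc 1 N, a n) * (N : ℂ) ^ (-s)‖ ≤ B := by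
    rw [norm_mul, Complex.norm_natCast_cpow_of_pos (by omega)]
    have : ‖∑ n ∈ Finset.Icc 1 N, a n‖ ≤ N := by
      calc _ ≤ ∑ n ∈ Finset.Icc 1 N, ‖a n‖ := norm_sum_le _ _
        _ ≤ ∑ n ∈ Finset.Icc 1 N, (1 : ℝ) := Finset.sum_le_sum fun n _ => ha n
        _ = N := by simp
    calc _ ≤ N * (N : ℝ) ^ (-s).re := by gcongr
      _ = (N : ℝ) ^ (-s.re) * N := by rw [Complex.neg_re, mul_comm]
      _ ≤ B := hpowN.trans hNB
  have hsn : ‖s‖ ≤ 3 * (1 + |s.im|) := by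
    have := Complex.norm_le_abs_re_add_abs_im s
    rw [abs_of_pos hs0] at this
    nlinarith [abs_nonneg s.im]
  have t4 : ‖s * ∫ u in Set.Ioi (N : ℝ), Er a c u * (u : ℂ) ^ (-(s + 1))‖ ≤ 6 * B := by
    rw [norm_mul]
    calc _ ≤ (3 * (1 + |s.im|)) * (Q * (N : ℝ) ^ (-s.re) / s.re) := by
          gcongr
          exact norm_integral_Er_le hQ hs0 hN1r
      _ = 3 * (X * (N : ℝ) ^ (-s.re)) / s.re := by rw [hX]; ring
      _ ≤ 3 * ((N : ℝ) * (N : ℝ) ^ (-s.re)) / (1 / 2) := by gcongr; linarith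
      _ ≤ 6 * B := by nlinarith
  have hNB' : (N : ℝ) ^ ε * Real.log N ≤ B := by rw [hB]; nlinarith
  have t3 : ‖c - c * s * ∫ u in Set.Ioc (1 : ℝ) N, (u : ℂ) ^ (-s)‖ ≤ 7 * B := by
    have key : ‖s * ∫ u in Set.Ioc (1 : ℝ) N, (u : ℂ) ^ (-s)‖ ≤ 6 * B := by
      by_cases hs : 1 / 2 ≤ ‖s - 1‖
      · have hne : s ≠ 1 := by
          rintro rfl; norm_num at hs
        have hne' : -s + 1 ≠ 0 := by
          intro h; apply hne; linear_combination -h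
        rw [← intervalIntegral.integral_of_le hN1r, integral_cpow (Or.inr ⟨?_, ?_⟩)]
        · rw [norm_mul, norm_div]
          have e1 : ‖-s + 1‖ = ‖s - 1‖ := by rw [← norm_neg]; congr 1; ring
          have e2 : ‖s‖ ≤ ‖s - 1‖ + 1 := by
            calc ‖s‖ = ‖(s - 1) + 1‖ := by ring_nf
              _ ≤ _ := (norm_add_le _ _).trans (by simp)
          have e3 : ‖((N : ℝ) : ℂ) ^ (-s + 1) - ((1 : ℝ) : ℂ) ^ (-s + 1)‖ ≤ 2 * B := by
            refine (norm_sub_le _ _).trans ?_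
            rw [Complex.norm_cpow_eq_rpow_re_of_pos hN0, Complex.norm_cpow_eq_rpow_re_of_pos one_pos,
              one_rpow]
            have : (N : ℝ) ^ (-s + 1).re ≤ (N : ℝ) ^ ε := by
              apply rpow_le_rpow_of_exponent_le hN1r
              simp; linarith
            linarith
          rw [e1, ← mul_div_assoc, div_le_iff₀ (by linarith)]
          calc _ ≤ (‖s - 1‖ + 1) * (2 * B) := by gcongr
            _ ≤ _ := by nlinarith
        · intro h; apply hne; linear_combination -h
        · rw [Set.uIcc_of_le hN1r]; intro h; linarith [h.1]
      · push Not at hs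
        have e2 : ‖s‖ ≤ 3 / 2 := by
          calc ‖s‖ = ‖(s - 1) + 1‖ := by ring_nf
            _ ≤ ‖s - 1‖ + 1 := (norm_add_le _ _).trans (by simp)
            _ ≤ _ := by linarith
        have e3 : ‖∫ u in Set.Ioc (1 : ℝ) N, (u : ℂ) ^ (-s)‖ ≤ (N : ℝ) ^ ε * Real.log N := by
          calc _ ≤ ∫ u in Set.Ioc (1 : ℝ) N, (N : ℝ) ^ ε * u⁻¹ := by
                refine norm_integral_le_of_norm_le ?_ ?_
                · apply Integrable.const_mul
                  apply IntegrableOn.mono_set (t := Set.Icc (1 : ℝ) N) _ Set.Ioc_subset_Icc_self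
                  apply ContinuousOn.integrableOn_compact isCompact_Icc
                  apply continuousOn_inv₀.mono
                  intro u hu; simp only [Set.mem_compl_iff, Set.mem_singleton_iff]; linarith [hu.1]
                · refine (ae_restrict_iff' measurableSet_Ioc).2 (Eventually.of_forall fun u hu => ?_)
                  rw [Complex.norm_cpow_eq_rpow_re_of_pos (by linarith [hu.1])]
                  exact hpow u hu.1.le hu.2
            _ = _ := by
                rw [integral_const_mul, ← intervalIntegral.integral_of_le hN1r,
                  integral_inv_of_pos one_pos hN0, div_one]
        rw [norm_mul]
        calc _ ≤ 3 / 2 * ((N : ℝ) ^ ε * Real.log N) := by gcongr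
          _ ≤ 6 * B := by linarith
    rw [mul_assoc]
    refine (norm_sub_le _ _).trans ?_
    rw [norm_mul]
    nlinarith [norm_nonneg c, norm_nonneg (s * ∫ u in Set.Ioc (1 : ℝ) N, (u : ℂ) ^ (-s))]
  have htot : ‖HH a c s‖ ≤ 15 * B := by
    rw [HH_eq_trunc hQ hs0 hN1]
    refine (norm_add_le _ _).trans ?_
    have h1 := norm_add_le (∑ n ∈ Finset.Icc 1 N, a n * (n : ℂ) ^ (-s)
      - (∑ n ∈ Finset.Icc 1 N, a n) * (N : ℂ) ^ (-s)) (c - c * s * ∫ u in Set.Ioc (1 : ℝ) N, (u : ℂ) ^ (-s))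
    have h2 := norm_sub_le (∑ n ∈ Finset.Icc 1 N, a n * (n : ℂ) ^ (-s))
      ((∑ n ∈ Finset.Icc 1 N, a n) * (N : ℂ) ^ (-s))
    linarith
  have hBle : B ≤ (1 + 1 / ε) * (N : ℝ) ^ (2 * ε) := by
    have h1 : Real.log N ≤ (N : ℝ) ^ ε / ε := Real.log_le_rpow_div hN0.le hε
    rw [hB, show 2 * ε = ε + ε by ring, rpow_add hN0]
    have h2 : 1 + Real.log N ≤ (1 + 1 / ε) * (N : ℝ) ^ ε := by
      rw [add_mul, one_mul, one_div, inv_mul_eq_div]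
      linarith
    calc _ ≤ (N : ℝ) ^ ε * ((1 + 1 / ε) * (N : ℝ) ^ ε) := by gcongr
      _ = _ := by ring
  have hNpow : (N : ℝ) ^ (2 * ε) ≤ 2 * X ^ (2 * ε) := by
    calc (N : ℝ) ^ (2 * ε) ≤ (2 * X) ^ (2 * ε) := by gcongr
      _ = 2 ^ (2 * ε) * X ^ (2 * ε) := by rw [mul_rpow (by norm_num) (by linarith)]
      _ ≤ 2 ^ (1 : ℝ) * X ^ (2 * ε) := by
          gcongr
          · norm_num
          · linarith
      _ = _ := by rw [rpow_one]
  have hε' : 0 < 1 / ε := by positivity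
  calc ‖HH a c s‖ ≤ 15 * B := htot
    _ ≤ 15 * ((1 + 1 / ε) * (N : ℝ) ^ (2 * ε)) := by gcongr
    _ ≤ 15 * ((1 + 1 / ε) * (2 * X ^ (2 * ε))) := by gcongr
    _ = _ := by ring

end ATR

namespace ATR

lemma periodic_sum_bound {h : ℕ → ℂ} {q : ℕ} (hq : 0 < q) (hp : ∀ n, h (q + n) = h n)
    (hb : ∀ n, ‖h n‖ ≤ 2) (h0 : ∑ k ∈ Finset.range q, h k = 0) (n : ℕ) :
    ‖∑ k ∈ Finset.range n, h k‖ ≤ 2 * (q - 1 : ℝ) := by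
  induction n using Nat.strong_induction_on with
  | _ n ih =>
    by_cases hn : n < q
    · calc _ ≤ ∑ k ∈ Finset.range n, ‖h k‖ := norm_sum_le _ _
        _ ≤ ∑ k ∈ Finset.range n, (2 : ℝ) := Finset.sum_le_sum fun k _ => hb k
        _ = 2 * n := by simp [mul_comm]
        _ ≤ _ := by
          have : (n : ℝ) + 1 ≤ q := by exact_mod_cast hn
          linarith
    · push Not at hn
      obtain ⟨m, rfl⟩ := Nat.exists_eq_add_of_le hn
      rw [Finset.sum_range_add, h0, zero_add]
      simp_rw [hp]
      exact ih m (by omega)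

set_option linter.unusedSectionVars false

variable {q : ℕ} [NeZero q]

open Classical in
/-- density of the character -/
noncomputable def cc (χ : DirichletCharacter ℂ q) : ℂ := if χ = 1 then (q.totient : ℂ) / q else 0

/-- coefficients of the character -/
noncomputable def cf (χ : DirichletCharacter ℂ q) : ℕ → ℂ := fun n => χ n

lemma cc_of_ne {χ : DirichletCharacter ℂ q} (h : χ ≠ 1) : cc χ = 0 := by simp [cc, h]

lemma norm_cc_le (χ : DirichletCharacter ℂ q) : ‖cc χ‖ ≤ 1 := by
  unfold cc
  split_ifs
  · rw [norm_div, Complex.norm_natCast, Complex.norm_natCast]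
    apply div_le_one_of_le₀ _ (Nat.cast_nonneg _)
    exact_mod_cast Nat.totient_le q
  · simp

lemma norm_cf_le (χ : DirichletCharacter ℂ q) (n : ℕ) : ‖cf χ n‖ ≤ 1 := χ.norm_le_one _

lemma sum_range_char (χ : DirichletCharacter ℂ q) :
    ∑ k ∈ Finset.range q, χ (k : ZMod q) = cc χ * q := by
  have h1 : ∑ k ∈ Finset.range q, χ (k : ZMod q) = ∑ a : ZMod q, χ a := by
    obtain ⟨n, rfl⟩ : ∃ n, q = n + 1 := Nat.exists_eq_succ_of_ne_zero (NeZero.ne q)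
    rw [← Fin.sum_univ_eq_sum_range (fun k : ℕ => χ (k : ZMod (n + 1)))]
    refine Finset.sum_congr rfl fun i _ => ?_
    congr 1
    exact Fin.cast_val_eq_self i
  have hq0 : (q : ℂ) ≠ 0 := by exact_mod_cast NeZero.ne q
  rw [h1]
  unfold cc
  split_ifs with h
  · rw [h, MulChar.sum_one_eq_card_units, ZMod.card_units_eq_totient]
    field_simp
  · rw [MulChar.sum_eq_zero_of_ne_one h, zero_mul]

lemma Er_char_le (χ : DirichletCharacter ℂ q) (u : ℝ) (hu : 1 ≤ u) :
    ‖Er (cf χ) (cc χ) u‖ ≤ 2 * q := by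
  have hq0 : (q : ℂ) ≠ 0 := by exact_mod_cast NeZero.ne q
  have hqp : 0 < q := Nat.pos_of_ne_zero (NeZero.ne q)
  set h : ℕ → ℂ := fun k => χ ((k + 1 : ℕ) : ZMod q) - cc χ with hh
  have hb := periodic_sum_bound (h := h) hqp (fun n => by
      simp only [hh]; push_cast; simp) (fun n => by
      refine (norm_sub_le _ _).trans ?_
      have := χ.norm_le_one ((n + 1 : ℕ) : ZMod q)
      have := norm_cc_le χ
      linarith) (by
      have e := Finset.sum_range_succ' (fun k : ℕ => χ (k : ZMod q)) q
      rw [Finset.sum_range_succ, sum_range_char] at e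
      simp only [hh, Finset.sum_sub_distrib, Finset.sum_const, Finset.card_range, nsmul_eq_mul]
      simp only [ZMod.natCast_self, Nat.cast_zero] at e
      linear_combination -e) ⌊u⌋₊
  have hE : Er (cf χ) (cc χ) u = ∑ k ∈ Finset.range ⌊u⌋₊, h k - cc χ * ((u - ⌊u⌋₊ : ℝ) : ℂ) := by
    have : ∑ k ∈ Finset.Icc 1 ⌊u⌋₊, cf χ k = ∑ k ∈ Finset.range ⌊u⌋₊, χ ((k + 1 : ℕ) : ZMod q) := by
      rw [Finset.range_eq_Ico, Finset.sum_Ico_add' (fun k : ℕ => χ (k : ZMod q)) 0 _ 1]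
      rfl
    rw [Er, this]
    simp only [hh, Finset.sum_sub_distrib, Finset.sum_const, Finset.card_range, nsmul_eq_mul]
    push_cast
    ring
  rw [hE]
  refine (norm_sub_le _ _).trans ?_
  rw [norm_mul, Complex.norm_real, Real.norm_of_nonneg (by linarith [Nat.floor_le (by linarith : 0 ≤ u)])]
  have h1 := norm_cc_le χ
  have h2 : u - ⌊u⌋₊ ≤ 1 := by linarith [Nat.lt_floor_add_one u]
  have h3 : 0 ≤ u - ⌊u⌋₊ := by linarith [Nat.floor_le (by linarith : 0 ≤ u)]
  nlinarith [norm_nonneg (cc χ)]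

lemma halfplane_preconnected : IsPreconnected {s : ℂ | 0 < s.re} :=
  (convex_halfSpace_re_gt 0).isPreconnected

lemma halfplane_open (r : ℝ) : IsOpen {s : ℂ | r < s.re} := isOpen_lt continuous_const Complex.continuous_re

/-- regular part of L -/
noncomputable def Hc (χ : DirichletCharacter ℂ q) (s : ℂ) : ℂ := HH (cf χ) (cc χ) s

lemma Hc_diff (χ : DirichletCharacter ℂ q) {s : ℂ} (hs : 0 < s.re) : DifferentiableAt ℂ (Hc χ) s :=
  differentiableAt_HH (Er_char_le χ) hs

lemma Hc_diffOn (χ : DirichletCharacter ℂ q) : DifferentiableOn ℂ (Hc χ) {s | 0 < s.re} :=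
  fun _ hs => (Hc_diff χ hs).differentiableWithinAt

lemma LSeries_eq_Hc (χ : DirichletCharacter ℂ q) {s : ℂ} (hs : 1 < s.re) :
    LSeries (fun n => χ n) s = cc χ / (s - 1) + Hc χ s :=
  LSeries_eq_HH (norm_cf_le χ) (Er_char_le χ) hs

lemma LFunction_eq_Hc {χ : DirichletCharacter ℂ q} (hχ : χ ≠ 1) {s : ℂ} (hs : 0 < s.re) :
    DirichletCharacter.LFunction χ s = Hc χ s := by
  have h1 : AnalyticOnNhd ℂ (DirichletCharacter.LFunction χ) {s : ℂ | 0 < s.re} :=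
    ((DirichletCharacter.differentiable_LFunction hχ).differentiableOn).analyticOnNhd (halfplane_open 0)
  have h2 : AnalyticOnNhd ℂ (Hc χ) {s : ℂ | 0 < s.re} :=
    (Hc_diffOn χ).analyticOnNhd (halfplane_open 0)
  refine h1.eqOn_of_preconnected_of_eventuallyEq h2 halfplane_preconnected (z₀ := 2) (by simp) ?_ hs
  filter_upwards [(halfplane_open 1).mem_nhds (show (2 : ℂ) ∈ {s : ℂ | 1 < s.re} by simp)] with z hz
  rw [DirichletCharacter.LFunction_eq_LSeries χ hz, LSeries_eq_Hc χ hz, cc_of_ne hχ]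
  simp

lemma norm_Hc_le (χ : DirichletCharacter ℂ q) {s : ℂ} (hs : 1 / 2 ≤ s.re) :
    ‖Hc χ s‖ ≤ 1 + 4 * ‖s‖ * q := by
  refine (norm_HH_le (Er_char_le χ) (by linarith)).trans ?_
  have : ‖s‖ * (2 * q) / s.re ≤ ‖s‖ * (2 * q) / (1 / 2) := by gcongr
  have := norm_cc_le χ
  linarith

lemma norm_Hc_le_rpow {ε : ℝ} (hε : 0 < ε) (hε2 : ε ≤ 1 / 2) :
    ∃ K : ℝ, 1 ≤ K ∧ ∀ (q : ℕ) [NeZero q] (χ : DirichletCharacter ℂ q), ∀ s : ℂ, 1 - ε ≤ s.re → s.re ≤ 3 →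
        ‖Hc χ s‖ ≤ K * (q * (2 + |s.im|)) ^ (2 * ε) := by
  obtain ⟨K, hK, h⟩ := norm_HH_le_rpow hε hε2
  refine ⟨K * 2 ^ (2 * ε), ?_, ?_⟩
  · have : (1 : ℝ) ≤ 2 ^ (2 * ε) := one_le_rpow (by norm_num) (by linarith)
    nlinarith
  intro q _ χ s h1 h2
  have hq1 : (1 : ℝ) ≤ q := by exact_mod_cast Nat.pos_of_ne_zero (NeZero.ne q)
  refine (h (cf χ) (cc χ) (2 * q) (norm_cf_le χ) (norm_cc_le χ) (by linarith) (Er_char_le χ) s h1 h2).trans ?_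
  rw [mul_assoc K (2 ^ (2 * ε))]
  refine mul_le_mul_of_nonneg_left ?_ (by linarith)
  rw [← mul_rpow (by norm_num) (by positivity)]
  refine rpow_le_rpow (by positivity) ?_ (by linarith)
  nlinarith [abs_nonneg s.im]

end ATR

namespace ATR

lemma iteratedDeriv_inv_sub (m : ℕ) :
    iteratedDeriv m (fun s : ℂ => (s - 1)⁻¹) 2 = (-1) ^ m * (m.factorial : ℂ) := by
  rw [iteratedDeriv_comp_sub_const (f := fun s : ℂ => s⁻¹)]
  simp only
  rw [iteratedDeriv_eq_iterate, iter_deriv_inv]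
  norm_num

open ComplexOrder in
/-- Estermann's lemma. -/
lemma estermann {P h : ℂ → ℂ} {B B₁ c₀ β : ℝ} {M : ℕ}
    (hP : DifferentiableOn ℂ P {s | 0 < s.re}) (hh : DifferentiableOn ℂ h {s | 0 < s.re})
    (hB : ∀ s ∈ Metric.sphere (2 : ℂ) (3 / 2), ‖P s‖ ≤ B)
    (hB₁ : ∀ s ∈ Metric.sphere (2 : ℂ) (3 / 2), ‖h s‖ ≤ B₁) (hP1 : ‖P 1‖ ≤ B)
    (halt : ∀ m : ℕ, 0 ≤ (-1) ^ m * iteratedDeriv m (fun s => P s * ((s - 1)⁻¹ + h s)) 2)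
    (hc₀ : c₀ ≤ (P 2 * ((2 - 1 : ℂ)⁻¹ + h 2)).re) (hβ : 7 / 8 ≤ β) (hβ1 : β < 1)
    (hM : 4 * ((4 + B₁) * B) * (3 / 4) ^ M ≤ c₀ / 2) (hM1 : 1 ≤ M)
    (hF : (P β * (((β : ℂ) - 1)⁻¹ + h β)).re ≤ 0) :
    c₀ / 2 * (1 - β) ≤ (P 1).re * (2 - β) ^ M := by
  set U : Set ℂ := {s | 0 < s.re} with hU
  have hUo : IsOpen U := halfplane_open 0
  set G : ℂ → ℂ := fun s => dslope P 1 s + P s * h s with hG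
  have h1U : (1 : ℂ) ∈ U := by simp [hU]
  have hGd : DifferentiableOn ℂ G U :=
    ((Complex.differentiableOn_dslope (hUo.mem_nhds h1U)).2 hP).add (hP.mul hh)
  have hGF : ∀ s : ℂ, s ≠ 1 → G s = P s * ((s - 1)⁻¹ + h s) - P 1 * (s - 1)⁻¹ := by
    intro s hs
    simp only [hG]
    rw [dslope_of_ne _ hs, slope_def_field, div_eq_mul_inv]
    ring
  have hball : Metric.ball (2 : ℂ) 2 ⊆ U := by
    intro s hs
    rw [Metric.mem_ball, dist_eq_norm] at hs
    have := Complex.abs_re_le_norm (s - 2)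
    simp only [Complex.sub_re, Complex.re_ofNat] at this
    have := (abs_lt.1 (lt_of_le_of_lt this hs)).1
    simp only [hU, Set.mem_setOf_eq]; linarith
  have hB0 : 0 ≤ B := (norm_nonneg _).trans hP1
  have hGb : ∀ s ∈ Metric.sphere (2 : ℂ) (3 / 2), ‖G s‖ ≤ (4 + B₁) * B := by
    intro s hs
    have hs' : ‖s - 2‖ = 3 / 2 := by simpa [dist_eq_norm] using hs
    have hs1 : 1 / 2 ≤ ‖s - 1‖ := by
      have : ‖s - 2‖ ≤ ‖s - 1‖ + 1 := by
        calc ‖s - 2‖ = ‖(s - 1) + (-1)‖ := by ring_nf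
          _ ≤ _ := (norm_add_le _ _).trans (by simp)
      linarith
    have hne : s ≠ 1 := by rintro rfl; norm_num at hs1
    simp only [hG]
    rw [dslope_of_ne _ hne, slope_def_field]
    refine (norm_add_le _ _).trans ?_
    rw [norm_div, norm_mul]
    have e1 : ‖P s - P 1‖ / ‖s - 1‖ ≤ (B + B) / (1 / 2) := by
      gcongr
      exact (norm_sub_le _ _).trans (add_le_add (hB s hs) hP1)
    have e2 : ‖P s‖ * ‖h s‖ ≤ B * B₁ := by
      gcongr
      · exact hB s hs
      · exact hB₁ s hs
    linarith
  have hcauchy : ∀ m : ℕ, ‖iteratedDeriv m G 2‖ ≤ m.factorial * ((4 + B₁) * B) / (3 / 2) ^ m := by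
    intro m
    refine Complex.norm_iteratedDeriv_le_of_forall_mem_sphere_norm_le m (by norm_num) ?_ hGb
    apply DifferentiableOn.diffContOnCl
    rw [closure_ball _ (by norm_num)]
    exact hGd.mono ((Metric.closedBall_subset_ball (by norm_num)).trans hball)
  -- decomposition of derivatives
  set F : ℂ → ℂ := fun s => P s * ((s - 1)⁻¹ + h s) with hFdef
  have hev : ∀ᶠ s in 𝓝 (2 : ℂ), G s = F s - P 1 * (s - 1)⁻¹ := by
    filter_upwards [isOpen_ne.mem_nhds (show (2 : ℂ) ≠ 1 by norm_num)] with s hs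
    exact hGF s hs
  have hGm : ∀ m : ℕ, iteratedDeriv m G 2 = iteratedDeriv m F 2 - P 1 * ((-1) ^ m * m.factorial) := by
    intro m
    have hanF : AnalyticAt ℂ F 2 := by
      have a1 : AnalyticAt ℂ P 2 := (hP.analyticOnNhd hUo) 2 (by simp [hU])
      have a2 : AnalyticAt ℂ h 2 := (hh.analyticOnNhd hUo) 2 (by simp [hU])
      have a3 : AnalyticAt ℂ (fun s : ℂ => (s - 1)⁻¹) 2 :=
        (analyticAt_id.sub analyticAt_const).inv (by norm_num)
      exact a1.mul (a3.add a2)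
    have a3 : AnalyticAt ℂ (fun s : ℂ => (s - 1)⁻¹) 2 :=
        (analyticAt_id.sub analyticAt_const).inv (by norm_num)
    rw [Filter.EventuallyEq.iteratedDeriv_eq m hev]
    have a4 : AnalyticAt ℂ (fun s : ℂ => P 1 * (s - 1)⁻¹) 2 := analyticAt_const.mul a3
    rw [iteratedDeriv_fun_sub hanF.contDiffAt a4.contDiffAt,
      iteratedDeriv_const_mul_field, iteratedDeriv_inv_sub]
  have hβ2 : 0 < 2 - β := by linarith
  have hsum := Complex.hasSum_taylorSeries_on_ball (hGd.mono hball) (z := (β : ℂ)) (by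
    rw [Metric.mem_ball, dist_eq_norm, ← Complex.ofReal_ofNat, ← Complex.ofReal_sub, Complex.norm_real,
      Real.norm_eq_abs, abs_lt]
    constructor <;> linarith)
  set g : ℕ → ℝ := fun m => (((m.factorial : ℂ))⁻¹ * ((-1) ^ m * iteratedDeriv m G 2)).re with hg
  have hsumr : HasSum (fun m => (2 - β) ^ m * g m) (G β).re := by
    have := Complex.hasSum_re hsum
    convert this using 2 with m
    rw [hg]
    simp only [smul_eq_mul]
    rw [← Complex.re_ofReal_mul]
    congr 1
    have : ((β : ℂ) - 2) ^ m = (-1) ^ m * (2 - (β : ℂ)) ^ m := by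
      rw [← mul_pow]; ring_nf
    rw [this]; push_cast; ring
  have hg1 : ∀ m, g m = (((m.factorial : ℂ))⁻¹ * ((-1) ^ m * iteratedDeriv m F 2)).re - (P 1).re := by
    intro m
    simp only [hg]
    rw [hGm, ← Complex.sub_re]
    congr 1
    have : (m.factorial : ℂ) ≠ 0 := by exact_mod_cast m.factorial_ne_zero
    have h2 : ((-1 : ℂ) ^ m) * (-1) ^ m = 1 := by rw [← mul_pow]; simp
    field_simp
    linear_combination (-(m.factorial : ℂ) * P 1) * h2
  have hglow : ∀ m, -(P 1).re ≤ g m := by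
    intro m
    rw [hg1]
    have : 0 ≤ ((m.factorial : ℂ))⁻¹ * ((-1) ^ m * iteratedDeriv m F 2) := by
      apply mul_nonneg _ (halt m)
      rw [← Complex.ofReal_natCast, ← Complex.ofReal_inv]
      exact Complex.zero_le_real.2 (by positivity)
    have := (Complex.le_def.1 this).1
    simp only [Complex.zero_re] at this
    linarith
  have hg0 : c₀ - (P 1).re ≤ g 0 := by
    rw [hg1]; simp only [Nat.factorial_zero, Nat.cast_one, inv_one, pow_zero, one_mul, iteratedDeriv_zero]
    have : c₀ ≤ (F 2).re := hc₀
    linarith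
  set D := (4 + B₁) * B with hD
  have hgtail : ∀ m, -(D * (2 / 3) ^ m) ≤ g m := by
    intro m
    have h1 : |g m| ≤ D * (2 / 3) ^ m := by
      refine (Complex.abs_re_le_norm _).trans ?_
      rw [norm_mul, norm_mul, norm_inv, Complex.norm_natCast, norm_pow, norm_neg, norm_one, one_pow,
        one_mul]
      have hf : (0 : ℝ) < m.factorial := by exact_mod_cast m.factorial_pos
      calc _ ≤ (m.factorial : ℝ)⁻¹ * (m.factorial * D / (3 / 2) ^ m) := by gcongr; exact hcauchy m
        _ = D / (3 / 2) ^ m := by field_simp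
        _ = _ := by
          rw [show (2 / 3 : ℝ) = (3 / 2)⁻¹ by norm_num, inv_pow, div_eq_mul_inv]
    exact (abs_le.1 h1).1
  have hD0 : 0 ≤ D := by
    have h2 := hGb (7 / 2) (by simp [dist_eq_norm]; norm_num)
    exact (norm_nonneg _).trans h2
  -- split the sum
  have hsplit := hsumr.summable.sum_add_tsum_nat_add M
  rw [hsumr.tsum_eq] at hsplit
  have hsm2 : Summable (fun m : ℕ => -(D * (3 / 4) ^ M) * (3 / 4 : ℝ) ^ m) :=
    (summable_geometric_of_lt_one (by norm_num) (by norm_num)).mul_left _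
  have htail : -(4 * D * (3 / 4) ^ M) ≤ ∑' m, (2 - β) ^ (m + M) * g (m + M) := by
    have : ∑' m : ℕ, -(D * (3 / 4) ^ M) * (3 / 4 : ℝ) ^ m = -(4 * D * (3 / 4) ^ M) := by
      rw [tsum_mul_left, tsum_geometric_of_lt_one (by norm_num) (by norm_num)]
      ring
    rw [← this]
    refine hsm2.tsum_le_tsum (fun m => ?_) ((summable_nat_add_iff M).2 hsumr.summable)
    have h3 : (2 - β) ^ (m + M) * -(D * (2 / 3) ^ (m + M)) ≤ (2 - β) ^ (m + M) * g (m + M) := by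
      gcongr
      exact hgtail _
    refine le_trans ?_ h3
    have h4 : ((2 - β) * (2 / 3)) ^ (m + M) ≤ (3 / 4) ^ (m + M) := by
      gcongr; linarith
    rw [mul_pow] at h4
    have h5 : D * ((2 - β) ^ (m + M) * (2 / 3) ^ (m + M)) ≤ D * (3 / 4) ^ (m + M) := by gcongr
    rw [pow_add (3 / 4 : ℝ)] at h5
    linarith
  have hhead : c₀ - (P 1).re * (((2 - β) ^ M - 1) / (1 - β)) ≤ ∑ m ∈ Finset.range M, (2 - β) ^ m * g m := by
    have e1 : ∑ m ∈ Finset.range M, (2 - β) ^ m = ((2 - β) ^ M - 1) / (1 - β) := by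
      rw [geom_sum_eq (by linarith)]; congr 1; ring
    rw [← e1]
    obtain ⟨M', rfl⟩ : ∃ M', M = M' + 1 := ⟨M - 1, by omega⟩
    rw [Finset.sum_range_succ', Finset.sum_range_succ']
    have : ∑ m ∈ Finset.range M', (2 - β) ^ (m + 1) * -(P 1).re ≤
        ∑ m ∈ Finset.range M', (2 - β) ^ (m + 1) * g (m + 1) := by
      refine Finset.sum_le_sum fun m _ => ?_
      gcongr
      exact hglow _
    rw [← Finset.sum_mul] at this
    simp only [pow_zero, one_mul]
    linarith
  have hGβ : (G β).re = (F β).re + (P 1).re / (1 - β) := by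
    have hne : (β : ℂ) ≠ 1 := by exact_mod_cast hβ1.ne
    rw [hGF _ hne, Complex.sub_re]
    have : P 1 * ((β : ℂ) - 1)⁻¹ = (((β - 1)⁻¹ : ℝ) : ℂ) * P 1 := by push_cast; ring
    rw [this, Complex.re_ofReal_mul]
    have e : (β - 1)⁻¹ = -(1 - β)⁻¹ := by rw [← inv_neg]; congr 1; ring
    rw [e]; simp only [hFdef]; rw [div_eq_mul_inv]; ring
  have hfin : c₀ / 2 ≤ (P 1).re * (2 - β) ^ M / (1 - β) := by
    have : (F β).re ≤ 0 := hF
    have e : (P 1).re * (((2 - β) ^ M - 1) / (1 - β)) = (P 1).re * (2 - β) ^ M / (1 - β) - (P 1).re / (1 - β) := by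
      ring
    linarith
  rwa [le_div_iff₀ (by linarith)] at hfin

end ATR

namespace ATR

variable {q : ℕ} [NeZero q]

open ComplexOrder in
lemma alt_of_log {F k : ℂ → ℂ} (hF : AnalyticAt ℂ F 2) (hk : AnalyticAt ℂ k 2)
    (hd : deriv F =ᶠ[𝓝 2] fun s => -(F s * k s)) (h2 : 0 ≤ F 2)
    (hka : ∀ m : ℕ, 0 ≤ (-1) ^ m * iteratedDeriv m k 2) (m : ℕ) :
    0 ≤ (-1) ^ m * iteratedDeriv m F 2 := by
  induction m using Nat.strong_induction_on with
  | _ m ih =>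
    rcases m with _ | m
    · simpa using h2
    · rw [iteratedDeriv_succ', Filter.EventuallyEq.iteratedDeriv_eq m hd, iteratedDeriv_fun_neg,
        iteratedDeriv_fun_mul hF.contDiffAt hk.contDiffAt]
      have : (-1 : ℂ) ^ (m + 1) * -∑ i ∈ Finset.range (m + 1), (m.choose i : ℂ) * iteratedDeriv i F 2 *
            iteratedDeriv (m - i) k 2 = ∑ i ∈ Finset.range (m + 1), (m.choose i : ℂ) *
            (((-1) ^ i * iteratedDeriv i F 2) * ((-1) ^ (m - i) * iteratedDeriv (m - i) k 2)) := by
        rw [pow_succ, mul_neg, Finset.mul_sum, ← Finset.sum_neg_distrib]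
        refine Finset.sum_congr rfl fun i hi => ?_
        have hi' : i ≤ m := by simpa [Nat.lt_succ_iff] using hi
        have : (-1 : ℂ) ^ m = (-1) ^ i * (-1) ^ (m - i) := by rw [← pow_add]; congr 1; omega
        rw [this]; ring
      rw [this]
      refine Finset.sum_nonneg fun i hi => ?_
      have hi' : i < m + 1 := by simpa using hi
      refine mul_nonneg (by exact_mod_cast Nat.zero_le _) (mul_nonneg (ih i hi') (hka _))

lemma quad_cases {χ : DirichletCharacter ℂ q} (h : χ ^ 2 = 1) (a : ZMod q) :
    χ a = 0 ∨ χ a = 1 ∨ χ a = -1 :=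
  (MulChar.isQuadratic_iff_sq_eq_one.2 h) a

open ComplexOrder in
lemma quad_nonneg {χ : DirichletCharacter ℂ q} (h : χ ^ 2 = 1) (a : ZMod q) : 0 ≤ 1 + χ a := by
  rcases quad_cases h a with h | h | h <;> rw [h] <;> norm_num

lemma quad_conj {χ : DirichletCharacter ℂ q} (h : χ ^ 2 = 1) (a : ZMod q) :
    (starRingEnd ℂ) (χ a) = χ a := by
  rcases quad_cases h a with h | h | h <;> rw [h] <;> simp

lemma cc_conj (χ : DirichletCharacter ℂ q) : (starRingEnd ℂ) (cc χ) = cc χ := by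
  unfold cc; split_ifs <;> simp

lemma Hc_conj {χ : DirichletCharacter ℂ q} (h : χ ^ 2 = 1) (x : ℝ) :
    (starRingEnd ℂ) (Hc χ x) = Hc χ x := by
  unfold Hc HH
  rw [map_add, map_mul, cc_conj, ← integral_conj, Complex.conj_ofReal]
  congr 2
  refine setIntegral_congr_fun measurableSet_Ioi fun u hu => ?_
  have hu1 : (1 : ℝ) < u := hu
  simp only [map_mul]
  congr 1
  · unfold Er cf
    simp only [map_sub, map_sum, map_mul, cc_conj, quad_conj h, Complex.conj_ofReal]
  · have : (u : ℂ) ^ (-((x : ℂ) + 1)) = ((u ^ (-(x + 1)) : ℝ) : ℂ) := by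
      rw [Complex.ofReal_cpow (by linarith)]; push_cast; rfl
    rw [this, Complex.conj_ofReal]

lemma Hc_ofReal {χ : DirichletCharacter ℂ q} (h : χ ^ 2 = 1) (x : ℝ) :
    Hc χ x = ((Hc χ x).re : ℂ) := (Complex.conj_eq_iff_re.1 (Hc_conj h x)).symm

lemma LSeries_two_near (χ : DirichletCharacter ℂ q) :
    ‖LSeries (fun n => χ n) 2 - 1‖ ≤ 3 / 4 := by
  have hs : LSeriesSummable (fun n => χ n) 2 := χ.LSeriesSummable_of_one_lt_re (by simp)
  have h1 := hasSum_zeta_two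
  have e1 := hs.tsum_eq_add_tsum_ite 1
  have e2 := h1.summable.tsum_eq_add_tsum_ite 1
  rw [h1.tsum_eq] at e2
  have t1 : LSeries.term (fun n => χ n) 2 1 = 1 := by
    rw [LSeries.term_of_ne_zero one_ne_zero]; simp
  unfold LSeries
  rw [e1, t1, add_sub_cancel_left]
  have hs2 : Summable (fun n : ℕ => if n = 1 then 0 else 1 / (n : ℝ) ^ 2) := by
    refine Summable.of_nonneg_of_le (fun n => ?_) (fun n => ?_) h1.summable
    · split_ifs <;> positivity
    · split_ifs
      · positivity
      · exact le_rfl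
  refine (tsum_of_norm_bounded hs2.hasSum (fun n => ?_)).trans ?_
  · split_ifs with h
    · simp
    · rcases eq_or_ne n 0 with rfl | hn
      · simp
      · rw [LSeries.term_of_ne_zero hn, norm_div]
        have : ‖((n : ℂ) ^ (2 : ℂ))‖ = (n : ℝ) ^ 2 := by
          rw [show (2 : ℂ) = ((2 : ℕ) : ℂ) by norm_num, Complex.cpow_natCast, norm_pow, Complex.norm_natCast]
        rw [this]
        gcongr
        exact χ.norm_le_one _
  · have := Real.pi_lt_d2
    have h3 := Real.pi_pos
    simp only [Nat.cast_one] at e2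
    nlinarith

/-- product character -/
noncomputable def pr {q₁ q₂ : ℕ} (χ₁ : DirichletCharacter ℂ q₁) (χ₂ : DirichletCharacter ℂ q₂) :
    DirichletCharacter ℂ (q₁ * q₂) :=
  DirichletCharacter.changeLevel (dvd_mul_right q₁ q₂) χ₁ *
    DirichletCharacter.changeLevel (dvd_mul_left q₂ q₁) χ₂

lemma pr_apply {q₁ q₂ : ℕ} (χ₁ : DirichletCharacter ℂ q₁) (χ₂ : DirichletCharacter ℂ q₂) (n : ℕ) :
    pr χ₁ χ₂ n = χ₁ n * χ₂ n := by
  unfold pr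
  rw [MulChar.mul_apply]
  by_cases h : IsUnit (n : ZMod (q₁ * q₂))
  · obtain ⟨u, hu⟩ := h
    rw [← hu, DirichletCharacter.changeLevel_eq_cast_of_dvd, DirichletCharacter.changeLevel_eq_cast_of_dvd,
      hu, ZMod.cast_natCast (dvd_mul_right q₁ q₂), ZMod.cast_natCast (dvd_mul_left q₂ q₁)]
  · rw [MulChar.map_nonunit _ h, zero_mul]
    rw [ZMod.isUnit_iff_coprime, Nat.Coprime.eq_1, ] at h
    by_cases h1 : IsUnit (n : ZMod q₁)
    · by_cases h2 : IsUnit (n : ZMod q₂)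
      · rw [ZMod.isUnit_iff_coprime] at h1 h2
        exact absurd (Nat.Coprime.mul_right h1 h2) h
      · rw [MulChar.map_nonunit _ h2, mul_zero]
    · rw [MulChar.map_nonunit _ h1, zero_mul]

lemma pr_sq {q₁ q₂ : ℕ} {χ₁ : DirichletCharacter ℂ q₁} {χ₂ : DirichletCharacter ℂ q₂}
    (h1 : χ₁ ^ 2 = 1) (h2 : χ₂ ^ 2 = 1) : pr χ₁ χ₂ ^ 2 = 1 := by
  unfold pr
  rw [mul_pow, ← map_pow, ← map_pow, h1, h2, map_one, map_one, one_mul]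

lemma LSeries_an (χ : DirichletCharacter ℂ q) {s : ℂ} (hs : 1 < s.re) :
    AnalyticAt ℂ (LSeries (fun n => χ n)) s := by
  apply LSeries_analyticOnNhd
  simp only [Set.mem_setOf_eq]
  rw [DirichletCharacter.absicssaOfAbsConv_eq_one (NeZero.ne q)]
  exact_mod_cast hs

lemma quad_L2 {χ : DirichletCharacter ℂ q} (h : χ ^ 2 = 1) :
    ∃ r : ℝ, 1 / 4 ≤ r ∧ LSeries (fun n => χ n) 2 = r := by
  have h1 := LSeries_eq_Hc χ (s := 2) (by simp)
  refine ⟨(LSeries (fun n => χ n) 2).re, ?_, ?_⟩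
  · have := (Complex.abs_re_le_norm _).trans (LSeries_two_near χ)
    have := (abs_le.1 this).1
    simp only [Complex.sub_re, Complex.one_re] at this
    linarith
  · apply (Complex.conj_eq_iff_re.1 _).symm
    have h3 := Hc_conj h 2
    simp only [Complex.ofReal_ofNat] at h3
    rw [h1, map_add, h3, map_div₀, cc_conj, show (2 - 1 : ℂ) = 1 by norm_num, map_one]

end ATR

namespace ATR

/-- the trivial character mod 1 -/
noncomputable abbrev tr : DirichletCharacter ℂ 1 := 1

lemma cc_tr : cc tr = 1 := by simp [cc, tr]

/-- von Mangoldt twisted -/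
noncomputable abbrev vm {q : ℕ} (χ : DirichletCharacter ℂ q) : ℕ → ℂ :=
  (fun n : ℕ => χ n) * fun n : ℕ => ((ArithmeticFunction.vonMangoldt n : ℝ) : ℂ)

lemma deriv_LSeries_eq {q : ℕ} (χ : DirichletCharacter ℂ q) {s : ℂ} (hs : 1 < s.re) :
    deriv (LSeries (fun n => χ n)) s = -(LSeries (fun n => χ n) s * LSeries (vm χ) s) := by
  have h1 := DirichletCharacter.LSeries_twist_vonMangoldt_eq χ hs
  have h2 := χ.LSeries_ne_zero_of_one_lt_re hs
  rw [h1]; field_simp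

lemma vm_abs {q : ℕ} (χ : DirichletCharacter ℂ q) : LSeries.abscissaOfAbsConv (vm χ) ≤ (1 : ℝ) := by
  apply LSeries.abscissaOfAbsConv_le_of_forall_lt_LSeriesSummable
  intro y hy
  exact DirichletCharacter.LSeriesSummable_twist_vonMangoldt χ (by simpa using hy)

lemma vm_an {q : ℕ} (χ : DirichletCharacter ℂ q) {s : ℂ} (hs : 1 < s.re) :
    AnalyticAt ℂ (LSeries (vm χ)) s := by
  apply LSeries_analyticOnNhd
  simp only [Set.mem_setOf_eq]
  exact lt_of_le_of_lt (vm_abs χ) (by exact_mod_cast hs)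

open ComplexOrder in
lemma four_alt {q₁ q₂ : ℕ} [NeZero q₁] [NeZero q₂] {χ₁ : DirichletCharacter ℂ q₁}
    {χ₂ : DirichletCharacter ℂ q₂} (h1 : χ₁ ^ 2 = 1) (h2 : χ₂ ^ 2 = 1) (m : ℕ) :
    0 ≤ (-1) ^ m * iteratedDeriv m (fun s => LSeries (fun n => χ₁ n) s * LSeries (fun n => χ₂ n) s *
      LSeries (fun n => pr χ₁ χ₂ n) s * LSeries (fun n => tr n) s) 2 := by
  have hN : NeZero (q₁ * q₂) := ⟨mul_ne_zero (NeZero.ne q₁) (NeZero.ne q₂)⟩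
  have h2re : (1 : ℝ) < (2 : ℂ).re := by simp
  have hb : ∀ s : ℂ, 1 < s.re → LSeries (vm χ₁ + vm χ₂ + vm (pr χ₁ χ₂) + vm tr) s =
      LSeries (vm χ₁) s + LSeries (vm χ₂) s + LSeries (vm (pr χ₁ χ₂)) s + LSeries (vm tr) s := by
    intro s hs
    have s1 := DirichletCharacter.LSeriesSummable_twist_vonMangoldt χ₁ hs
    have s2 := DirichletCharacter.LSeriesSummable_twist_vonMangoldt χ₂ hs
    have s3 := DirichletCharacter.LSeriesSummable_twist_vonMangoldt (pr χ₁ χ₂) hs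
    have s4 := DirichletCharacter.LSeriesSummable_twist_vonMangoldt tr hs
    rw [LSeries_add ((s1.add s2).add s3) s4, LSeries_add (s1.add s2) s3, LSeries_add s1 s2]
  have hab : LSeries.abscissaOfAbsConv (vm χ₁ + vm χ₂ + vm (pr χ₁ χ₂) + vm tr) ≤ (1 : ℝ) := by
    apply LSeries.abscissaOfAbsConv_le_of_forall_lt_LSeriesSummable
    intro y hy
    have hs : 1 < (y : ℂ).re := by simpa using hy
    have s1 := DirichletCharacter.LSeriesSummable_twist_vonMangoldt χ₁ hs
    have s2 := DirichletCharacter.LSeriesSummable_twist_vonMangoldt χ₂ hs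
    have s3 := DirichletCharacter.LSeriesSummable_twist_vonMangoldt (pr χ₁ χ₂) hs
    have s4 := DirichletCharacter.LSeriesSummable_twist_vonMangoldt tr hs
    exact ((s1.add s2).add s3).add s4
  refine alt_of_log (k := LSeries (vm χ₁ + vm χ₂ + vm (pr χ₁ χ₂) + vm tr)) ?_ ?_ ?_ ?_ ?_ m
  · exact (((LSeries_an _ h2re).mul (LSeries_an _ h2re)).mul (LSeries_an _ h2re)).mul (LSeries_an _ h2re)
  · apply LSeries_analyticOnNhd
    exact lt_of_le_of_lt hab (by exact_mod_cast h2re)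
  · filter_upwards [(halfplane_open 1).mem_nhds h2re] with s hs
    rw [hb s hs]
    have d1 := (LSeries_an χ₁ hs).differentiableAt
    have d2 := (LSeries_an χ₂ hs).differentiableAt
    have d3 := (LSeries_an (pr χ₁ χ₂) hs).differentiableAt
    have d4 := (LSeries_an tr hs).differentiableAt
    have hd := ((d1.hasDerivAt.mul d2.hasDerivAt).mul d3.hasDerivAt).mul d4.hasDerivAt
    rw [deriv_LSeries_eq _ hs, deriv_LSeries_eq _ hs, deriv_LSeries_eq _ hs, deriv_LSeries_eq _ hs] at hd
    refine hd.deriv.trans ?_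
    simp only [Pi.mul_apply]
    ring
  · obtain ⟨r1, hr1, e1⟩ := quad_L2 h1
    obtain ⟨r2, hr2, e2⟩ := quad_L2 h2
    obtain ⟨r3, hr3, e3⟩ := quad_L2 (pr_sq h1 h2)
    obtain ⟨r4, hr4, e4⟩ := quad_L2 (χ := tr) (by simp)
    rw [e1, e2, e3, e4]
    norm_cast
    positivity
  · intro m
    have := LSeries.iteratedDeriv_alternating (a := vm χ₁ + vm χ₂ + vm (pr χ₁ χ₂) + vm tr) ?_ (x := 2) ?_ m
    · simpa using this
    · intro n
      have : (vm χ₁ + vm χ₂ + vm (pr χ₁ χ₂) + vm tr) n =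
          (1 + χ₁ n) * (1 + χ₂ n) * ((ArithmeticFunction.vonMangoldt n : ℝ) : ℂ) := by
        simp only [Pi.add_apply, vm, Pi.mul_apply, pr_apply]
        have : (tr (n : ZMod 1)) = 1 := by
          rw [show (n : ZMod 1) = 1 from Subsingleton.elim _ _]; simp
        rw [this]; ring
      rw [this]
      refine mul_nonneg (mul_nonneg (quad_nonneg h1 _) (quad_nonneg h2 _)) ?_
      exact Complex.zero_le_real.2 ArithmeticFunction.vonMangoldt_nonneg
    · exact lt_of_le_of_lt hab (by norm_num; exact_mod_cast (by norm_num : (1 : ℝ) < 2))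

lemma siegel_core : ∃ c : ℝ, 0 < c ∧ ∀ (q₁ q₂ : ℕ) [NeZero q₁] [NeZero q₂]
    (χ₁ : DirichletCharacter ℂ q₁) (χ₂ : DirichletCharacter ℂ q₂),
    χ₁ ^ 2 = 1 → χ₂ ^ 2 = 1 → χ₁ ≠ 1 → χ₂ ≠ 1 → pr χ₁ χ₂ ≠ 1 → ∀ β : ℝ, 7 / 8 ≤ β → β < 1 →
    (haveI : NeZero (q₁ * q₂) := ⟨mul_ne_zero (NeZero.ne q₁) (NeZero.ne q₂)⟩
    ((Hc χ₁ β * Hc χ₂ β * Hc (pr χ₁ χ₂) β) * (((β : ℂ) - 1)⁻¹ + Hc tr β)).re ≤ 0 →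
    c * (1 - β) * ((q₁ * q₂ : ℕ) : ℝ) ^ (-(8 * (1 - β))) ≤ ‖Hc χ₁ 1‖ * ‖Hc χ₂ 1‖ * ‖Hc (pr χ₁ χ₂) 1‖) := by
  refine ⟨1 / 512 * Real.exp (-14), by positivity, ?_⟩
  intro q₁ q₂ _ _ χ₁ χ₂ h1 h2 n1 n2 n3 β hβ hβ1
  haveI hN : NeZero (q₁ * q₂) := ⟨mul_ne_zero (NeZero.ne q₁) (NeZero.ne q₂)⟩
  intro hF
  set P : ℂ → ℂ := fun s => Hc χ₁ s * Hc χ₂ s * Hc (pr χ₁ χ₂) s with hP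
  set Q : ℝ := ((q₁ * q₂ : ℕ) : ℝ) with hQ
  have hQ1 : 1 ≤ Q := by
    rw [hQ]; exact_mod_cast Nat.one_le_iff_ne_zero.2 (NeZero.ne _)
  have hq1 : (1 : ℝ) ≤ q₁ := by exact_mod_cast Nat.one_le_iff_ne_zero.2 (NeZero.ne _)
  have hq2 : (1 : ℝ) ≤ q₂ := by exact_mod_cast Nat.one_le_iff_ne_zero.2 (NeZero.ne _)
  have hQm : Q = q₁ * q₂ := by rw [hQ]; push_cast; rfl
  set L := Real.log Q with hL
  have hL0 : 0 ≤ L := Real.log_nonneg hQ1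
  have hexpL : Real.exp L = Q := Real.exp_log (by linarith)
  have hHb : ∀ (q : ℕ) [NeZero q] (χ : DirichletCharacter ℂ q) (s : ℂ), 1 / 2 ≤ s.re → ‖s‖ ≤ 7 / 2 →
      ‖Hc χ s‖ ≤ 15 * q := by
    intro q _ χ s hs hs2
    have hq : (1 : ℝ) ≤ q := by exact_mod_cast Nat.one_le_iff_ne_zero.2 (NeZero.ne _)
    have := norm_Hc_le χ hs
    nlinarith
  have hPb : ∀ s : ℂ, 1 / 2 ≤ s.re → ‖s‖ ≤ 7 / 2 → ‖P s‖ ≤ 3375 * Q ^ 2 := by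
    intro s hs hs2
    simp only [hP]
    rw [norm_mul, norm_mul]
    calc _ ≤ (15 * (q₁ : ℝ)) * (15 * q₂) * (15 * Q) := by
          gcongr
          · exact hHb _ _ s hs hs2
          · exact hHb _ _ s hs hs2
          · exact hHb _ _ s hs hs2
      _ = _ := by rw [hQm]; ring
  have hsph : ∀ s ∈ Metric.sphere (2 : ℂ) (3 / 2), 1 / 2 ≤ s.re ∧ ‖s‖ ≤ 7 / 2 := by
    intro s hs
    have hs' : ‖s - 2‖ = 3 / 2 := by simpa [dist_eq_norm] using hs
    constructor
    · have := (abs_le.1 ((Complex.abs_re_le_norm (s - 2)).trans hs'.le)).1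
      simp at this; linarith
    · calc ‖s‖ = ‖(s - 2) + 2‖ := by ring_nf
        _ ≤ ‖s - 2‖ + ‖(2 : ℂ)‖ := norm_add_le _ _
        _ ≤ _ := by rw [hs']; norm_num
  set M : ℕ := ⌈4 * (27 + 2 * L)⌉₊ with hMdef
  have hM1 : 4 * (27 + 2 * L) ≤ M := Nat.le_ceil _
  have hM2 : (M : ℝ) ≤ 109 + 8 * L := by
    have := (Nat.ceil_lt_add_one (show 0 ≤ 4 * (27 + 2 * L) by positivity)).le
    linarith
  have key := estermann (P := P) (h := Hc tr) (B := 3375 * Q ^ 2) (B₁ := 15) (c₀ := 1 / 256) (β := β) (M := M)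
    (((Hc_diffOn _).mul (Hc_diffOn _)).mul (Hc_diffOn _)) (Hc_diffOn _)
    (fun s hs => hPb s (hsph s hs).1 (hsph s hs).2)
    (fun s hs => by simpa using hHb _ tr s (hsph s hs).1 (hsph s hs).2)
    (hPb 1 (by norm_num) (by norm_num)) ?_ ?_ hβ hβ1 ?_ ?_ hF
  · have h3 : (2 - β) ^ M ≤ Real.exp 14 * Q ^ (8 * (1 - β)) := by
      calc (2 - β) ^ M ≤ (Real.exp (1 - β)) ^ M := by
            gcongr
            · linarith
            · have := Real.add_one_le_exp (1 - β); linarith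
        _ = Real.exp (M * (1 - β)) := by rw [← Real.exp_nat_mul]
        _ ≤ Real.exp (14 + L * (8 * (1 - β))) := by
            apply Real.exp_le_exp.2; nlinarith
        _ = _ := by rw [Real.exp_add, Real.rpow_def_of_pos (by linarith)]
    have h4 : (P 1).re ≤ ‖Hc χ₁ 1‖ * ‖Hc χ₂ 1‖ * ‖Hc (pr χ₁ χ₂) 1‖ := by
      refine (Complex.re_le_norm _).trans ?_
      simp only [hP]; rw [norm_mul, norm_mul]
    set R := ‖Hc χ₁ 1‖ * ‖Hc χ₂ 1‖ * ‖Hc (pr χ₁ χ₂) 1‖ with hR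
    have hR0 : 0 ≤ R := by positivity
    have h5 : 1 / 512 * (1 - β) ≤ R * (Real.exp 14 * Q ^ (8 * (1 - β))) := by
      calc _ = 1 / 256 / 2 * (1 - β) := by ring
        _ ≤ _ := key
        _ ≤ R * (2 - β) ^ M := by exact mul_le_mul_of_nonneg_right h4 (pow_nonneg (by linarith) _)
        _ ≤ _ := by gcongr
    rw [Real.rpow_neg (by linarith), Real.exp_neg]
    have e1 : 0 < Real.exp 14 := Real.exp_pos _
    have e2 : 0 < Q ^ (8 * (1 - β)) := Real.rpow_pos_of_pos (by linarith) _
    calc _ = (1 / 512 * (1 - β)) / (Real.exp 14 * Q ^ (8 * (1 - β))) := by field_simp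
      _ ≤ R := by rw [div_le_iff₀ (by positivity)]; exact h5
  · intro m
    have := four_alt h1 h2 m
    rwa [Filter.EventuallyEq.iteratedDeriv_eq (g := fun s => P s * ((s - 1)⁻¹ + Hc tr s))] at this
    filter_upwards [(halfplane_open 1).mem_nhds (show (1 : ℝ) < (2 : ℂ).re by simp)] with s hs
    rw [LSeries_eq_Hc _ hs, LSeries_eq_Hc _ hs, LSeries_eq_Hc _ hs, LSeries_eq_Hc _ hs, cc_of_ne n1, cc_of_ne n2,
      cc_of_ne n3, cc_tr]
    simp [hP]
  · obtain ⟨r1, hr1, e1⟩ := quad_L2 h1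
    obtain ⟨r2, hr2, e2⟩ := quad_L2 h2
    obtain ⟨r3, hr3, e3⟩ := quad_L2 (pr_sq h1 h2)
    obtain ⟨r4, hr4, e4⟩ := quad_L2 (χ := tr) (by simp)
    have h2re : (1 : ℝ) < (2 : ℂ).re := by simp
    rw [LSeries_eq_Hc _ h2re] at e1 e2 e3 e4
    rw [cc_of_ne n1] at e1; rw [cc_of_ne n2] at e2; rw [cc_of_ne n3] at e3; rw [cc_tr] at e4
    simp only [zero_div, zero_add, one_div] at e1 e2 e3 e4
    simp only [hP]
    rw [e1, e2, e3, e4, ← Complex.ofReal_mul, ← Complex.ofReal_mul, ← Complex.ofReal_mul, Complex.ofReal_re]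
    calc (1 / 256 : ℝ) = 1 / 4 * (1 / 4) * (1 / 4) * (1 / 4) := by norm_num
      _ ≤ _ := by gcongr
  · have h6 : (3 / 4 : ℝ) ^ M ≤ Real.exp (-27) * (Q ^ 2)⁻¹ := by
      calc (3 / 4 : ℝ) ^ M ≤ Real.exp (-1 / 4) ^ M := by
            gcongr
            have := Real.add_one_le_exp (-1 / 4); linarith
        _ = Real.exp (M * (-1 / 4)) := by rw [← Real.exp_nat_mul]
        _ ≤ Real.exp (-27 + -((2 : ℕ) * L)) := by
            apply Real.exp_le_exp.2; push_cast; linarith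
        _ = _ := by rw [Real.exp_add, Real.exp_neg (_ * L), Real.exp_nat_mul, hexpL]
    have h7 : Real.exp (-27) ≤ 1 / 2 ^ 27 := by
      rw [Real.exp_neg, ← one_div]
      have h8 : (2 : ℝ) ^ 27 ≤ Real.exp 27 := by
        rw [show (27 : ℝ) = (27 : ℕ) * 1 by norm_num, Real.exp_nat_mul]
        gcongr
        have := Real.add_one_le_exp 1; linarith
      gcongr
    calc 4 * ((4 + 15) * (3375 * Q ^ 2)) * (3 / 4) ^ M
        ≤ 4 * ((4 + 15) * (3375 * Q ^ 2)) * (1 / 2 ^ 27 * (Q ^ 2)⁻¹) := by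
          gcongr; exact h6.trans (by gcongr)
      _ = 4 * 19 * 3375 / 2 ^ 27 := by
          have : Q ≠ 0 := by positivity
          field_simp; norm_num
      _ ≤ _ := by norm_num
  · have : (1 : ℝ) ≤ M := by linarith
    exact_mod_cast this

end ATR

namespace ATR

lemma prod_lower (S : Finset ℕ) (hS : ∀ p ∈ S, 2 ≤ p) :
    1 / ((S.card : ℝ) + 1) ≤ ∏ p ∈ S, (1 - 1 / (p : ℝ)) := by
  induction S using Finset.induction_on_max with
  | empty => simp
  | insert a S ha ih =>
    have haS : a ∉ S := fun h => lt_irrefl _ (ha a h)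
    have ih' := ih (fun p hp => hS p (Finset.mem_insert_of_mem hp))
    have ha2 : 2 ≤ a := hS a (Finset.mem_insert_self _ _)
    have hsub : S ⊆ Finset.Ico 2 a := fun p hp => by
      rw [Finset.mem_Ico]; exact ⟨hS p (Finset.mem_insert_of_mem hp), ha p hp⟩
    have hcard : S.card + 2 ≤ a := by
      have := Finset.card_le_card hsub
      rw [Nat.card_Ico] at this; omega
    have hcard' : (S.card : ℝ) + 2 ≤ a := by exact_mod_cast hcard
    rw [Finset.prod_insert haS, Finset.card_insert_of_notMem haS]
    push_cast
    have h1 : (S.card + 1 : ℝ) / (S.card + 2) ≤ 1 - 1 / a := by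
      have : 1 / (a : ℝ) ≤ 1 / (S.card + 2) := by gcongr
      have e : (S.card + 1 : ℝ) / (S.card + 2) = 1 - 1 / (S.card + 2) := by
        field_simp; ring
      rw [e]; linarith
    calc 1 / ((S.card : ℝ) + 1 + 1) = (S.card + 1 : ℝ) / (S.card + 2) * (1 / (S.card + 1)) := by
          field_simp; ring
      _ ≤ _ := by gcongr; exact le_trans (by positivity) h1

lemma phi_lower {ε : ℝ} (hε : 0 < ε) : ∃ c : ℝ, 0 < c ∧ ∀ N : ℕ, N ≠ 0 →
    c * (N : ℝ) ^ (-ε) ≤ ∏ p ∈ N.primeFactors, (1 - 1 / (p : ℝ)) := by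
  set δ := min 1 (ε * Real.log 2) with hδ
  have hl2 : 0 < Real.log 2 := Real.log_pos (by norm_num)
  have hδ0 : 0 < δ := lt_min one_pos (by positivity)
  refine ⟨δ, hδ0, fun N hN => ?_⟩
  refine le_trans ?_ (prod_lower _ fun p hp => (Nat.prime_of_mem_primeFactors hp).two_le)
  set w := N.primeFactors.card with hw
  have hN0 : (0 : ℝ) < N := by exact_mod_cast Nat.pos_of_ne_zero hN
  have h2 : (2 : ℝ) ^ w ≤ N := by
    have : 2 ^ w ≤ ∏ p ∈ N.primeFactors, p :=
      Finset.pow_card_le_prod _ _ _ fun p hp => (Nat.prime_of_mem_primeFactors hp).two_le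
    exact_mod_cast this.trans (Nat.le_of_dvd (Nat.pos_of_ne_zero hN) (Nat.prod_primeFactors_dvd N))
  have h3 : δ * (w + 1) ≤ (N : ℝ) ^ ε := by
    have hw0 : (0 : ℝ) ≤ w := Nat.cast_nonneg _
    calc δ * (w + 1) ≤ δ * w + 1 := by
          have : δ ≤ 1 := min_le_left _ _
          linarith
      _ ≤ Real.exp (δ * w) := Real.add_one_le_exp _
      _ ≤ Real.exp (ε * Real.log 2 * w) := by
          apply Real.exp_le_exp.2; gcongr; exact min_le_right _ _
      _ = ((2 : ℝ) ^ w) ^ ε := by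
          rw [← Real.rpow_natCast, ← Real.rpow_mul (by norm_num), Real.rpow_def_of_pos (by norm_num)]
          ring_nf
      _ ≤ _ := by gcongr
  rw [Real.rpow_neg hN0.le, le_div_iff₀ (by positivity), mul_right_comm, ← div_eq_mul_inv,
    div_le_one (by positivity)]
  exact h3

/-- quadratic L values are positive to the right of all zeros -/
lemma Hc_re_pos {q : ℕ} [NeZero q] {χ : DirichletCharacter ℂ q} (h : χ ^ 2 = 1) (hne : χ ≠ 1)
    {β : ℝ} (hβ0 : 0 < β) (hβ : β < 1) (hz : ∀ x : ℝ, β ≤ x → x < 1 → Hc χ x ≠ 0) : 0 < (Hc χ β).re := by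
  have hz' : ∀ x : ℝ, β ≤ x → (Hc χ x).re ≠ 0 := by
    intro x hx h0
    have : Hc χ x = 0 := by rw [Hc_ofReal h x, h0]; simp
    by_cases hx1 : x < 1
    · exact hz x hx hx1 this
    · push Not at hx1
      rw [← LFunction_eq_Hc hne (by simp; linarith)] at this
      exact χ.LFunction_ne_zero_of_one_le_re (Or.inl hne) (by simpa using hx1) this
  have h2 : 0 < (Hc χ (2 : ℝ)).re := by
    obtain ⟨r, hr, e⟩ := quad_L2 h
    rw [LSeries_eq_Hc _ (by simp), cc_of_ne hne, zero_div, zero_add] at e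
    simp only [Complex.ofReal_ofNat]
    rw [e]; simp; linarith
  have hcont : ContinuousOn (fun x : ℝ => (Hc χ x).re) (Set.Icc β 2) := by
    intro x hx
    have hd : ContinuousAt (Hc χ) (x : ℂ) := (Hc_diff χ (by simp; linarith [hx.1])).continuousAt
    exact (Complex.continuous_re.continuousAt.comp
      (hd.comp Complex.continuous_ofReal.continuousAt)).continuousWithinAt
  by_contra hcon
  push Not at hcon
  have := intermediate_value_Icc (by linarith : β ≤ 2) hcont
  obtain ⟨x, hx, hx0⟩ := this ⟨hcon, h2.le⟩
  exact hz' x hx.1 hx0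

lemma siegel_aux {ε' : ℝ} (hε' : 0 < ε') (h8 : ε' ≤ 1 / 8) :
    (∃ (q₁ : ℕ) (_ : NeZero q₁) (χ₁ : DirichletCharacter ℂ q₁) (β : ℝ), χ₁ ^ 2 = 1 ∧ χ₁ ≠ 1 ∧ 1 - ε' ≤ β ∧
      β < 1 ∧ ∀ (q₂ : ℕ) [NeZero q₂] [NeZero (q₁ * q₂)] (χ₂ : DirichletCharacter ℂ q₂), χ₂ ^ 2 = 1 → χ₂ ≠ 1 →
      pr χ₁ χ₂ ≠ 1 →
      ((Hc χ₁ β * Hc χ₂ β * Hc (pr χ₁ χ₂) β) * (((β : ℂ) - 1)⁻¹ + Hc tr β)).re ≤ 0) ∨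
    (∀ (q₁ : ℕ) [NeZero q₁] (χ₁ : DirichletCharacter ℂ q₁), χ₁ ^ 2 = 1 → χ₁ = 1) := by
  by_cases hall : ∀ (q₁ : ℕ) [NeZero q₁] (χ₁ : DirichletCharacter ℂ q₁), χ₁ ^ 2 = 1 → χ₁ = 1
  · exact Or.inr hall
  left
  by_cases hz : ∃ (q₁ : ℕ) (_ : NeZero q₁) (χ₁ : DirichletCharacter ℂ q₁) (β : ℝ), χ₁ ^ 2 = 1 ∧ χ₁ ≠ 1 ∧
      1 - ε' ≤ β ∧ β < 1 ∧ Hc χ₁ β = 0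
  · obtain ⟨q₁, i, χ₁, β, h1, h2, h3, h4, h5⟩ := hz
    exact ⟨q₁, i, χ₁, β, h1, h2, h3, h4, fun _ _ _ _ _ _ _ => by rw [h5]; simp⟩
  push Not at hall hz
  obtain ⟨q₁, i, χ₁, h1, h2⟩ := hall
  refine ⟨q₁, i, χ₁, 1 - ε', h1, h2, le_rfl, by linarith, ?_⟩
  intro q₂ _ _ χ₂ h3 h4 h5
  have p1 := Hc_re_pos h1 h2 (β := 1 - ε') (by linarith) (by linarith)
    (fun x hx hx1 => hz q₁ i χ₁ x h1 h2 hx hx1)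
  have p2 := Hc_re_pos h3 h4 (β := 1 - ε') (by linarith) (by linarith)
    (fun x hx hx1 => hz q₂ _ χ₂ x h3 h4 hx hx1)
  have p3 := Hc_re_pos (pr_sq h1 h3) h5 (β := 1 - ε') (by linarith) (by linarith)
    (fun x hx hx1 => hz _ _ _ x (pr_sq h1 h3) h5 hx hx1)
  have p4 : (Hc tr ((1 - ε' : ℝ) : ℂ)).re ≤ 5 := by
    refine (Complex.re_le_norm _).trans ((norm_Hc_le tr (by simp; linarith)).trans ?_)
    rw [Complex.norm_real, Real.norm_eq_abs, abs_of_pos (by linarith)]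
    push_cast; linarith
  rw [Hc_ofReal h1, Hc_ofReal h3, Hc_ofReal (pr_sq h1 h3), Hc_ofReal (χ := tr) (by simp)]
  have e : ((((1 - ε' : ℝ) : ℂ)) - 1)⁻¹ = ((-(1 / ε') : ℝ) : ℂ) := by
    push_cast
    rw [sub_sub_cancel_left, inv_neg, one_div]
  rw [e, ← Complex.ofReal_add, ← Complex.ofReal_mul, ← Complex.ofReal_mul, ← Complex.ofReal_mul, Complex.ofReal_re]
  apply mul_nonpos_of_nonneg_of_nonpos (by positivity)
  have : 8 ≤ 1 / ε' := by
    rw [le_div_iff₀ hε']; linarith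
  linarith

/-- Siegel's theorem. -/
lemma siegel {ε : ℝ} (hε : 0 < ε) : ∃ c : ℝ, 0 < c ∧ ∀ (q : ℕ) [NeZero q] (χ : DirichletCharacter ℂ q),
    χ ^ 2 = 1 → χ ≠ 1 → c * (q : ℝ) ^ (-ε) ≤ ‖Hc χ 1‖ := by
  set ε' := min ε 1 / 10 with hε'
  have hε'0 : 0 < ε' := by
    have : 0 < min ε 1 := lt_min hε one_pos
    positivity
  have hε'1 : ε' ≤ 1 / 8 := by
    have : min ε 1 ≤ 1 := min_le_right _ _
    linarith
  have hε'2 : 10 * ε' ≤ ε := by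
    have : min ε 1 ≤ ε := min_le_left _ _
    linarith
  rcases siegel_aux hε'0 hε'1 with ⟨q₁, i, χ₁, β, h1, n1, hβ, hβ1, hre⟩ | hall
  swap
  · exact ⟨1, one_pos, fun q _ χ h2 h => absurd (hall q χ h2) h⟩
  obtain ⟨c₀, hc₀, hcore⟩ := siegel_core
  obtain ⟨K, hK1, hK⟩ := norm_Hc_le_rpow hε'0 (by linarith)
  obtain ⟨c₁, hc₁, hphi⟩ := phi_lower hε'0
  have hH1 : 0 < ‖Hc χ₁ 1‖ := by
    rw [norm_pos_iff, ← LFunction_eq_Hc n1 (by simp)]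
    exact DirichletCharacter.LFunction_apply_one_ne_zero n1
  have hq1 : (1 : ℝ) ≤ q₁ := by exact_mod_cast Nat.one_le_iff_ne_zero.2 (NeZero.ne _)
  set A : ℝ := c₀ * (1 - β) / (‖Hc χ₁ 1‖ * (K * 2 ^ (2 * ε'))) * (q₁ : ℝ) ^ (-(10 * ε')) with hA
  set B : ℝ := ‖Hc χ₁ 1‖ * c₁ ^ 2 * (q₁ : ℝ) ^ (-(2 * ε')) with hB
  have hA0 : 0 < A := by
    have : 0 < 1 - β := by linarith
    positivity
  have hB0 : 0 < B := by positivity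
  refine ⟨min A B, lt_min hA0 hB0, ?_⟩
  intro q _ χ h2 n2
  haveI hN : NeZero (q₁ * q) := ⟨mul_ne_zero (NeZero.ne q₁) (NeZero.ne q)⟩
  have hq : (1 : ℝ) ≤ q := by exact_mod_cast Nat.one_le_iff_ne_zero.2 (NeZero.ne _)
  by_cases hp : pr χ₁ χ = 1
  · -- same character
    have heq : DirichletCharacter.changeLevel (dvd_mul_right q₁ q) χ₁ =
        DirichletCharacter.changeLevel (dvd_mul_left q q₁) χ := by
      have e1 : DirichletCharacter.changeLevel (dvd_mul_left q q₁) χ ^ 2 = 1 := by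
        rw [← map_pow, h2, map_one]
      unfold pr at hp
      calc _ = DirichletCharacter.changeLevel (dvd_mul_right q₁ q) χ₁ *
            DirichletCharacter.changeLevel (dvd_mul_left q q₁) χ ^ 2 := by rw [e1, mul_one]
        _ = _ := by rw [sq, ← mul_assoc, hp, one_mul]
    have e1 := DirichletCharacter.LFunction_changeLevel (dvd_mul_right q₁ q) χ₁ (s := 1) (Or.inl n1)
    have e2 := DirichletCharacter.LFunction_changeLevel (dvd_mul_left q q₁) χ (s := 1) (Or.inl n2)
    rw [heq, e2, LFunction_eq_Hc n1 (by simp), LFunction_eq_Hc n2 (by simp)] at e1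
    have e3 := congrArg norm e1
    rw [norm_mul, norm_mul, norm_prod, norm_prod] at e3
    set N := q₁ * q with hNdef
    have hterm : ∀ (r : ℕ) (ψ : DirichletCharacter ℂ r), ∀ p ∈ N.primeFactors,
        ‖ψ p * (p : ℂ) ^ (-1 : ℂ)‖ ≤ 1 / p := by
      intro r ψ p hp
      rw [Complex.cpow_neg_one, norm_mul, norm_inv, Complex.norm_natCast, one_div]
      exact mul_le_of_le_one_left (by positivity) (ψ.norm_le_one _)
    have hlow : ∏ p ∈ N.primeFactors, (1 - 1 / (p : ℝ)) ≤
        ∏ p ∈ N.primeFactors, ‖1 - χ₁ p * (p : ℂ) ^ (-1 : ℂ)‖ := by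
      refine Finset.prod_le_prod (fun p hp => ?_) (fun p hp => ?_)
      · have : (2 : ℝ) ≤ p := by exact_mod_cast (Nat.prime_of_mem_primeFactors hp).two_le
        rw [sub_nonneg, div_le_one (by linarith)]; linarith
      · have := norm_sub_norm_le (1 : ℂ) (χ₁ p * (p : ℂ) ^ (-1 : ℂ))
        rw [norm_one] at this
        linarith [hterm _ χ₁ p hp]
    have hup : (∏ p ∈ N.primeFactors, ‖1 - χ p * (p : ℂ) ^ (-1 : ℂ)‖) *
        ∏ p ∈ N.primeFactors, (1 - 1 / (p : ℝ)) ≤ 1 := by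
      rw [← Finset.prod_mul_distrib]
      refine Finset.prod_le_one (fun p hp => ?_) (fun p hp => ?_)
      · have : (2 : ℝ) ≤ p := by exact_mod_cast (Nat.prime_of_mem_primeFactors hp).two_le
        apply mul_nonneg (norm_nonneg _)
        rw [sub_nonneg, div_le_one (by linarith)]; linarith
      · have h2p : (2 : ℝ) ≤ p := by exact_mod_cast (Nat.prime_of_mem_primeFactors hp).two_le
        have := norm_sub_le (1 : ℂ) (χ p * (p : ℂ) ^ (-1 : ℂ))
        rw [norm_one] at this
        have h4 := hterm _ χ p hp
        have h5 : 1 / (p : ℝ) ≤ 1 := by rw [div_le_one (by linarith)]; linarith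
        have h6 : 0 ≤ 1 / (p : ℝ) := by positivity
        calc _ ≤ (1 + 1 / (p : ℝ)) * (1 - 1 / p) := by gcongr <;> linarith
          _ ≤ 1 := by nlinarith
    have hph := hphi N (NeZero.ne N)
    set V := ∏ p ∈ N.primeFactors, (1 - 1 / (p : ℝ)) with hV
    have hNpos : (0 : ℝ) < N := by exact_mod_cast Nat.pos_of_ne_zero (NeZero.ne N)
    have hV0 : 0 < V := lt_of_lt_of_le (by positivity) hph
    have e4 : ‖Hc χ₁ 1‖ * V * V ≤ ‖Hc χ 1‖ := by
      calc ‖Hc χ₁ 1‖ * V * V ≤ ‖Hc χ₁ 1‖ * (∏ p ∈ N.primeFactors, ‖1 - χ₁ p * (p : ℂ) ^ (-1 : ℂ)‖) * V := by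
            gcongr
        _ = ‖Hc χ 1‖ * ((∏ p ∈ N.primeFactors, ‖1 - χ p * (p : ℂ) ^ (-1 : ℂ)‖) * V) := by
            rw [← e3]; ring
        _ ≤ _ := mul_le_of_le_one_right (norm_nonneg _) hup
    calc min A B * (q : ℝ) ^ (-ε) ≤ B * (q : ℝ) ^ (-(2 * ε')) := by
          gcongr
          · exact min_le_right _ _
          · linarith
      _ = ‖Hc χ₁ 1‖ * (c₁ * (N : ℝ) ^ (-ε')) * (c₁ * (N : ℝ) ^ (-ε')) := by
          rw [hB, hNdef]
          push_cast
          rw [Real.mul_rpow (by positivity) (by positivity), show -(2 * ε') = -ε' + -ε' by ring,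
            Real.rpow_add (by linarith), Real.rpow_add (by linarith)]
          ring
      _ ≤ ‖Hc χ₁ 1‖ * V * V := by gcongr
      _ ≤ _ := e4
  · have k1 := hcore q₁ q χ₁ χ h1 h2 n1 n2 hp β (by linarith) hβ1 (hre q χ h2 n2 hp)
    have k2 := hK (q₁ * q) (pr χ₁ χ) 1 (by simp; linarith) (by norm_num)
    simp only [Complex.one_im, abs_zero, add_zero] at k2
    set Q : ℝ := ((q₁ * q : ℕ) : ℝ) with hQ
    have hQ1 : 1 ≤ Q := by rw [hQ]; exact_mod_cast Nat.one_le_iff_ne_zero.2 (NeZero.ne _)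
    have k3 : c₀ * (1 - β) * Q ^ (-(8 * ε')) ≤ ‖Hc χ₁ 1‖ * ‖Hc χ 1‖ * (K * (Q * 2) ^ (2 * ε')) := by
      calc _ ≤ c₀ * (1 - β) * Q ^ (-(8 * (1 - β))) := by
            have : 0 < 1 - β := by linarith
            gcongr
            linarith
        _ ≤ _ := k1
        _ ≤ _ := by gcongr
    rw [Real.mul_rpow (by linarith) (by norm_num)] at k3
    have hQp : 0 < Q ^ (2 * ε') := Real.rpow_pos_of_pos (by linarith) _
    have k4 : c₀ * (1 - β) / (‖Hc χ₁ 1‖ * (K * 2 ^ (2 * ε'))) * Q ^ (-(10 * ε')) ≤ ‖Hc χ 1‖ := by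
      rw [show -(10 * ε') = -(8 * ε') + -(2 * ε') by ring, Real.rpow_add (by linarith),
        Real.rpow_neg (by linarith) (2 * ε')]
      have h2p : (0 : ℝ) < 2 ^ (2 * ε') := by positivity
      calc _ = (c₀ * (1 - β) * Q ^ (-(8 * ε'))) / (‖Hc χ₁ 1‖ * (K * 2 ^ (2 * ε')) * Q ^ (2 * ε')) := by
            field_simp
        _ ≤ _ := by
          rw [div_le_iff₀ (by positivity)]
          linarith
    refine le_trans ?_ k4
    have : Q ^ (-(10 * ε')) = (q₁ : ℝ) ^ (-(10 * ε')) * (q : ℝ) ^ (-(10 * ε')) := by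
      rw [hQ]; push_cast
      rw [Real.mul_rpow (by positivity) (by positivity)]
    rw [this, ← mul_assoc, ← hA]
    gcongr
    exact min_le_left _ _

end ATR

namespace ATR

lemma norm_deriv_Hc_le {ε : ℝ} (hε : 0 < ε) (hε2 : ε ≤ 1 / 2) :
    ∃ K : ℝ, 1 ≤ K ∧ ∀ (q : ℕ) [NeZero q] (χ : DirichletCharacter ℂ q), ∀ s : ℂ, 1 ≤ s.re → s.re ≤ 2 →
        ‖deriv (Hc χ) s‖ ≤ K * (q * (2 + |s.im|)) ^ (2 * ε) := by
  obtain ⟨K, hK1, hK⟩ := norm_Hc_le_rpow hε hε2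
  refine ⟨K * 2 / ε, ?_, ?_⟩
  · rw [le_div_iff₀ hε]; linarith
  intro q _ χ s h1 h2
  have hq : (1 : ℝ) ≤ q := by exact_mod_cast Nat.one_le_iff_ne_zero.2 (NeZero.ne _)
  have hre : ∀ z ∈ Metric.closedBall s ε, 1 - ε ≤ z.re ∧ z.re ≤ 3 ∧ |z.im| ≤ |s.im| + 1 := by
    intro z hz
    rw [Metric.mem_closedBall, dist_eq_norm] at hz
    have a1 := abs_le.1 ((Complex.abs_re_le_norm (z - s)).trans hz)
    have a2 := (Complex.abs_im_le_norm (z - s)).trans hz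
    simp only [Complex.sub_re, Complex.sub_im] at a1 a2
    refine ⟨by linarith, by linarith, ?_⟩
    have := abs_sub_abs_le_abs_sub z.im s.im
    linarith
  have := Complex.norm_deriv_le_of_forall_mem_sphere_norm_le (f := Hc χ) (c := s) (R := ε)
    (C := K * 2 * (q * (2 + |s.im|)) ^ (2 * ε)) hε ?_ ?_
  · refine this.trans (le_of_eq ?_); ring
  · apply DifferentiableOn.diffContOnCl
    rw [closure_ball _ hε.ne']
    intro z hz
    exact (Hc_diff χ (by linarith [(hre z hz).1])).differentiableWithinAt
  · intro z hz
    obtain ⟨b1, b2, b3⟩ := hre z (Metric.sphere_subset_closedBall hz)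
    refine (hK q χ z b1 b2).trans ?_
    rw [mul_assoc]
    gcongr
    calc (q * (2 + |z.im|)) ^ (2 * ε) ≤ (2 * (q * (2 + |s.im|))) ^ (2 * ε) := by
          gcongr ?_ ^ _
          nlinarith [abs_nonneg s.im]
      _ = 2 ^ (2 * ε) * (q * (2 + |s.im|)) ^ (2 * ε) := by
          rw [Real.mul_rpow (by norm_num) (by positivity)]
      _ ≤ 2 * (q * (2 + |s.im|)) ^ (2 * ε) := by
          gcongr
          calc (2 : ℝ) ^ (2 * ε) ≤ 2 ^ (1 : ℝ) := by gcongr <;> linarith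
            _ = 2 := by norm_num

lemma norm_LSeries_le (f : ℕ → ℂ)
    (hf : ∀ n, ‖f n‖ ≤ 1) {s : ℂ} (h1 : 1 < s.re) (h2 : s.re ≤ 2) :
    ‖LSeries f s‖ ≤ 10 / (s.re - 1) := by
  have htr : ∀ n : ℕ, tr (n : ZMod 1) = 1 := fun n => by
    rw [show (n : ZMod 1) = 1 from Subsingleton.elim _ _]; simp
  have hs : 1 < ((s.re : ℝ) : ℂ).re := by simpa using h1
  have hsum : LSeriesSummable (fun n => tr n) (s.re : ℂ) := tr.LSeriesSummable_of_one_lt_re hs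
  have h3 : ‖LSeries f s‖ ≤ ∑' n, ‖LSeries.term (fun n => tr n) (s.re : ℂ) n‖ := by
    refine tsum_of_norm_bounded hsum.norm.hasSum fun n => ?_
    rcases eq_or_ne n 0 with rfl | hn
    · simp
    · rw [LSeries.term_of_ne_zero hn, LSeries.term_of_ne_zero hn, htr, norm_div, norm_div, norm_one,
        Complex.norm_natCast_cpow_of_pos (Nat.pos_of_ne_zero hn),
        Complex.norm_natCast_cpow_of_pos (Nat.pos_of_ne_zero hn), Complex.ofReal_re]
      gcongr
      exact hf n
  have h4 : ((∑' n, ‖LSeries.term (fun n => tr n) (s.re : ℂ) n‖ : ℝ) : ℂ) = LSeries (fun n => tr n) (s.re : ℂ) := by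
    rw [Complex.ofReal_tsum]
    unfold LSeries
    congr 1; ext n
    rcases eq_or_ne n 0 with rfl | hn
    · simp
    · rw [LSeries.term_of_ne_zero hn, htr, norm_div, norm_one,
        Complex.norm_natCast_cpow_of_pos (Nat.pos_of_ne_zero hn), Complex.ofReal_re]
      push_cast
      rw [Complex.ofReal_cpow (Nat.cast_nonneg _)]
      simp
  have h5 : ∑' n, ‖LSeries.term (fun n => tr n) (s.re : ℂ) n‖ ≤ ‖LSeries (fun n => tr n) (s.re : ℂ)‖ := by
    rw [← h4, Complex.norm_real]; exact le_abs_self _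
  refine h3.trans (h5.trans ?_)
  rw [LSeries_eq_Hc _ hs, cc_tr]
  refine (norm_add_le _ _).trans ?_
  have h6 := norm_Hc_le tr (s := (s.re : ℂ)) (by simp; linarith)
  rw [Complex.norm_real, Real.norm_eq_abs, abs_of_pos (by linarith)] at h6
  rw [norm_div, norm_one, ← Complex.ofReal_one, ← Complex.ofReal_sub, Complex.norm_real, Real.norm_eq_abs,
    abs_of_pos (by linarith)]
  push_cast at h6
  have h7 : 9 ≤ 9 / (s.re - 1) := by rw [le_div_iff₀ (by linarith)]; linarith
  have : 10 / (s.re - 1) = 1 / (s.re - 1) + 9 / (s.re - 1) := by ring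
  linarith

lemma norm_LSeries_ge {q : ℕ} [NeZero q] (χ : DirichletCharacter ℂ q) {s : ℂ} (h1 : 1 < s.re) (h2 : s.re ≤ 2) :
    (s.re - 1) / 10 ≤ ‖LSeries (fun n => χ n) s‖ := by
  have e := DirichletCharacter.LSeries.mul_mu_eq_one χ h1
  have e2 := congrArg norm e
  rw [norm_mul, norm_one] at e2
  have := norm_LSeries_le ((fun n : ℕ => χ n) * fun n : ℕ => ((ArithmeticFunction.moebius n : ℤ) : ℂ)) (fun n => by
    simp only [Pi.mul_apply, norm_mul]
    refine mul_le_one₀ (χ.norm_le_one _) (norm_nonneg _) ?_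
    rw [Complex.norm_intCast]
    exact_mod_cast ArithmeticFunction.abs_moebius_le_one) h1 h2
  have h0 : 0 < s.re - 1 := by linarith
  rw [div_le_iff₀ (by norm_num)]
  rw [le_div_iff₀ h0] at this
  nlinarith [norm_nonneg (LSeries (fun n => χ n) s)]

lemma caseA {g : ℝ → ℝ} {K τ : ℝ} (hK : 1 ≤ K) (hτ : 1 ≤ τ) (hg : ∀ x, 0 ≤ g x)
    (h1 : ∀ x, 0 < x → x ≤ 1 → 1 ≤ (10 / x) ^ 3 * g x ^ 4 * (K * τ ^ 4))
    (h2 : ∀ x y, 0 < x → x ≤ y → y ≤ 1 → g y ≤ g x + K * τ ^ 2 * (y - x)) {y : ℝ} (hy : 0 < y) (hy1 : y ≤ 1) :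
    1 / (1000 * K) / 2 * (1 / (1000 * K) / (2 * K)) ^ 3 ≤ g y * τ ^ 10 := by
  set c := 1 / (1000 * K) with hc
  have hK0 : 0 < K := by linarith
  have hτ0 : 0 < τ := by linarith
  have hc0 : 0 < c := by positivity
  have hc1 : c ≤ 1 := by
    rw [hc, div_le_one (by positivity)]; linarith
  set v := c / (2 * K) with hv
  have hv0 : 0 < v := by positivity
  have hv1 : v ≤ 1 := by rw [hv, div_le_one (by positivity)]; linarith
  set u := v / τ ^ 3 with hu
  have hu0 : 0 < u := by positivity
  have hu1 : u ≤ 1 := by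
    rw [hu, div_le_one (by positivity)]; exact hv1.trans (one_le_pow₀ hτ)
  have hbig : ∀ x, u ^ 4 ≤ x → x ≤ 1 → u ^ 3 * c / τ ≤ g x := by
    intro x hx hx1
    have hx0 : 0 < x := lt_of_lt_of_le (by positivity) hx
    have h3 := h1 x hx0 hx1
    have h4 : x ^ 3 * c / τ ^ 4 ≤ g x ^ 4 := by
      rw [div_pow, div_mul_eq_mul_div, div_mul_eq_mul_div, le_div_iff₀ (by positivity)] at h3
      rw [hc, div_le_iff₀ (by positivity), mul_one_div, div_le_iff₀ (by positivity)]
      linarith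
    have h5 : (u ^ 3 * c / τ) ^ 4 ≤ g x ^ 4 := by
      refine le_trans ?_ h4
      rw [div_pow, mul_pow]
      have : (u ^ 3) ^ 4 ≤ x ^ 3 := by
        calc (u ^ 3) ^ 4 = (u ^ 4) ^ 3 := by ring
          _ ≤ _ := by gcongr
      have h6 : c ^ 4 ≤ c := by
        calc c ^ 4 ≤ c ^ 1 := pow_le_pow_of_le_one hc0.le hc1 (by norm_num)
          _ = c := pow_one c
      gcongr
    exact (pow_le_pow_iff_left₀ (by positivity) (hg x) (by norm_num)).1 h5
  have hfin : c / 2 * v ^ 3 = u ^ 3 * c / (2 * τ) * τ ^ 10 := by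
    rw [hu]; field_simp
  rw [hfin]
  gcongr
  by_cases hyu : u ^ 4 ≤ y
  · refine le_trans ?_ (hbig y hyu hy1)
    gcongr; linarith
  · push Not at hyu
    have hu41 : u ^ 4 ≤ 1 := pow_le_one₀ hu0.le hu1
    have h7 := h2 y (u ^ 4) hy hyu.le hu41
    have h8 := hbig (u ^ 4) le_rfl hu41
    have h9 : K * τ ^ 2 * (u ^ 4 - y) ≤ K * τ ^ 2 * u ^ 4 := by gcongr; linarith
    have h10 : K * τ ^ 2 * u ^ 4 = u ^ 3 * c / (2 * τ) := by
      have : u = c / (2 * K) / τ ^ 3 := by rw [hu, hv]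
      calc K * τ ^ 2 * u ^ 4 = K * τ ^ 2 * u ^ 3 * u := by ring
        _ = K * τ ^ 2 * u ^ 3 * (c / (2 * K) / τ ^ 3) := by rw [← this]
        _ = _ := by field_simp
    have h11 : u ^ 3 * c / τ = 2 * (u ^ 3 * c / (2 * τ)) := by field_simp
    linarith

end ATR

namespace ATR

lemma Hc_lip {ε : ℝ} (hε : 0 < ε) (hε2 : ε ≤ 1 / 2) :
    ∃ K : ℝ, 1 ≤ K ∧ ∀ (q : ℕ) [NeZero q] (χ : DirichletCharacter ℂ q), ∀ (t : ℝ) (s w : ℂ),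
      1 ≤ s.re → s.re ≤ 2 → |s.im| ≤ t → 1 ≤ w.re → w.re ≤ 2 → |w.im| ≤ t →
        ‖Hc χ w - Hc χ s‖ ≤ K * (q * (2 + t)) ^ (2 * ε) * ‖w - s‖ := by
  obtain ⟨K, hK1, hK⟩ := norm_deriv_Hc_le hε hε2
  refine ⟨K, hK1, ?_⟩
  intro q _ χ t s w s1 s2 s3 w1 w2 w3
  have hconv : Convex ℝ {z : ℂ | (1 ≤ z.re ∧ z.re ≤ 2) ∧ (-t ≤ z.im ∧ z.im ≤ t)} :=
    ((convex_halfSpace_re_ge 1).inter (convex_halfSpace_re_le 2)).inter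
      ((convex_halfSpace_im_ge (-t)).inter (convex_halfSpace_im_le t))
  refine Convex.norm_image_sub_le_of_norm_deriv_le (s := {z : ℂ | (1 ≤ z.re ∧ z.re ≤ 2) ∧ (-t ≤ z.im ∧ z.im ≤ t)})
    (fun z hz => Hc_diff χ (by linarith [hz.1.1])) (fun z hz => ?_) hconv
    ⟨⟨s1, s2⟩, abs_le.1 s3⟩ ⟨⟨w1, w2⟩, abs_le.1 w3⟩
  refine (hK q χ z hz.1.1 hz.1.2).trans ?_
  have : |z.im| ≤ t := abs_le.2 hz.2
  gcongr

lemma two_rpow_le {ε : ℝ} (hε : 0 < ε) (hε2 : ε ≤ 1 / 2) {a b : ℝ} (ha : 0 ≤ a) (hb : 0 ≤ b) (hab : a ≤ 2 * b) :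
    a ^ (2 * ε) ≤ 2 * b ^ (2 * ε) := by
  calc a ^ (2 * ε) ≤ (2 * b) ^ (2 * ε) := by gcongr
    _ = 2 ^ (2 * ε) * b ^ (2 * ε) := by rw [Real.mul_rpow (by norm_num) hb]
    _ ≤ 2 ^ (1 : ℝ) * b ^ (2 * ε) := by gcongr <;> linarith
    _ = _ := by norm_num

/-- 3-4-1 inequality for a point with a bound for the squared character -/
lemma three_four_one {q : ℕ} [NeZero q] (χ : DirichletCharacter ℂ q) {x t W : ℝ} (hx : 0 < x) (hx1 : x ≤ 1)
    (hW : ‖LSeries (fun n => (χ ^ 2) n) (1 + x + 2 * Complex.I * t)‖ ≤ W) :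
    1 ≤ (10 / x) ^ 3 * ‖LSeries (fun n => χ n) (1 + x + Complex.I * t)‖ ^ 4 * W := by
  have h := DirichletCharacter.norm_LSeries_product_ge_one χ hx t
  rw [norm_mul, norm_mul, norm_pow, norm_pow] at h
  refine le_trans h ?_
  have h1 := norm_LSeries_le (fun n => (1 : DirichletCharacter ℂ q) n) (s := 1 + x)
    (fun n => DirichletCharacter.norm_le_one _ _) (by simp; linarith) (by simp; linarith)
  simp only [Complex.add_re, Complex.one_re, Complex.ofReal_re, add_sub_cancel_left] at h1
  gcongr

lemma lower_nontrivial {ε : ℝ} (hε : 0 < ε) (hε2 : ε ≤ 1 / 2) :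
    ∃ c : ℝ, 0 < c ∧ ∀ (q : ℕ) [NeZero q] (χ : DirichletCharacter ℂ q), χ ≠ 1 → ∀ s : ℂ,
      1 < s.re → s.re ≤ 2 → c ≤ ‖Hc χ s‖ * ((q * (2 + |s.im|)) ^ ε) ^ 10 := by
  obtain ⟨K₁, hK₁1, hK₁⟩ := norm_Hc_le_rpow hε hε2
  obtain ⟨K₂, hK₂1, hK₂⟩ := Hc_lip hε hε2
  obtain ⟨cS, hcS, hS⟩ := siegel (ε := 2 * ε) (by linarith)
  set κ := min (cS / (4 * K₂)) 1 with hκ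
  have hκ0 : 0 < κ := lt_min (by positivity) one_pos
  have hκ1 : κ ≤ 1 := min_le_right _ _
  set K := 1 / κ + 2 * K₁ + K₂ with hKdef
  have hK1 : 1 ≤ K := by
    have : 0 < 1 / κ := by positivity
    linarith
  set c₁ := 1 / (1000 * K) / 2 * (1 / (1000 * K) / (2 * K)) ^ 3 with hc₁
  have hc₁0 : 0 < c₁ := by
    have : 0 < K := by linarith
    positivity
  refine ⟨min c₁ (min (cS / 2) (κ / 10)), by positivity, ?_⟩
  intro q _ χ hχ s hs1 hs2
  have hq : (1 : ℝ) ≤ q := by exact_mod_cast Nat.one_le_iff_ne_zero.2 (NeZero.ne _)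
  set t := s.im with ht
  set T : ℝ := q * (2 + |t|) with hT
  have hT1 : 1 ≤ T := by rw [hT]; nlinarith [abs_nonneg t]
  have hqT : (q : ℝ) ≤ T := by rw [hT]; nlinarith [abs_nonneg t]
  set τ := T ^ ε with hτ
  have hτ1 : 1 ≤ τ := one_le_rpow hT1 hε.le
  have hτ0 : 0 < τ := by linarith
  have hτ2 : T ^ (2 * ε) = τ ^ 2 := by
    rw [hτ, ← Real.rpow_natCast, ← Real.rpow_mul (by linarith)]; congr 1; push_cast; ring
  have hsre : s = 1 + ((s.re - 1 : ℝ) : ℂ) + Complex.I * t := by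
    apply Complex.ext <;> simp [ht]
  by_cases hcase : χ ^ 2 = 1 ∧ |t| < κ / τ ^ 4
  · obtain ⟨hsq, htk⟩ := hcase
    by_cases hy : s.re - 1 ≤ κ / τ ^ 4
    · -- near 1
      have h1 := hK₂ q χ |t| 1 s (by simp) (by simp) (by simp) hs1.le hs2 le_rfl
      rw [← hT, hτ2] at h1
      have h2 : ‖s - 1‖ ≤ 2 * (κ / τ ^ 4) := by
        refine (Complex.norm_le_abs_re_add_abs_im _).trans ?_
        simp only [Complex.sub_re, Complex.one_re, Complex.sub_im, Complex.one_im, sub_zero]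
        rw [abs_of_pos (by linarith)]
        linarith
      have h3 := hS q χ hsq hχ
      have h4 : cS / τ ^ 2 ≤ ‖Hc χ 1‖ := by
        refine le_trans ?_ h3
        rw [div_eq_mul_inv, ← hτ2, ← Real.rpow_neg (by linarith)]
        gcongr ?_ * ?_
        exact Real.rpow_le_rpow_of_nonpos (by linarith) hqT (by linarith)
      have h5 : K₂ * τ ^ 2 * ‖s - 1‖ ≤ cS / 2 / τ ^ 2 := by
        calc K₂ * τ ^ 2 * ‖s - 1‖ ≤ K₂ * τ ^ 2 * (2 * (cS / (4 * K₂) / τ ^ 4)) := by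
              gcongr
              refine h2.trans ?_
              gcongr
              exact min_le_left _ _
          _ = _ := by field_simp; norm_num
      have h6 : ‖Hc χ 1‖ ≤ ‖Hc χ s‖ + ‖Hc χ s - Hc χ 1‖ := by
        have := norm_sub_norm_le (Hc χ 1) (Hc χ s)
        rw [norm_sub_rev] at this; linarith
      have h7 : cS / 2 / τ ^ 2 ≤ ‖Hc χ s‖ := by
        have : cS / τ ^ 2 = 2 * (cS / 2 / τ ^ 2) := by ring
        linarith
      rw [div_le_iff₀ (by positivity)] at h7
      calc _ ≤ cS / 2 := (min_le_right _ _).trans (min_le_left _ _)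
        _ ≤ _ := h7
        _ ≤ _ := by gcongr <;> norm_num
    · push Not at hy
      have h1 := norm_LSeries_ge χ hs1 hs2
      rw [LSeries_eq_Hc χ hs1, cc_of_ne hχ, zero_div, zero_add] at h1
      calc _ ≤ κ / 10 := (min_le_right _ _).trans (min_le_right _ _)
        _ = κ / τ ^ 4 / 10 * τ ^ 4 := by field_simp
        _ ≤ (s.re - 1) / 10 * τ ^ 4 := by gcongr
        _ ≤ ‖Hc χ s‖ * τ ^ 4 := by gcongr
        _ ≤ _ := by gcongr <;> norm_num
  · -- generic case
    have hLH : ∀ x : ℝ, 0 < x → LSeries (fun n => χ n) (1 + x + Complex.I * t) = Hc χ (1 + x + Complex.I * t) := by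
      intro x hx
      rw [LSeries_eq_Hc χ (by simp; linarith), cc_of_ne hχ, zero_div, zero_add]
    have := caseA (g := fun x : ℝ => ‖Hc χ (1 + x + Complex.I * t)‖) (K := K) (τ := τ) hK1 hτ1
      (fun _ => norm_nonneg _) ?_ ?_ (y := s.re - 1) (by linarith) (by linarith)
    · rw [← hsre, ← hc₁] at this
      exact (min_le_left _ _).trans this
    · intro x hx hx1
      rw [← hLH x hx]
      apply three_four_one χ hx hx1
      rw [LSeries_eq_Hc _ (by simp; linarith)]
      refine (norm_add_le _ _).trans ?_
      have b1 := hK₁ q (χ ^ 2) (1 + x + 2 * Complex.I * t) (by simp; linarith) (by simp; linarith)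
      have him : (1 + x + 2 * Complex.I * t : ℂ).im = 2 * t := by simp
      rw [him, abs_mul, abs_two] at b1
      have b2 : (q * (2 + 2 * |t|)) ^ (2 * ε) ≤ 2 * T ^ (2 * ε) :=
        two_rpow_le hε hε2 (by positivity) (by positivity) (by rw [hT]; nlinarith [abs_nonneg t])
      rw [hτ2] at b2
      have b3 : ‖Hc (χ ^ 2) (1 + x + 2 * Complex.I * t)‖ ≤ 2 * K₁ * τ ^ 4 := by
        calc _ ≤ K₁ * (2 * τ ^ 2) := b1.trans (by gcongr)
          _ = 2 * K₁ * τ ^ 2 := by ring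
          _ ≤ _ := by gcongr <;> norm_num
      have b4 : ‖cc (χ ^ 2) / (1 + x + 2 * Complex.I * t - 1)‖ ≤ 1 / κ * τ ^ 4 := by
        by_cases hsq : χ ^ 2 = 1
        · have ht2 : κ / τ ^ 4 ≤ |t| := by
            by_contra hh; push Not at hh; exact hcase ⟨hsq, hh⟩
          have ht0 : 0 < |t| := lt_of_lt_of_le (by positivity) ht2
          rw [norm_div]
          have hn : |t| ≤ ‖(1 + x + 2 * Complex.I * t - 1 : ℂ)‖ := by
            refine le_trans ?_ (Complex.abs_im_le_norm _)
            simp only [Complex.sub_im, him, Complex.one_im, sub_zero, abs_mul, abs_two]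
            linarith
          calc _ ≤ 1 / |t| := by gcongr; exact norm_cc_le _
            _ ≤ 1 / (κ / τ ^ 4) := by gcongr
            _ = _ := by field_simp
        · rw [cc_of_ne hsq]; simp; positivity
      have : 0 ≤ K₂ * τ ^ 4 := by positivity
      rw [hKdef]; linarith
    · intro x y hx hxy hy1
      have h1 := hK₂ q χ |t| (1 + x + Complex.I * t) (1 + y + Complex.I * t) (by simp; linarith)
        (by simp; linarith) (by simp) (by simp; linarith) (by simp; linarith) (by simp)
      rw [← hT, hτ2] at h1
      have h2 : ‖(1 + y + Complex.I * t : ℂ) - (1 + x + Complex.I * t)‖ = y - x := by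
        rw [show (1 + y + Complex.I * t : ℂ) - (1 + x + Complex.I * t) = ((y - x : ℝ) : ℂ) by push_cast; ring,
          Complex.norm_real, Real.norm_eq_abs, abs_of_nonneg (by linarith)]
      rw [h2] at h1
      have h3 := norm_sub_norm_le (Hc χ (1 + y + Complex.I * t)) (Hc χ (1 + x + Complex.I * t))
      have h4 : K₂ * τ ^ 2 * (y - x) ≤ K * τ ^ 2 * (y - x) := by
        have : 0 ≤ y - x := by linarith
        gcongr
        have : 0 < 1 / κ := by positivity
        linarith
      linarith

end ATR

namespace ATR

/-- normalized zeta -/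
noncomputable def Zp (s : ℂ) : ℂ := (1 + (s - 1) * Hc tr s) / (s + 1)

lemma Zp_diff {s : ℂ} (hs : 0 < s.re) : DifferentiableAt ℂ Zp s := by
  unfold Zp
  refine DifferentiableAt.div ?_ (by fun_prop) ?_
  · have := Hc_diff tr hs
    fun_prop
  · intro h
    have := congrArg Complex.re h
    simp at this; linarith

lemma Zp_eq {s : ℂ} (hs : 1 < s.re) : Zp s = (s - 1) * LSeries (fun n => tr n) s / (s + 1) := by
  have h1 : s - 1 ≠ 0 := by
    intro h
    have := congrArg Complex.re h
    simp at this; linarith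
  rw [LSeries_eq_Hc _ hs, cc_tr, Zp]
  congr 1
  field_simp

lemma tr_apply (n : ℕ) : tr (n : ZMod 1) = 1 := by
  rw [show (n : ZMod 1) = 1 from Subsingleton.elim _ _]; simp

lemma Hc_tr_zeta {s : ℂ} (hs : 1 ≤ s.re) (h1 : s ≠ 1) : riemannZeta s = (s - 1)⁻¹ + Hc tr s := by
  have c1 : ContinuousAt riemannZeta s := (differentiableAt_riemannZeta h1).continuousAt
  have c2 : ContinuousAt (fun s => (s - 1)⁻¹ + Hc tr s) s := by
    have h2 : s - 1 ≠ 0 := sub_ne_zero.2 h1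
    have h3 : ContinuousAt (Hc tr) s := (Hc_diff tr (by linarith)).continuousAt
    have h4 : ContinuousAt (fun s : ℂ => (s - 1)⁻¹) s := by fun_prop (disch := exact h2)
    exact h4.add h3
  have hl : Tendsto (fun x : ℝ => s + x) (𝓝[>] 0) (𝓝 s) := by
    have : Tendsto (fun x : ℝ => s + x) (𝓝 0) (𝓝 (s + (0 : ℝ))) :=
      Continuous.tendsto (by fun_prop) 0
    simp only [Complex.ofReal_zero, add_zero] at this
    exact this.mono_left nhdsWithin_le_nhds
  refine tendsto_nhds_unique_of_eventuallyEq (c1.tendsto.comp hl) (c2.tendsto.comp hl) ?_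
  filter_upwards [self_mem_nhdsWithin] with x hx
  have hx0 : (0 : ℝ) < x := hx
  have hz : 1 < (s + x).re := by simp; linarith
  simp only [Function.comp]
  have e := LSeries_eq_Hc tr hz
  rw [cc_tr, one_div] at e
  rw [← LSeries_one_eq_riemannZeta hz, ← e]
  congr 1; ext n; simp [tr_apply]

lemma Zp_ne {s : ℂ} (hs : 1 ≤ s.re) : Zp s ≠ 0 := by
  have h2 : s + 1 ≠ 0 := by
    intro h
    have := congrArg Complex.re h
    simp at this; linarith
  by_cases h1 : s = 1
  · rw [h1]; unfold Zp; norm_num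
  · have h3 : s - 1 ≠ 0 := sub_ne_zero.2 h1
    have := riemannZeta_ne_zero_of_one_le_re hs
    rw [Hc_tr_zeta hs h1] at this
    have e : Zp s = (s - 1) * ((s - 1)⁻¹ + Hc tr s) / (s + 1) := by
      unfold Zp; congr 1; field_simp
    rw [e]
    exact div_ne_zero (mul_ne_zero h3 this) h2

lemma lower_zeta {ε : ℝ} (hε : 0 < ε) (hε2 : ε ≤ 1 / 2) :
    ∃ c : ℝ, 0 < c ∧ ∀ s : ℂ, 1 < s.re → s.re ≤ 2 → c ≤ ‖Zp s‖ * ((2 + |s.im|) ^ ε) ^ 10 := by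
  obtain ⟨K₁, hK₁1, hK₁⟩ := norm_Hc_le_rpow hε hε2
  obtain ⟨K₂, hK₂1, hK₂⟩ := Hc_lip hε hε2
  set K := 1 + 2 * K₁ + K₂ with hKdef
  have hK1 : 1 ≤ K := by linarith
  set c₁ := 1 / (1000 * K) / 2 * (1 / (1000 * K) / (2 * K)) ^ 3 with hc₁
  have hc₁0 : 0 < c₁ := by
    have : 0 < K := by linarith
    positivity
  -- compact part
  have hcpt : IsCompact (Set.Icc (1 : ℝ) 2 ×ℂ Set.Icc (-1 : ℝ) 1) := isCompact_Icc.reProdIm isCompact_Icc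
  have hcont : ContinuousOn (fun s => ‖Zp s‖) (Set.Icc (1 : ℝ) 2 ×ℂ Set.Icc (-1 : ℝ) 1) := by
    intro s hs
    rw [Complex.mem_reProdIm] at hs
    exact (Zp_diff (by linarith [hs.1.1])).continuousAt.norm.continuousWithinAt
  obtain ⟨s₀, hs₀, hmin⟩ := hcpt.exists_isMinOn ⟨1, by simp [Complex.mem_reProdIm]⟩ hcont
  set c₂ := ‖Zp s₀‖ with hc₂
  have hc₂0 : 0 < c₂ := by
    rw [Complex.mem_reProdIm] at hs₀
    exact norm_pos_iff.2 (Zp_ne hs₀.1.1)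
  refine ⟨min c₂ (c₁ / 4), by positivity, ?_⟩
  intro s hs1 hs2
  set t := s.im with ht
  set T : ℝ := 2 + |t| with hT
  have hT1 : 1 ≤ T := by rw [hT]; linarith [abs_nonneg t]
  set τ := T ^ ε with hτ
  have hτ1 : 1 ≤ τ := one_le_rpow hT1 hε.le
  have hτ0 : 0 < τ := by linarith
  have hτ2 : T ^ (2 * ε) = τ ^ 2 := by
    rw [hτ, ← Real.rpow_natCast, ← Real.rpow_mul (by linarith)]; congr 1; push_cast; ring
  by_cases ht1 : |t| ≤ 1
  · have : c₂ ≤ ‖Zp s‖ := hmin (by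
      rw [Complex.mem_reProdIm]; exact ⟨⟨hs1.le, hs2⟩, abs_le.1 ht1⟩)
    calc _ ≤ c₂ := min_le_left _ _
      _ ≤ ‖Zp s‖ * 1 := by rw [mul_one]; exact this
      _ ≤ _ := by gcongr; exact one_le_pow₀ hτ1
  push Not at ht1
  have hsre : s = 1 + ((s.re - 1 : ℝ) : ℂ) + Complex.I * t := by
    apply Complex.ext <;> simp [ht]
  have hLH : ∀ x : ℝ, 0 < x → LSeries (fun n => tr n) (1 + x + Complex.I * t) =
      1 / (x + Complex.I * t) + Hc tr (1 + x + Complex.I * t) := by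
    intro x hx
    rw [LSeries_eq_Hc tr (by simp; linarith), cc_tr]
    congr 2; ring
  have hnorm : ∀ x : ℝ, 1 ≤ ‖(x + Complex.I * t : ℂ)‖ := by
    intro x
    refine le_trans ht1.le (le_trans ?_ (Complex.abs_im_le_norm _))
    simp
  have := caseA (g := fun x : ℝ => ‖LSeries (fun n => tr n) (1 + x + Complex.I * t)‖) (K := K) (τ := τ) hK1 hτ1
      (fun _ => norm_nonneg _) ?_ ?_ (y := s.re - 1) (by linarith) (by linarith)
  · rw [← hsre, ← hc₁] at this
    rw [Zp_eq hs1, norm_div, norm_mul]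
    have hn1 : |t| ≤ ‖s - 1‖ := by
      refine le_trans ?_ (Complex.abs_im_le_norm _); simp [ht]
    have hn2 : ‖s + 1‖ ≤ 4 * |t| := by
      refine (Complex.norm_le_abs_re_add_abs_im _).trans ?_
      simp only [Complex.add_re, Complex.one_re, Complex.add_im, Complex.one_im, add_zero, ← ht]
      rw [abs_of_pos (by linarith)]
      linarith
    have hn3 : 0 < ‖s + 1‖ := by
      refine lt_of_lt_of_le ?_ (Complex.abs_re_le_norm _)
      simp only [Complex.add_re, Complex.one_re]
      rw [abs_of_pos (by linarith)]; linarith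
    have hfr : 1 / 4 ≤ ‖s - 1‖ / ‖s + 1‖ := by
      rw [le_div_iff₀ hn3]; linarith
    calc _ ≤ c₁ / 4 := min_le_right _ _
      _ = c₁ * (1 / 4) := by ring
      _ ≤ (‖LSeries (fun n => tr n) s‖ * τ ^ 10) * (‖s - 1‖ / ‖s + 1‖) := by gcongr
      _ = _ := by ring
  · intro x hx hx1
    apply three_four_one tr hx hx1
    rw [LSeries_eq_Hc _ (by simp; linarith), show tr ^ 2 = tr by simp, cc_tr]
    refine (norm_add_le _ _).trans ?_
    have b1 := hK₁ 1 tr (1 + x + 2 * Complex.I * t) (by simp; linarith) (by simp; linarith)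
    have him : (1 + x + 2 * Complex.I * t : ℂ).im = 2 * t := by simp
    rw [him, abs_mul, abs_two, Nat.cast_one, one_mul] at b1
    have b2 : (2 + 2 * |t|) ^ (2 * ε) ≤ 2 * T ^ (2 * ε) :=
      two_rpow_le hε hε2 (by positivity) (by positivity) (by rw [hT]; linarith [abs_nonneg t])
    rw [hτ2] at b2
    have b3 : ‖Hc tr (1 + x + 2 * Complex.I * t)‖ ≤ 2 * K₁ * τ ^ 4 := by
      calc _ ≤ K₁ * (2 * τ ^ 2) := b1.trans (by gcongr)
        _ = 2 * K₁ * τ ^ 2 := by ring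
        _ ≤ _ := by gcongr <;> norm_num
    have b4 : ‖(1 : ℂ) / (1 + x + 2 * Complex.I * t - 1)‖ ≤ 1 * τ ^ 4 := by
      have e : (1 + x + 2 * Complex.I * t - 1 : ℂ) = x + Complex.I * ((2 * t : ℝ) : ℂ) := by
        push_cast; ring
      have hn : 1 ≤ ‖(1 + x + 2 * Complex.I * t - 1 : ℂ)‖ := by
        refine le_trans ?_ (Complex.abs_im_le_norm _)
        simp only [Complex.sub_im, him, Complex.one_im, sub_zero, abs_mul, abs_two]
        linarith
      rw [norm_div, norm_one, one_mul]
      calc _ ≤ (1 : ℝ) / 1 := by gcongr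
        _ ≤ _ := by rw [div_one]; exact one_le_pow₀ hτ1
    have : 0 ≤ K₂ * τ ^ 4 := by positivity
    rw [hKdef]; linarith
  · intro x y hx hxy hy1
    have h1 := hK₂ 1 tr |t| (1 + x + Complex.I * t) (1 + y + Complex.I * t) (by simp; linarith)
      (by simp; linarith) (by simp) (by simp; linarith) (by simp; linarith) (by simp)
    rw [Nat.cast_one, one_mul, ← hT, hτ2] at h1
    have h2 : ‖(1 + y + Complex.I * t : ℂ) - (1 + x + Complex.I * t)‖ = y - x := by
      rw [show (1 + y + Complex.I * t : ℂ) - (1 + x + Complex.I * t) = ((y - x : ℝ) : ℂ) by push_cast; ring,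
        Complex.norm_real, Real.norm_eq_abs, abs_of_nonneg (by linarith)]
    rw [h2] at h1
    have hyx : 0 ≤ y - x := by linarith
    have h5 : ‖(1 : ℂ) / (y + Complex.I * t) - 1 / (x + Complex.I * t)‖ ≤ y - x := by
      have n1 := hnorm x
      have n2 := hnorm y
      have z1 : (x + Complex.I * t : ℂ) ≠ 0 := by intro h; rw [h] at n1; norm_num at n1
      have z2 : (y + Complex.I * t : ℂ) ≠ 0 := by intro h; rw [h] at n2; norm_num at n2
      have e : (1 : ℂ) / (y + Complex.I * t) - 1 / (x + Complex.I * t) =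
          ((x - y : ℝ) : ℂ) / ((y + Complex.I * t) * (x + Complex.I * t)) := by
        rw [div_sub_div _ _ z2 z1]; push_cast; ring
      rw [e, norm_div, norm_mul, Complex.norm_real, Real.norm_eq_abs, abs_sub_comm, abs_of_nonneg hyx]
      apply div_le_of_le_mul₀ (by positivity) hyx
      have n3 := one_le_mul_of_one_le_of_one_le n2 n1
      exact le_mul_of_one_le_right hyx n3
    rw [hLH x hx, hLH y (by linarith)]
    have h3 := norm_sub_norm_le (1 / (y + Complex.I * t) + Hc tr (1 + y + Complex.I * t))
      (1 / (x + Complex.I * t) + Hc tr (1 + x + Complex.I * t))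
    rw [add_sub_add_comm] at h3
    have h6 := norm_add_le ((1 : ℂ) / (y + Complex.I * t) - 1 / (x + Complex.I * t))
      (Hc tr (1 + y + Complex.I * t) - Hc tr (1 + x + Complex.I * t))
    have h4 : y - x + K₂ * τ ^ 2 * (y - x) ≤ K * τ ^ 2 * (y - x) := by
      have h7 : 1 ≤ τ ^ 2 := one_le_pow₀ hτ1
      have h8 : 1 + K₂ * τ ^ 2 ≤ K * τ ^ 2 := by rw [hKdef]; nlinarith
      nlinarith
    linarith

end ATR

namespace ATR

lemma logDeriv_local {P : ℂ → ℂ} {s₀ : ℂ} {ρ B b : ℝ} (hρ : 0 < ρ) (hb : 0 < b) (hbB : b ≤ B)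
    (hd : ∀ s ∈ Metric.ball s₀ (2 * ρ), DifferentiableAt ℂ P s)
    (hB : ∀ s ∈ Metric.ball s₀ (2 * ρ), ‖P s‖ ≤ B) (hlow : b ≤ ‖P s₀‖) (j : ℕ) :
    ‖iteratedDeriv j (fun s => deriv P s / P s) s₀‖ ≤ j.factorial * (4 * B / (ρ * b)) ^ (j + 1) := by
  have hB0 : 0 < B := lt_of_lt_of_le hb hbB
  set r := ρ * b / (4 * B) with hr
  have hr0 : 0 < r := by positivity
  have hrρ : r ≤ ρ / 4 := by
    rw [hr, div_le_iff₀ (by positivity)]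
    nlinarith
  -- derivative bound
  have hder : ∀ s ∈ Metric.closedBall s₀ r, ‖deriv P s‖ ≤ B / ρ := by
    intro s hs
    rw [Metric.mem_closedBall] at hs
    have hsub : ∀ z ∈ Metric.closedBall s ρ, z ∈ Metric.ball s₀ (2 * ρ) := by
      intro z hz
      rw [Metric.mem_closedBall] at hz
      rw [Metric.mem_ball]
      linarith [dist_triangle z s s₀]
    apply Complex.norm_deriv_le_of_forall_mem_sphere_norm_le hρ
    · apply DifferentiableOn.diffContOnCl
      rw [closure_ball _ hρ.ne']
      intro z hz
      exact (hd z (hsub z hz)).differentiableWithinAt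
    · intro z hz
      exact hB z (hsub z (Metric.sphere_subset_closedBall hz))
  have hsub2 : ∀ s ∈ Metric.closedBall s₀ r, s ∈ Metric.ball s₀ (2 * ρ) := by
    intro s hs
    rw [Metric.mem_closedBall] at hs
    rw [Metric.mem_ball]; linarith
  have hP : ∀ s ∈ Metric.closedBall s₀ r, b / 2 ≤ ‖P s‖ := by
    intro s hs
    have h1 := Convex.norm_image_sub_le_of_norm_deriv_le (f := P) (s := Metric.closedBall s₀ r)
      (x := s) (y := s₀) (C := B / ρ) (fun z hz => hd z (hsub2 z hz)) hder (convex_closedBall _ _)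
      hs (Metric.mem_closedBall_self hr0.le)
    have h2 : ‖s₀ - s‖ ≤ r := by
      rw [Metric.mem_closedBall, dist_comm, dist_eq_norm] at hs; exact hs
    have h3 : B / ρ * ‖s₀ - s‖ ≤ b / 4 := by
      calc _ ≤ B / ρ * r := by gcongr
        _ = _ := by rw [hr]; field_simp
    have h4 := norm_sub_norm_le (P s₀) (P s)
    linarith
  have hopen : ∀ s ∈ Metric.closedBall s₀ r, DifferentiableAt ℂ (deriv P) s := by
    intro s hs
    have : AnalyticAt ℂ P s := by
      rw [Complex.analyticAt_iff_eventually_differentiableAt]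
      filter_upwards [Metric.isOpen_ball.mem_nhds (hsub2 s hs)] with z hz using hd z hz
    exact this.deriv.differentiableAt
  have := Complex.norm_iteratedDeriv_le_of_forall_mem_sphere_norm_le (c := s₀) (R := r)
    (C := 4 * B / (ρ * b)) (f := fun s => deriv P s / P s) j hr0 ?_ ?_
  · refine this.trans (le_of_eq ?_)
    rw [pow_succ, mul_div_assoc, hr]
    congr 1
    rw [div_eq_mul_inv, ← inv_pow, inv_div]
    ring
  · apply DifferentiableOn.diffContOnCl
    rw [closure_ball _ hr0.ne']
    intro z hz
    refine ((hopen z hz).div (hd z (hsub2 z hz)) ?_).differentiableWithinAt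
    rw [← norm_pos_iff]
    linarith [hP z hz]
  · intro z hz
    have hz := Metric.sphere_subset_closedBall hz
    rw [norm_div]
    calc _ ≤ (B / ρ) / (b / 2) := by
          have := hP z hz
          have := hder z hz
          gcongr
      _ = 2 * B / (ρ * b) := by field_simp
      _ ≤ _ := by gcongr; norm_num

/-- combine with power bounds -/
lemma logDeriv_rpow {ε K c : ℝ} (hε : 0 < ε) (hK : 0 < K) (hc : 0 < c) (j : ℕ)
    (hεj : 12 * ε * (j + 1) = 1 / 2) :
    ∃ M : ℝ, 1 ≤ M ∧ ∀ (P : ℂ → ℂ) (s : ℂ) (T : ℝ), 1 ≤ T → 1 < s.re → s.re ≤ 2 →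
      (∀ z : ℂ, 0 < z.re → DifferentiableAt ℂ P z) →
      (∀ z ∈ Metric.ball s ε, ‖P z‖ ≤ K * T ^ (2 * ε)) →
      c ≤ ‖P s‖ * (T ^ ε) ^ 10 →
      ‖iteratedDeriv j (fun s => deriv P s / P s) s‖ ≤ M * T ^ (1 / 2 : ℝ) := by
  refine ⟨max 1 (j.factorial * (4 * K / (ε / 2 * c)) ^ (j + 1)), le_max_left _ _, ?_⟩
  intro P s T hT hs1 hs2 hd hB hlow
  have hε2 : ε ≤ 1 / 2 := by
    have : (0 : ℝ) ≤ j := by positivity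
    nlinarith
  set τ := T ^ ε with hτ
  have hτ1 : 1 ≤ τ := one_le_rpow hT hε.le
  have hτ0 : 0 < τ := by linarith
  have hτ2 : T ^ (2 * ε) = τ ^ 2 := by
    rw [hτ, ← Real.rpow_natCast, ← Real.rpow_mul (by linarith)]; congr 1; push_cast; ring
  have hτT : T ^ (1 / 2 : ℝ) = (τ ^ 12) ^ (j + 1) := by
    rw [← pow_mul, hτ, ← Real.rpow_natCast, ← Real.rpow_mul (by linarith), ← hεj]
    congr 1; push_cast; ring
  rw [hτ2] at hB
  have hb : c / τ ^ 10 ≤ ‖P s‖ := by rw [div_le_iff₀ (by positivity)]; exact hlow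
  have hbB : c / τ ^ 10 ≤ K * τ ^ 2 := hb.trans (hB s (Metric.mem_ball_self hε))
  have h2 : 2 * (ε / 2) = ε := by ring
  have := logDeriv_local (P := P) (s₀ := s) (ρ := ε / 2) (B := K * τ ^ 2) (b := c / τ ^ 10)
    (by linarith) (by positivity) hbB (by
      intro z hz
      rw [h2, Metric.mem_ball, dist_eq_norm] at hz
      have := (Complex.abs_re_le_norm (z - s)).trans hz.le
      rw [Complex.sub_re, abs_le] at this
      exact hd z (by linarith)) (by rw [h2]; exact hB) hb j
  refine this.trans ?_
  rw [hτT]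
  calc _ = j.factorial * (4 * K / (ε / 2 * c)) ^ (j + 1) * (τ ^ 12) ^ (j + 1) := by
        rw [mul_assoc, ← mul_pow]; congr 2; field_simp
    _ ≤ _ := by gcongr; exact le_max_right _ _

lemma Hc_ball {ε : ℝ} (hε : 0 < ε) (hε2 : ε ≤ 1 / 2) : ∃ K : ℝ, 1 ≤ K ∧
    ∀ (q : ℕ) [NeZero q] (χ : DirichletCharacter ℂ q) (s : ℂ), 1 < s.re → s.re ≤ 2 →
      ∀ z ∈ Metric.ball s ε, ‖Hc χ z‖ ≤ K * (q * (2 + |s.im|)) ^ (2 * ε) := by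
  obtain ⟨K₁, hK₁1, hK₁⟩ := norm_Hc_le_rpow hε hε2
  refine ⟨2 * K₁, by linarith, ?_⟩
  intro q _ χ s hs1 hs2 z hz
  rw [Metric.mem_ball, dist_eq_norm] at hz
  have h1 := (Complex.abs_re_le_norm (z - s)).trans hz.le
  have h2 := (Complex.abs_im_le_norm (z - s)).trans hz.le
  rw [Complex.sub_re, abs_le] at h1
  rw [Complex.sub_im] at h2
  have h3 : |z.im| ≤ |s.im| + ε := by
    have := abs_add_le s.im (z.im - s.im)
    rw [add_sub_cancel] at this
    linarith
  refine (hK₁ q χ z (by linarith) (by linarith)).trans ?_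
  calc _ ≤ K₁ * (2 * (q * (2 + |s.im|)) ^ (2 * ε)) := by
        gcongr
        apply two_rpow_le hε hε2 (by positivity) (by positivity)
        have : (2 + |z.im|) ≤ 2 * (2 + |s.im|) := by linarith [abs_nonneg s.im]
        have hq : (0 : ℝ) ≤ q := by positivity
        nlinarith
    _ = _ := by ring

lemma one_le_qT {q : ℕ} [NeZero q] (t : ℝ) : 1 ≤ (q : ℝ) * (2 + |t|) := by
  have h1 : (1 : ℝ) ≤ q := by exact_mod_cast NeZero.one_le
  nlinarith [abs_nonneg t]

lemma iter_vm (j : ℕ) : ∃ M : ℝ, 1 ≤ M ∧ ∀ (q : ℕ) [NeZero q] (χ : DirichletCharacter ℂ q), χ ≠ 1 →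
    ∀ s : ℂ, 1 < s.re → s.re ≤ 2 →
      ‖iteratedDeriv j (LSeries (vm χ)) s‖ ≤ M * (q * (2 + |s.im|)) ^ (1 / 2 : ℝ) := by
  set ε : ℝ := 1 / (24 * (j + 1)) with hε
  have hε0 : 0 < ε := by positivity
  have hεj : 12 * ε * (j + 1) = 1 / 2 := by rw [hε]; field_simp; norm_num
  have hε2 : ε ≤ 1 / 2 := by
    have : (0 : ℝ) ≤ j := by positivity
    nlinarith
  obtain ⟨K, hK1, hK⟩ := Hc_ball hε0 hε2
  obtain ⟨c, hc, hlow⟩ := lower_nontrivial hε0 hε2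
  obtain ⟨M, hM1, hM⟩ := logDeriv_rpow hε0 (by linarith : 0 < K) hc j hεj
  refine ⟨M, hM1, ?_⟩
  intro q _ χ hχ s hs1 hs2
  have h := hM (Hc χ) s (q * (2 + |s.im|)) (one_le_qT _) hs1 hs2 (fun z hz => Hc_diff χ hz)
    (hK q χ s hs1 hs2) (hlow q χ hχ s hs1 hs2)
  have e : LSeries (vm χ) =ᶠ[𝓝 s] fun s => -(deriv (Hc χ) s / Hc χ s) := by
    filter_upwards [(halfplane_open 1).mem_nhds hs1] with z hz
    have hz : 1 < z.re := hz
    have e1 : LSeries (fun n => χ n) =ᶠ[𝓝 z] Hc χ := by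
      filter_upwards [(halfplane_open 1).mem_nhds hz] with w hw
      rw [LSeries_eq_Hc χ hw, cc_of_ne hχ]; simp
    have h2 := deriv_LSeries_eq χ hz
    rw [e1.deriv_eq, e1.eq_of_nhds] at h2
    have h3 := χ.LSeries_ne_zero_of_one_lt_re hz
    have h4 : LSeries (fun n => χ n) z = Hc χ z := e1.eq_of_nhds
    have h5 : Hc χ z ≠ 0 := by rw [← h4]; exact h3
    rw [h2]; field_simp
  rw [e.iteratedDeriv_eq, iteratedDeriv_fun_neg, norm_neg]
  exact h

/-- coefficients Λ - 1 -/
noncomputable def lam1 : ℕ → ℂ := fun n => ((ArithmeticFunction.vonMangoldt n : ℝ) : ℂ) - 1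

lemma lam1_eq : lam1 = vm tr - fun n : ℕ => tr n := by
  ext n; simp [lam1, vm, tr_apply]

lemma LSeries_lam1 {s : ℂ} (hs : 1 < s.re) :
    LSeries lam1 s = -(deriv Zp s / Zp s) - (1 / (s + 1) + Hc tr s) := by
  have hsum1 : LSeriesSummable (fun n : ℕ => tr n) s := by
    apply LSeriesSummable_of_bounded_of_one_lt_re (m := 1) _ hs
    intro n _; rw [tr_apply]; simp
  rw [lam1_eq, LSeries_sub (DirichletCharacter.LSeriesSummable_twist_vonMangoldt tr hs) hsum1]
  have hL := LSeries_eq_Hc tr hs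
  rw [cc_tr] at hL
  have hne := tr.LSeries_ne_zero_of_one_lt_re hs
  have hs1 : s - 1 ≠ 0 := by
    intro h
    have := congrArg Complex.re h
    simp at this; linarith
  have hs2 : s + 1 ≠ 0 := by
    intro h
    have := congrArg Complex.re h
    simp at this; linarith
  have e : Zp =ᶠ[𝓝 s] fun s => (s - 1) * LSeries (fun n => tr n) s / (s + 1) := by
    filter_upwards [(halfplane_open 1).mem_nhds hs] with w hw using Zp_eq hw
  have hd : HasDerivAt (LSeries (fun n => tr n))
      (-(LSeries (fun n => tr n) s * LSeries (vm tr) s)) s := by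
    rw [← deriv_LSeries_eq tr hs]
    exact (LSeries_an tr hs).differentiableAt.hasDerivAt
  have hd2 := ((((hasDerivAt_id s).sub_const 1).mul hd).div ((hasDerivAt_id s).add_const 1) hs2).deriv
  have hd3 : deriv Zp s = _ := e.deriv_eq.trans hd2
  rw [hd3, e.eq_of_nhds]
  simp only [id, Pi.mul_apply]
  set L := LSeries (fun n => tr n) s
  set V := LSeries (vm tr) s
  have : Hc tr s = L - 1 / (s - 1) := by rw [hL]; ring
  rw [this]
  field_simp
  ring

lemma iter_lam1 (j : ℕ) : ∃ M : ℝ, 1 ≤ M ∧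
    ∀ s : ℂ, 1 < s.re → s.re ≤ 2 →
      ‖iteratedDeriv j (LSeries lam1) s‖ ≤ M * (2 + |s.im|) ^ (1 / 2 : ℝ) := by
  set ε : ℝ := 1 / (24 * (j + 1)) with hε
  have hε0 : 0 < ε := by positivity
  have hεj : 12 * ε * (j + 1) = 1 / 2 := by rw [hε]; field_simp; norm_num
  have hj0 : (0 : ℝ) ≤ j := by positivity
  have hε2 : ε ≤ 1 / 24 := by nlinarith
  obtain ⟨K, hK1, hK⟩ := Hc_ball hε0 (by linarith)
  obtain ⟨c, hc, hlow⟩ := lower_zeta hε0 (by linarith)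
  obtain ⟨M, hM1, hM⟩ := logDeriv_rpow hε0 (by linarith : 0 < 1 + 2 * K) hc j hεj
  refine ⟨M + j.factorial * (1 + K) / (ε / 2) ^ j, ?_, ?_⟩
  · have : 0 ≤ j.factorial * (1 + K) / (ε / 2) ^ j := by positivity
    linarith
  intro s hs1 hs2
  set T := 2 + |s.im| with hT
  have hT1 : 1 ≤ T := by rw [hT]; linarith [abs_nonneg s.im]
  have hre : ∀ z ∈ Metric.ball s ε, 1 / 2 < z.re := by
    intro z hz
    rw [Metric.mem_ball, dist_eq_norm] at hz
    have h1 := (Complex.abs_re_le_norm (z - s)).trans hz.le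
    rw [Complex.sub_re, abs_le] at h1
    linarith
  have hz1 : ∀ z : ℂ, 0 < z.re → 1 ≤ ‖z + 1‖ := by
    intro z hz
    refine le_trans ?_ (Complex.abs_re_le_norm _)
    rw [Complex.add_re, Complex.one_re, abs_of_pos (by linarith)]; linarith
  have hz0 : ∀ z : ℂ, 0 < z.re → z + 1 ≠ 0 := by
    intro z hz h
    have := hz1 z hz
    rw [h] at this; norm_num at this
  have hT2 : 1 ≤ T ^ (2 * ε) := one_le_rpow hT1 (by linarith)
  have hHc : ∀ z ∈ Metric.ball s ε, ‖Hc tr z‖ ≤ K * T ^ (2 * ε) := by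
    intro z hz
    have := hK 1 tr s hs1 hs2 z hz
    rwa [Nat.cast_one, one_mul] at this
  have h := hM Zp s T hT1 hs1 hs2 (fun z hz => Zp_diff hz) (by
    intro z hz
    have hz' : 0 < z.re := by linarith [hre z hz]
    have h1 := hz1 z hz'
    have e : Zp z = 1 / (z + 1) + ((z - 1) / (z + 1)) * Hc tr z := by unfold Zp; ring
    have h2 : ‖(1 : ℂ) / (z + 1)‖ ≤ 1 := by
      rw [norm_div, norm_one]; exact div_le_one_of_le₀ h1 (by positivity)
    have h3 : ‖(z - 1) / (z + 1)‖ ≤ 3 := by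
      have : (z - 1) / (z + 1) = 1 - 2 * (1 / (z + 1)) := by
        have := hz0 z hz'
        field_simp; ring
      rw [this]
      refine (norm_sub_le _ _).trans ?_
      rw [norm_mul, norm_one]
      have : ‖(2 : ℂ)‖ = 2 := by simp
      rw [this]; linarith
    have h3' : ‖(z - 1) / (z + 1)‖ ≤ 2 := by
      rw [norm_div]
      apply div_le_of_le_mul₀ (by positivity) (by norm_num)
      have : ‖z - 1‖ ≤ ‖z + 1‖ := by
        rw [Complex.norm_def, Complex.norm_def]
        apply Real.sqrt_le_sqrt
        simp only [Complex.normSq_apply, Complex.sub_re, Complex.add_re, Complex.one_re,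
          Complex.sub_im, Complex.add_im, Complex.one_im]
        nlinarith
      linarith
    rw [e]
    refine (norm_add_le _ _).trans ?_
    rw [norm_mul]
    calc _ ≤ 1 * T ^ (2 * ε) + 2 * (K * T ^ (2 * ε)) := by
          have := hHc z hz
          gcongr
          linarith
      _ = _ := by ring) (hlow s hs1 hs2)
  have hr : Metric.closedBall s (ε / 2) ⊆ Metric.ball s ε :=
    Metric.closedBall_subset_ball (by linarith)
  have hFd : ∀ z : ℂ, 0 < z.re → DifferentiableAt ℂ (fun z => 1 / (z + 1) + Hc tr z) z := by
    intro z hz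
    have h1 := Hc_diff tr hz
    have h2 := hz0 z hz
    fun_prop (disch := assumption)
  have h2 := Complex.norm_iteratedDeriv_le_of_forall_mem_sphere_norm_le (c := s) (R := ε / 2)
    (C := (1 + K) * T ^ (1 / 2 : ℝ)) (f := fun z => 1 / (z + 1) + Hc tr z) j (by linarith) (by
      apply DifferentiableOn.diffContOnCl
      rw [closure_ball _ (by linarith)]
      intro z hz
      exact (hFd z (by linarith [hre z (hr hz)])).differentiableWithinAt) (by
      intro z hz
      have hz := hr (Metric.sphere_subset_closedBall hz)
      refine (norm_add_le _ _).trans ?_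
      have h2 : ‖(1 : ℂ) / (z + 1)‖ ≤ 1 := by
        rw [norm_div, norm_one]
        exact div_le_one_of_le₀ (hz1 z (by linarith [hre z hz])) (by positivity)
      have h3 : T ^ (2 * ε) ≤ T ^ (1 / 2 : ℝ) := by gcongr; linarith
      have h4 := hHc z hz
      have h5 : K * T ^ (2 * ε) ≤ K * T ^ (1 / 2 : ℝ) := by gcongr
      linarith)
  have e : LSeries lam1 =ᶠ[𝓝 s] fun s => -(deriv Zp s / Zp s) - (1 / (s + 1) + Hc tr s) := by
    filter_upwards [(halfplane_open 1).mem_nhds hs1] with z hz using LSeries_lam1 hz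
  have hs0 : 0 < s.re := by linarith
  have an1 : AnalyticAt ℂ Zp s := by
    rw [Complex.analyticAt_iff_eventually_differentiableAt]
    filter_upwards [(halfplane_open 0).mem_nhds hs0] with z hz using Zp_diff hz
  have an2 : AnalyticAt ℂ (fun z => 1 / (z + 1) + Hc tr z) s := by
    rw [Complex.analyticAt_iff_eventually_differentiableAt]
    filter_upwards [(halfplane_open 0).mem_nhds hs0] with z hz using hFd z hz
  have an3 : AnalyticAt ℂ (fun s => -(deriv Zp s / Zp s)) s :=
    (an1.deriv.div an1 (Zp_ne hs1.le)).neg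
  rw [e.iteratedDeriv_eq, iteratedDeriv_fun_sub an3.contDiffAt an2.contDiffAt, iteratedDeriv_fun_neg]
  refine (norm_sub_le _ _).trans ?_
  rw [norm_neg, add_mul]
  refine add_le_add h (h2.trans (le_of_eq ?_))
  ring

end ATR

namespace ATR

/-- Fejer-type test function, as a difference of indicators -/
noncomputable def fk (u : ℝ) : ℂ :=
  (Set.Ioc (0 : ℝ) 1).indicator (fun _ => (1 : ℂ)) u - (Set.Ioc (0 : ℝ) 1).indicator (fun t : ℝ => (t : ℂ) ^ (1 : ℂ)) u

lemma fk_eq {u : ℝ} (hu : 0 < u) : fk u = ((max (1 - u) 0 : ℝ) : ℂ) := by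
  unfold fk
  by_cases h : u ≤ 1
  · have : u ∈ Set.Ioc (0 : ℝ) 1 := ⟨hu, h⟩
    rw [Set.indicator_of_mem this, Set.indicator_of_mem this, max_eq_left (by linarith)]
    simp
  · have : u ∉ Set.Ioc (0 : ℝ) 1 := fun h' => h h'.2
    rw [Set.indicator_of_notMem this, Set.indicator_of_notMem this, max_eq_right (by linarith)]
    simp

lemma fk_mellin {s : ℂ} (hs : 0 < s.re) : HasMellin fk s (1 / s - 1 / (s + 1)) := by
  have h1 := hasMellin_one_Ioc hs
  have h2 := hasMellin_cpow_Ioc 1 (s := s) (by simp; linarith)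
  have := hasMellin_sub h1.1 h2.1
  rw [h1.2, h2.2] at this
  exact this

lemma kernel_eq {s : ℂ} (hs : 0 < s.re) : 1 / s - 1 / (s + 1) = 1 / (s * (s + 1)) := by
  have h0 : s ≠ 0 := by rintro rfl; simp at hs
  have h1 : s + 1 ≠ 0 := by
    intro h
    have := congrArg Complex.re h
    simp at this; linarith
  field_simp; ring

lemma kernel_norm {c : ℝ} (hc : 1 < c) (t : ℝ) :
    ‖1 / (c + t * Complex.I : ℂ) - 1 / ((c + t * Complex.I : ℂ) + 1)‖ ≤ 2 * (1 + ‖t‖) ^ (-2 : ℝ) := by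
  rw [kernel_eq (by simp; linarith), norm_div, norm_one, norm_mul]
  have h1 : 1 + t ^ 2 ≤ ‖(c + t * Complex.I : ℂ)‖ ^ 2 := by
    rw [← Complex.normSq_eq_norm_sq, Complex.normSq_apply]; simp; nlinarith
  have h2 : ‖(c + t * Complex.I : ℂ)‖ ≤ ‖(c + t * Complex.I : ℂ) + 1‖ := by
    rw [Complex.norm_def, Complex.norm_def]
    apply Real.sqrt_le_sqrt
    simp only [Complex.normSq_apply]; simp; nlinarith
  have h3 : 1 + t ^ 2 ≤ ‖(c + t * Complex.I : ℂ)‖ * ‖(c + t * Complex.I : ℂ) + 1‖ := by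
    refine h1.trans ?_
    rw [sq]; gcongr
  have h4 : 0 < ‖(c + t * Complex.I : ℂ)‖ * ‖(c + t * Complex.I : ℂ) + 1‖ := by
    have : 0 < 1 + t ^ 2 := by positivity
    linarith
  rw [show (-2 : ℝ) = -((2 : ℕ) : ℝ) by norm_num, Real.rpow_neg (by positivity), Real.rpow_natCast,
    ← div_eq_mul_inv, div_le_div_iff₀ h4 (by positivity)]
  have : (1 + ‖t‖) ^ 2 ≤ 2 * (1 + t ^ 2) := by
    rw [Real.norm_eq_abs]
    have := sq_abs t
    nlinarith [sq_nonneg (|t| - 1)]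
  linarith

lemma kernel_cont {c : ℝ} (hc : 1 < c) :
    Continuous fun t : ℝ => 1 / (c + t * Complex.I : ℂ) - 1 / ((c + t * Complex.I : ℂ) + 1) := by
  have h0 : ∀ t : ℝ, (c + t * Complex.I : ℂ) ≠ 0 := by
    intro t h
    have := congrArg Complex.re h
    simp at this; linarith
  have h1 : ∀ t : ℝ, (c + t * Complex.I : ℂ) + 1 ≠ 0 := by
    intro t h
    have := congrArg Complex.re h
    simp at this; linarith
  fun_prop (disch := first | exact h0 _ | exact h1 _ | (intro x; first | exact h0 x | exact h1 x))

lemma kernel_int {c : ℝ} (hc : 1 < c) :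
    Integrable fun t : ℝ => 1 / (c + t * Complex.I : ℂ) - 1 / ((c + t * Complex.I : ℂ) + 1) := by
  have := (integrable_one_add_norm (E := ℝ) (μ := volume) (r := 2) (by simp)).const_mul 2
  refine this.mono' (kernel_cont hc).aestronglyMeasurable (Filter.Eventually.of_forall fun t => ?_)
  exact kernel_norm hc t

lemma fk_inv {c u : ℝ} (hc : 1 < c) (hu : 0 < u) :
    fk u = (1 / (2 * π)) • ∫ t : ℝ, (u : ℂ) ^ (-(c + t * Complex.I : ℂ)) *
      (1 / (c + t * Complex.I : ℂ) - 1 / ((c + t * Complex.I : ℂ) + 1)) := by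
  have hm : ∀ t : ℝ, mellin fk (c + t * Complex.I) =
      1 / (c + t * Complex.I : ℂ) - 1 / ((c + t * Complex.I : ℂ) + 1) := by
    intro t
    exact (fk_mellin (by simp; linarith)).2
  have hcont : ContinuousAt fk u := by
    have : ContinuousAt (fun u : ℝ => ((max (1 - u) 0 : ℝ) : ℂ)) u := by fun_prop
    refine this.congr ?_
    filter_upwards [lt_mem_nhds hu] with v hv using (fk_eq hv).symm
  have := mellinInv_mellin_eq c fk hu (fk_mellin (by simp; linarith)).1 (by
    unfold Complex.VerticalIntegrable
    simp_rw [hm]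
    exact kernel_int hc) hcont
  rw [← this, mellinInv]
  simp_rw [hm, smul_eq_mul]

lemma norm_LS_arg {x c t : ℝ} (hx : 0 < x) : ‖(x : ℂ) ^ (c + t * Complex.I : ℂ)‖ = x ^ c := by
  rw [Complex.norm_cpow_eq_rpow_re_of_pos hx]; simp

/-- Cesaro bound -/
lemma cesaro : ∃ C : ℝ, 0 < C ∧ ∀ (b : ℕ → ℂ) (M c x : ℝ), 1 < c → 0 < x → 0 ≤ M →
    LSeriesSummable b c →
    (∀ t : ℝ, ‖LSeries b (c + t * Complex.I)‖ ≤ M * (2 + |t|) ^ (1 / 2 : ℝ)) →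
    ‖∑ n ∈ Finset.Icc 1 ⌊x⌋₊, b n * ((1 - n / x : ℝ) : ℂ)‖ ≤ C * M * x ^ c := by
  set I₀ : ℝ := ∫ t : ℝ, (1 + ‖t‖) ^ (-(3 / 2) : ℝ) with hI₀
  have hIntg : Integrable (fun t : ℝ => (1 + ‖t‖) ^ (-(3 / 2) : ℝ)) :=
    integrable_one_add_norm (by simp; norm_num)
  have hI₀0 : 0 ≤ I₀ := integral_nonneg fun t => by positivity
  refine ⟨4 * I₀ + 1, by positivity, ?_⟩
  intro b M c x hc hx hM hsum hbd
  set Kr : ℝ → ℂ := fun t => 1 / (c + t * Complex.I : ℂ) - 1 / ((c + t * Complex.I : ℂ) + 1) with hKr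
  set F : ℕ → ℝ → ℂ := fun n t => LSeries.term b (c + t * Complex.I) n * ((x : ℂ) ^ (c + t * Complex.I : ℂ) * Kr t) with hF
  have hxne : (x : ℂ) ≠ 0 := by exact_mod_cast hx.ne'
  have hFn : ∀ n : ℕ, n ≠ 0 → ∀ t, F n t = b n * (((n / x : ℝ) : ℂ) ^ (-(c + t * Complex.I : ℂ)) * Kr t) := by
    intro n hn t
    have hn0 : (0 : ℝ) < n := by exact_mod_cast Nat.pos_of_ne_zero hn
    simp only [hF]
    rw [LSeries.term_of_ne_zero hn]
    have hxs : (x : ℂ) ^ (c + t * Complex.I : ℂ) ≠ 0 := by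
      rw [Ne, Complex.cpow_eq_zero_iff]; tauto
    have e : (n : ℂ) ^ (c + t * Complex.I : ℂ) =
        ((n / x : ℝ) : ℂ) ^ (c + t * Complex.I : ℂ) * (x : ℂ) ^ (c + t * Complex.I : ℂ) := by
      rw [← Complex.mul_cpow_ofReal_nonneg (by positivity) hx.le]
      congr 1
      push_cast; field_simp
    rw [e, Complex.cpow_neg]
    generalize ((n / x : ℝ) : ℂ) ^ (c + t * Complex.I : ℂ) = w
    field_simp
  have hFnorm : ∀ n t, ‖F n t‖ = ‖LSeries.term b c n‖ * x ^ c * ‖Kr t‖ := by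
    intro n t
    simp only [hF, norm_mul, norm_LS_arg hx]
    rw [LSeries.norm_term_eq, LSeries.norm_term_eq]
    simp
    ring_nf
  have hcontF : ∀ n, Continuous (F n) := by
    intro n
    have hk := kernel_cont hc
    by_cases hn : n = 0
    · have : F n = fun _ => 0 := by ext t; simp [hF, hn]
      rw [this]; exact continuous_const
    · simp only [hF]
      simp_rw [LSeries.term_of_ne_zero hn]
      have hn0 : (n : ℂ) ≠ 0 := by exact_mod_cast hn
      have h1 : Continuous fun t : ℝ => (n : ℂ) ^ (c + t * Complex.I : ℂ) :=
        Continuous.const_cpow (by fun_prop) (Or.inl hn0)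
      have h2 : Continuous fun t : ℝ => (x : ℂ) ^ (c + t * Complex.I : ℂ) :=
        Continuous.const_cpow (by fun_prop) (Or.inl hxne)
      have h3 : ∀ t : ℝ, (n : ℂ) ^ (c + t * Complex.I : ℂ) ≠ 0 := fun t => by
        rw [Ne, Complex.cpow_eq_zero_iff]; tauto
      exact (continuous_const.div h1 h3).mul (h2.mul hk)
  have hFint : ∀ n, Integrable (F n) := by
    intro n
    refine ((kernel_int hc).norm.const_mul (‖LSeries.term b c n‖ * x ^ c)).mono'
      (hcontF n).aestronglyMeasurable (Filter.Eventually.of_forall fun t => ?_)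
    exact (hFnorm n t).le
  have hs := MeasureTheory.hasSum_integral_of_summable_integral_norm hFint (by
    have : ∀ n, ∫ t, ‖F n t‖ = ‖LSeries.term b c n‖ * (x ^ c * ∫ t, ‖Kr t‖) := by
      intro n
      simp_rw [hFnorm]
      rw [integral_const_mul, mul_assoc]
    simp_rw [this]
    exact (Summable.norm hsum).mul_right _)
  -- identify the terms
  have hterm : ∀ n : ℕ, ∫ t, F n t = if n ∈ Finset.Icc 1 ⌊x⌋₊ then (2 * π) * (b n * ((1 - n / x : ℝ) : ℂ)) else 0 := by
    intro n
    by_cases hn : n = 0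
    · have : F n = fun _ => 0 := by ext t; simp [hF, hn]
      rw [this, if_neg (by rw [hn]; simp)]; simp
    · have hn0 : (0 : ℝ) < n := by exact_mod_cast Nat.pos_of_ne_zero hn
      have hi := fk_inv (u := n / x) hc (by positivity)
      simp_rw [hFn n hn]
      rw [integral_const_mul]
      have hpi : (π : ℂ) ≠ 0 := by exact_mod_cast pi_ne_zero
      have hi2 : ∫ t : ℝ, ((n / x : ℝ) : ℂ) ^ (-(c + t * Complex.I : ℂ)) * Kr t = (2 * π) * fk (n / x) := by
        rw [hi, Complex.real_smul, ← mul_assoc]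
        have : (2 * π : ℂ) * ((1 / (2 * π) : ℝ) : ℂ) = 1 := by push_cast; field_simp
        rw [this, one_mul]
      rw [hi2, fk_eq (by positivity)]
      split_ifs with hm
      · rw [Finset.mem_Icc] at hm
        have : (n : ℝ) ≤ x := (Nat.le_floor_iff hx.le).1 hm.2
        rw [max_eq_left (by rw [sub_nonneg, div_le_one hx]; exact this)]
        ring
      · have : x ≤ (n : ℝ) := by
          by_contra h
          push Not at h
          exact hm (Finset.mem_Icc.2 ⟨Nat.one_le_iff_ne_zero.2 hn, Nat.le_floor h.le⟩)
        rw [max_eq_right (by rw [sub_nonpos, one_le_div hx]; exact this)]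
        simp
  have hfin : HasSum (fun n => ∫ t, F n t) (∑ n ∈ Finset.Icc 1 ⌊x⌋₊, (2 * π) * (b n * ((1 - n / x : ℝ) : ℂ))) := by
    have h1 : HasSum (fun n => ∫ t, F n t) (∑ n ∈ Finset.Icc 1 ⌊x⌋₊, ∫ t, F n t) :=
      hasSum_sum_of_ne_finset_zero (fun n hn => by rw [hterm, if_neg hn])
    convert h1 using 1
    refine Finset.sum_congr rfl fun n hn => ?_
    rw [hterm, if_pos hn]
  have heq := hfin.unique hs
  rw [← Finset.mul_sum] at heq
  have hbound : ‖∫ t : ℝ, (∑' n, F n t)‖ ≤ ∫ t : ℝ, (4 * M * x ^ c) * (1 + ‖t‖) ^ (-(3 / 2) : ℝ) := by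
    refine norm_integral_le_of_norm_le (hIntg.const_mul _) (Filter.Eventually.of_forall fun t => ?_)
    have : ∑' n, F n t = LSeries b (c + t * Complex.I) * ((x : ℂ) ^ (c + t * Complex.I : ℂ) * Kr t) := by
      simp only [hF]
      rw [tsum_mul_right]; rfl
    rw [this, norm_mul, norm_mul, norm_LS_arg hx]
    have e1 : (2 + |t|) ^ (1 / 2 : ℝ) ≤ 2 * (1 + ‖t‖) ^ (1 / 2 : ℝ) := by
      rw [Real.norm_eq_abs]
      calc (2 + |t|) ^ (1 / 2 : ℝ) ≤ (4 * (1 + |t|)) ^ (1 / 2 : ℝ) := by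
            gcongr; linarith [abs_nonneg t]
        _ = 4 ^ (1 / 2 : ℝ) * (1 + |t|) ^ (1 / 2 : ℝ) := Real.mul_rpow (by norm_num) (by positivity)
        _ = _ := by
          rw [show (4 : ℝ) = 2 ^ (2 : ℝ) by norm_num, ← Real.rpow_mul (by norm_num)]; norm_num
    calc _ ≤ (M * (2 * (1 + ‖t‖) ^ (1 / 2 : ℝ))) * (x ^ c * (2 * (1 + ‖t‖) ^ (-2 : ℝ))) := by
          have h1 := hbd t
          have h2 := kernel_norm hc t
          have h3 : M * (2 + |t|) ^ (1 / 2 : ℝ) ≤ M * (2 * (1 + ‖t‖) ^ (1 / 2 : ℝ)) := by gcongr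
          gcongr
          exact h1.trans h3
      _ = 4 * M * x ^ c * ((1 + ‖t‖) ^ (1 / 2 : ℝ) * (1 + ‖t‖) ^ (-2 : ℝ)) := by ring
      _ = _ := by
        rw [← Real.rpow_add (by positivity)]; norm_num
  rw [← heq, integral_const_mul, norm_mul] at hbound
  have hpi : ‖(2 * π : ℂ)‖ = 2 * π := by
    rw [show (2 * π : ℂ) = ((2 * π : ℝ) : ℂ) by push_cast; rfl, Complex.norm_real, Real.norm_eq_abs,
      abs_of_pos (by positivity)]
  rw [hpi, ← hI₀] at hbound
  have hge : 1 ≤ 2 * π := by linarith [pi_gt_three]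
  have hxc : 0 < x ^ c := by positivity
  calc _ ≤ 2 * π * ‖∑ n ∈ Finset.Icc 1 ⌊x⌋₊, b n * ((1 - n / x : ℝ) : ℂ)‖ :=
        le_mul_of_one_le_left (norm_nonneg _) hge
    _ ≤ _ := hbound
    _ ≤ _ := by nlinarith [mul_nonneg hM hxc.le]

end ATR

namespace ATR

lemma logMul_iter (a : ℕ → ℂ) (j n : ℕ) : (LSeries.logMul^[j] a) n = ((Real.log n) ^ j : ℝ) * a n := by
  induction j with
  | zero => simp
  | succ j ih =>
    rw [Function.iterate_succ_apply', LSeries.logMul, ih, ← Complex.natCast_log]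
    push_cast; ring

lemma one_le_log {x : ℝ} (hx : 3 ≤ x) : 1 ≤ Real.log x := by
  rw [Real.le_log_iff_exp_le (by linarith)]
  linarith [Real.exp_one_lt_d9]

lemma log_pow_le {x : ℝ} (hx : 3 ≤ x) (k : ℕ) : Real.log x ^ k ≤ k.factorial * x := by
  have h1 := one_le_log hx
  have := Real.pow_div_factorial_le_exp (Real.log x) (by linarith) k
  rw [Real.exp_log (by linarith), div_le_iff₀ (by positivity)] at this
  linarith

lemma rpow_c {x : ℝ} (hx : 3 ≤ x) : x ^ (1 + 1 / Real.log x) ≤ 3 * x := by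
  have h1 := one_le_log hx
  have hx0 : 0 < x := by linarith
  rw [Real.rpow_add hx0, Real.rpow_one, Real.rpow_def_of_pos hx0, mul_one_div_cancel (by linarith)]
  nlinarith [Real.exp_one_lt_d9]

lemma unsmooth (m : ℕ) (hm : 1 ≤ m) : ∃ C : ℝ, 0 < C ∧ ∀ (a : ℕ → ℂ) (M : ℝ), 1 ≤ M →
    (∀ n : ℕ, ‖a n‖ ≤ 1 + Real.log n) → LSeries.abscissaOfAbsConv a ≤ (1 : ℝ) →
    (∀ s : ℂ, 1 < s.re → s.re ≤ 2 →
      ‖iteratedDeriv (2 * m - 1) (LSeries a) s‖ ≤ M * (2 + |s.im|) ^ (1 / 2 : ℝ)) →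
    ∀ x : ℝ, 3 ≤ x → ‖∑ n ∈ Finset.Icc 0 ⌊x⌋₊, ((Real.log n) ^ (2 * m - 1) : ℝ) * a n‖ ≤
      C * M * x * Real.log x ^ m := by
  obtain ⟨C₀, hC₀, hces⟩ := cesaro
  refine ⟨15 * C₀ + 9 ^ m * (1 + (2 * m).factorial), by positivity, ?_⟩
  intro a M hM ha hab hD x hx
  set j := 2 * m - 1 with hj
  have hjm : j + 1 = 2 * m := by omega
  have hj0 : j ≠ 0 := by omega
  set b : ℕ → ℂ := fun n => ((Real.log n) ^ j : ℝ) * a n with hb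
  have hbeq : LSeries.logMul^[j] a = b := by ext n; exact logMul_iter a j n
  have hS : ∀ y : ℝ, 3 ≤ y → ‖∑ n ∈ Finset.Icc 1 ⌊y⌋₊, b n * ((1 - n / y : ℝ) : ℂ)‖ ≤ C₀ * M * (3 * y) := by
    intro y hy
    have hl := one_le_log hy
    have hl0 : 0 < 1 / Real.log y := by positivity
    have hl1 : 1 / Real.log y ≤ 1 := by rw [div_le_one (by linarith)]; exact hl
    refine (hces b M (1 + 1 / Real.log y) y (by linarith) (by linarith) (by linarith) ?_ ?_).trans ?_
    · apply LSeriesSummable_of_abscissaOfAbsConv_lt_re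
      rw [← hbeq, LSeries.absicssaOfAbsConv_logPowMul]
      refine lt_of_le_of_lt hab ?_
      have : (1 : ℝ) < ((1 + 1 / Real.log y : ℝ) : ℂ).re := by rw [Complex.ofReal_re]; linarith
      exact_mod_cast this
    · intro t
      set s : ℂ := ((1 + 1 / Real.log y : ℝ) : ℂ) + t * Complex.I with hs
      have hre : s.re = 1 + 1 / Real.log y := by simp [hs]
      have him : s.im = t := by simp [hs]
      have h1 := hD s (by rw [hre]; linarith) (by rw [hre]; linarith)
      rw [him, LSeries_iteratedDeriv j (lt_of_le_of_lt hab (by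
        have : (1 : ℝ) < s.re := by rw [hre]; linarith
        exact_mod_cast this)), hbeq, norm_mul, norm_pow, norm_neg, norm_one, one_pow, one_mul] at h1
      exact h1
    · gcongr; exact rpow_c hy
  set L := Real.log x with hL
  have hL1 : 1 ≤ L := one_le_log hx
  have hx0 : 0 < x := by linarith
  set h := x / L ^ m with hh
  have hLm : 1 ≤ L ^ m := one_le_pow₀ hL1
  have hh0 : 0 < h := by positivity
  have hhx : h ≤ x := div_le_self hx0.le hLm
  set N := ⌊x⌋₊ with hN
  set N' := ⌊x + h⌋₊ with hN'
  have hNN : N ≤ N' := Nat.floor_le_floor (by linarith)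
  -- split
  have hsplit : ∀ f : ℕ → ℂ, ∑ n ∈ Finset.Icc 1 N', f n = ∑ n ∈ Finset.Icc 1 N, f n + ∑ n ∈ Finset.Ioc N N', f n := by
    intro f
    rw [← Finset.sum_union]
    · congr 1
      ext n
      simp only [Finset.mem_Icc, Finset.mem_union, Finset.mem_Ioc]; omega
    · rw [Finset.disjoint_left]; intro n
      simp only [Finset.mem_Icc, Finset.mem_Ioc]; omega
  have e1 : ((x + h : ℝ) : ℂ) * ∑ n ∈ Finset.Icc 1 N', b n * ((1 - n / (x + h) : ℝ) : ℂ) =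
      ∑ n ∈ Finset.Icc 1 N, b n * ((x + h - n : ℝ) : ℂ) + ∑ n ∈ Finset.Ioc N N', b n * ((x + h - n : ℝ) : ℂ) := by
    rw [← hsplit, Finset.mul_sum]
    refine Finset.sum_congr rfl fun n _ => ?_
    have : ((x + h : ℝ) : ℂ) ≠ 0 := by exact_mod_cast (by linarith : x + h ≠ 0)
    rw [show (1 - n / (x + h) : ℝ) = (x + h - n) / (x + h) by field_simp]
    rw [Complex.ofReal_div]; field_simp
  have e2 : ((x : ℝ) : ℂ) * ∑ n ∈ Finset.Icc 1 N, b n * ((1 - n / x : ℝ) : ℂ) =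
      ∑ n ∈ Finset.Icc 1 N, b n * ((x - n : ℝ) : ℂ) := by
    rw [Finset.mul_sum]
    refine Finset.sum_congr rfl fun n _ => ?_
    have : ((x : ℝ) : ℂ) ≠ 0 := by exact_mod_cast hx0.ne'
    rw [show (1 - n / x : ℝ) = (x - n) / x by field_simp]
    rw [Complex.ofReal_div]; field_simp
  have e3 : (h : ℂ) * ∑ n ∈ Finset.Icc 1 N, b n =
      ((x + h : ℝ) : ℂ) * ∑ n ∈ Finset.Icc 1 N', b n * ((1 - n / (x + h) : ℝ) : ℂ) -
      ((x : ℝ) : ℂ) * ∑ n ∈ Finset.Icc 1 N, b n * ((1 - n / x : ℝ) : ℂ) -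
      ∑ n ∈ Finset.Ioc N N', b n * ((x + h - n : ℝ) : ℂ) := by
    rw [e1, e2, add_sub_right_comm, add_sub_cancel_right, ← Finset.sum_sub_distrib, Finset.mul_sum]
    refine Finset.sum_congr rfl fun n _ => ?_
    push_cast; ring
  have hR : ‖∑ n ∈ Finset.Ioc N N', b n * ((x + h - n : ℝ) : ℂ)‖ ≤ (h + 1) * ((3 * L) ^ (2 * m) * h) := by
    have hcard : ((Finset.Ioc N N').card : ℝ) ≤ h + 1 := by
      rw [Nat.card_Ioc, Nat.cast_sub hNN]
      have h1 := Nat.floor_le (show 0 ≤ x + h by linarith)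
      have h2 := Nat.lt_floor_add_one x
      rw [← hN] at h2; rw [← hN'] at h1
      linarith
    refine (norm_sum_le_of_le (f := fun n => b n * ((x + h - n : ℝ) : ℂ)) (n := fun _ => (3 * L) ^ (2 * m) * h) _ ?_).trans ?_
    · intro n hn
      rw [Finset.mem_Ioc] at hn
      have hn1 : x < n := (Nat.floor_lt hx0.le).1 hn.1
      have hn2 : (n : ℝ) ≤ x + h := (Nat.le_floor_iff (by linarith)).1 hn.2
      have hn0 : (0 : ℝ) < n := by linarith
      have hlog : Real.log n ≤ 1 + L := by
        calc Real.log n ≤ Real.log (2 * x) := Real.log_le_log hn0 (by linarith)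
          _ = Real.log 2 + L := Real.log_mul (by norm_num) hx0.ne'
          _ ≤ _ := by linarith [Real.log_two_lt_d9]
      have hlog0 : 0 ≤ Real.log n := Real.log_nonneg (by linarith)
      rw [norm_mul]
      gcongr
      · simp only [hb]
        rw [norm_mul, Complex.norm_real, Real.norm_eq_abs, abs_of_nonneg (by positivity), ← hjm, pow_succ]
        have := ha n
        gcongr
        · linarith
        · linarith
      · rw [Complex.norm_real, Real.norm_eq_abs, abs_le]; constructor <;> linarith
    · rw [Finset.sum_const, nsmul_eq_mul]
      gcongr
  have h1 := hS (x + h) (by linarith)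
  have h2 := hS x hx
  have hfin : h * ‖∑ n ∈ Finset.Icc 1 N, b n‖ ≤ 15 * C₀ * M * x ^ 2 + (h + 1) * ((3 * L) ^ (2 * m) * h) := by
    have : h * ‖∑ n ∈ Finset.Icc 1 N, b n‖ = ‖(h : ℂ) * ∑ n ∈ Finset.Icc 1 N, b n‖ := by
      rw [norm_mul, Complex.norm_real, Real.norm_eq_abs, abs_of_pos hh0]
    rw [this, e3]
    refine (norm_sub_le _ _).trans (add_le_add ((norm_sub_le _ _).trans ?_) hR)
    rw [norm_mul, norm_mul, Complex.norm_real, Real.norm_eq_abs, abs_of_pos (by linarith),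
      Complex.norm_real, Real.norm_eq_abs, abs_of_pos hx0]
    calc _ ≤ (2 * x) * (C₀ * M * (3 * (2 * x))) + x * (C₀ * M * (3 * x)) := by
          gcongr
          · linarith
          · refine h1.trans ?_
            gcongr; linarith
      _ = _ := by ring
  have hzero : ∑ n ∈ Finset.Icc 0 N, b n = ∑ n ∈ Finset.Icc 1 N, b n := by
    symm
    apply Finset.sum_subset
    · intro n; simp only [Finset.mem_Icc]; omega
    · intro n hn hn'
      have : n = 0 := by
        simp only [Finset.mem_Icc] at hn hn'; omega
      rw [this]; simp [hb, hj0]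
  show ‖∑ n ∈ Finset.Icc 0 N, b n‖ ≤ _
  rw [hzero]
  have hxh : x = h * L ^ m := by rw [hh]; field_simp
  have hLf : L ^ (2 * m) ≤ (2 * m).factorial * x := log_pow_le hx _
  have h9 : (3 * L) ^ (2 * m) = 9 ^ m * L ^ (2 * m) := by
    rw [mul_pow, pow_mul]; norm_num
  refine le_of_mul_le_mul_left (hfin.trans ?_) hh0
  have k1 : h * L ^ (2 * m) = x * L ^ m := by
    rw [hh, two_mul, pow_add]; field_simp
  have k2 : 1 * L ^ (2 * m) ≤ (2 * m).factorial * x * L ^ m := by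
    rw [one_mul]
    exact hLf.trans (le_mul_of_one_le_right (by positivity) hLm)
  calc 15 * C₀ * M * x ^ 2 + (h + 1) * ((3 * L) ^ (2 * m) * h)
      = h * (15 * C₀ * M * x * L ^ m + 9 ^ m * (h * L ^ (2 * m) + 1 * L ^ (2 * m))) := by
        rw [h9, sq]
        nth_rewrite 1 [hxh]
        ring
    _ ≤ h * (15 * C₀ * M * x * L ^ m + 9 ^ m * (x * L ^ m + (2 * m).factorial * x * L ^ m)) := by
        rw [k1]; gcongr
    _ = h * (15 * C₀ * M * x * L ^ m + 1 * (9 ^ m * (1 + (2 * m).factorial) * x * L ^ m)) := by ring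
    _ ≤ h * (15 * C₀ * M * x * L ^ m + M * (9 ^ m * (1 + (2 * m).factorial) * x * L ^ m)) := by gcongr
    _ = _ := by ring

end ATR

namespace ATR

lemma log_ratio (e : ℝ) (he : 0 ≤ e) : ∃ C : ℝ, 0 < C ∧ ∀ t x : ℝ, 3 ≤ t → t ≤ x →
    Real.log t ^ (-e) ≤ C * Real.log x ^ (-e) * (x / t) ^ (1 / 2 : ℝ) := by
  set N := ⌈e⌉₊ with hN
  refine ⟨2 ^ N * N.factorial * 2, by positivity, ?_⟩
  intro t x ht htx
  have h1 := one_le_log ht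
  have h2 := one_le_log (ht.trans htx)
  have ht0 : 0 < t := by linarith
  have hx0 : 0 < x := by linarith
  set u := x / t with hu
  have hu1 : 1 ≤ u := by rw [hu, one_le_div ht0]; exact htx
  have hlu : Real.log u = Real.log x - Real.log t := Real.log_div hx0.ne' ht0.ne'
  have hlu0 : 0 ≤ Real.log u := Real.log_nonneg hu1
  have h3 : Real.log x / Real.log t ≤ 1 + Real.log u := by
    rw [div_le_iff₀ (by linarith)]; nlinarith
  have h4 : (Real.log x / Real.log t) ^ e ≤ 2 ^ N * N.factorial * 2 * u ^ (1 / 2 : ℝ) := by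
    calc _ ≤ (1 + Real.log u) ^ e := by gcongr
      _ ≤ (1 + Real.log u) ^ (N : ℝ) := by
        apply Real.rpow_le_rpow_of_exponent_le (by linarith) (Nat.le_ceil e)
      _ = (1 + Real.log u) ^ N := Real.rpow_natCast _ _
      _ = 2 ^ N * ((1 + Real.log u) / 2) ^ N := by rw [← mul_pow]; congr 1; ring
      _ ≤ 2 ^ N * (N.factorial * Real.exp ((1 + Real.log u) / 2)) := by
        have := Real.pow_div_factorial_le_exp ((1 + Real.log u) / 2) (by linarith) N
        rw [div_le_iff₀ (by positivity)] at this
        gcongr; linarith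
      _ ≤ 2 ^ N * (N.factorial * (2 * u ^ (1 / 2 : ℝ))) := by
        have e1 : Real.exp ((1 + Real.log u) / 2) = Real.exp (1 / 2) * u ^ (1 / 2 : ℝ) := by
          rw [Real.rpow_def_of_pos (by linarith), ← Real.exp_add]; congr 1; ring
        have e2 : Real.exp (1 / 2) ≤ 2 := by
          rw [← Real.le_log_iff_exp_le (by norm_num)]; linarith [Real.log_two_gt_d9]
        rw [e1]; gcongr
      _ = _ := by ring
  rw [Real.div_rpow (by linarith) (by linarith), div_le_iff₀ (by positivity)] at h4
  rw [Real.rpow_neg (by linarith), Real.rpow_neg (by linarith)]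
  have p1 : 0 < Real.log t ^ e := by positivity
  have p2 : 0 < Real.log x ^ e := by positivity
  rw [inv_le_iff_one_le_mul₀ p1]
  have : 2 ^ N * ↑N.factorial * 2 * (Real.log x ^ e)⁻¹ * u ^ (1 / 2 : ℝ) * Real.log t ^ e =
    (2 ^ N * ↑N.factorial * 2 * u ^ (1 / 2 : ℝ) * Real.log t ^ e) / (Real.log x ^ e) := by
    field_simp
  rw [this, one_le_div p2]; exact h4

lemma hasDeriv_logpow (j : ℕ) {t : ℝ} (ht : 3 ≤ t) :
    HasDerivAt (fun t : ℝ => (((Real.log t ^ j)⁻¹ : ℝ) : ℂ))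
      ((-(j * Real.log t ^ (j - 1) * t⁻¹) / (Real.log t ^ j) ^ 2 : ℝ) : ℂ) t := by
  have h1 := one_le_log ht
  exact (((Real.hasDerivAt_log (by linarith)).pow j).inv (pow_ne_zero _ (by linarith))).ofReal_comp

lemma abel_log (r : ℝ) (j : ℕ) (hj : 1 ≤ j) (he : r ≤ j) : ∃ C : ℝ, 0 < C ∧ ∀ (c : ℕ → ℂ) (H : ℝ), 0 ≤ H →
    (∀ t : ℝ, 3 ≤ t → ‖∑ n ∈ Finset.Icc 0 ⌊t⌋₊, c n‖ ≤ H * t * Real.log t ^ r) →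
    ∀ x : ℝ, 3 ≤ x → ‖∑ n ∈ Finset.Ioc 3 ⌊x⌋₊, (((Real.log n ^ j)⁻¹ : ℝ) : ℂ) * c n‖ ≤
      C * H * x * Real.log x ^ (r - j) := by
  obtain ⟨C, hC, hr⟩ := log_ratio (j - r) (by linarith)
  refine ⟨1 + 3 * C + 2 * j * C, by positivity, ?_⟩
  intro c H hH hS x hx
  have hx0 : 0 < x := by linarith
  have hL := one_le_log hx
  set f : ℝ → ℂ := fun t : ℝ => (((Real.log t ^ j)⁻¹ : ℝ) : ℂ) with hf
  have hne : -(j - r) = r - j := by ring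
  rw [hne] at hr
  have hder : ∀ t ∈ Set.Icc 3 x, deriv f t = ((-(j * Real.log t ^ (j - 1) * t⁻¹) / (Real.log t ^ j) ^ 2 : ℝ) : ℂ) :=
    fun t ht => (hasDeriv_logpow j ht.1).deriv
  have hab := sum_mul_eq_sub_sub_integral_mul c (f := f) (a := 3) (b := x) (by norm_num) hx
    (fun t ht => (hasDeriv_logpow j ht.1).differentiableAt) (by
      refine IntegrableOn.congr_fun ?_ (fun t ht => (hder t ht).symm) measurableSet_Icc
      apply ContinuousOn.integrableOn_Icc
      apply Complex.continuous_ofReal.comp_continuousOn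
      have c1 : ContinuousOn Real.log (Set.Icc 3 x) :=
        Real.continuousOn_log.mono fun t ht => by simp; linarith [ht.1]
      have c2 : ContinuousOn (fun t : ℝ => t⁻¹) (Set.Icc 3 x) :=
        continuousOn_inv₀.mono fun t ht => by simp; linarith [ht.1]
      refine ContinuousOn.div (((continuousOn_const.mul (c1.pow _)).mul c2).neg) ((c1.pow _).pow _) ?_
      intro t ht
      have := one_le_log ht.1
      positivity)
  rw [show ⌊(3 : ℝ)⌋₊ = 3 by norm_num] at hab
  have hfn : ∀ t : ℝ, 3 ≤ t → ‖f t‖ = Real.log t ^ (-(j : ℝ)) := by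
    intro t ht
    have := one_le_log ht
    simp only [hf]
    rw [Complex.norm_real, Real.norm_eq_abs, abs_of_nonneg (by positivity), Real.rpow_neg (by linarith),
      Real.rpow_natCast]
  have hfs : ∀ t : ℝ, 3 ≤ t → ‖f t * ∑ n ∈ Finset.Icc 0 ⌊t⌋₊, c n‖ ≤ H * t * Real.log t ^ (r - j) := by
    intro t ht
    have := one_le_log ht
    rw [norm_mul, hfn t ht, sub_eq_add_neg, Real.rpow_add (by linarith)]
    calc _ ≤ Real.log t ^ (-(j : ℝ)) * (H * t * Real.log t ^ r) := by gcongr; exact hS t ht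
      _ = _ := by ring
  have t1 := hfs x hx
  have t2 : ‖f 3 * ∑ n ∈ Finset.Icc 0 3, c n‖ ≤ 3 * C * H * x * Real.log x ^ (r - j) := by
    have := hfs 3 le_rfl
    rw [show ⌊(3 : ℝ)⌋₊ = 3 by norm_num] at this
    refine this.trans ?_
    have h1 := hr 3 x le_rfl hx
    have h2 : (x / 3) ^ (1 / 2 : ℝ) ≤ x := by
      calc _ ≤ x ^ (1 / 2 : ℝ) := by gcongr; linarith
        _ ≤ x ^ (1 : ℝ) := by gcongr <;> linarith
        _ = x := Real.rpow_one x
    calc _ ≤ H * 3 * (C * Real.log x ^ (r - j) * x) := by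
          gcongr
          refine h1.trans ?_
          gcongr
      _ = _ := by ring
  have t3 : ‖∫ t in Set.Ioc 3 x, deriv f t * ∑ n ∈ Finset.Icc 0 ⌊t⌋₊, c n‖ ≤
      2 * j * C * H * x * Real.log x ^ (r - j) := by
    rw [← intervalIntegral.integral_of_le hx]
    have hIntg : IntervalIntegrable (fun t : ℝ => j * H * C * Real.log x ^ (r - j) * x ^ (1 / 2 : ℝ) * t ^ (-(1 / 2) : ℝ)) volume 3 x :=
      (intervalIntegral.intervalIntegrable_rpow' (by norm_num)).const_mul _
    refine (intervalIntegral.norm_integral_le_of_norm_le (g := fun t : ℝ =>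
      j * H * C * Real.log x ^ (r - j) * x ^ (1 / 2 : ℝ) * t ^ (-(1 / 2) : ℝ)) hx ?_ hIntg).trans ?_
    · refine Filter.Eventually.of_forall fun t ht => ?_
      have ht3 : 3 ≤ t := ht.1.le
      have hl := one_le_log ht3
      rw [hder t ⟨ht3, ht.2⟩, norm_mul, Complex.norm_real, Real.norm_eq_abs, abs_div, abs_neg,
        abs_of_nonneg (by positivity), abs_of_nonneg (by positivity)]
      have e1 : j * Real.log t ^ (j - 1) * t⁻¹ / (Real.log t ^ j) ^ 2 ≤ j * Real.log t ^ (-(j : ℝ)) * t⁻¹ := by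
        rw [Real.rpow_neg (by linarith), Real.rpow_natCast, div_le_iff₀ (by positivity)]
        calc _ ≤ j * Real.log t ^ j * t⁻¹ := by gcongr; omega
          _ = _ := by field_simp
      calc _ ≤ (j * Real.log t ^ (-(j : ℝ)) * t⁻¹) * (H * t * Real.log t ^ r) := by
            gcongr; exact hS t ht3
        _ = j * H * Real.log t ^ (r - j) := by
            rw [sub_eq_add_neg, Real.rpow_add (by linarith)]; field_simp
        _ ≤ j * H * (C * Real.log x ^ (r - j) * (x / t) ^ (1 / 2 : ℝ)) := by
            gcongr; exact hr t x ht3 ht.2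
        _ = _ := by
            rw [Real.div_rpow hx0.le (by linarith), Real.rpow_neg (by linarith)]; ring
    · rw [intervalIntegral.integral_const_mul, integral_rpow (Or.inl (by norm_num))]
      have e1 : x ^ (1 / 2 : ℝ) * x ^ (1 / 2 : ℝ) = x := by
        rw [← Real.rpow_add hx0]; norm_num
      have e2 : (x ^ (-(1 / 2) + 1 : ℝ) - 3 ^ (-(1 / 2) + 1 : ℝ)) / (-(1 / 2) + 1) ≤ 2 * x ^ (1 / 2 : ℝ) := by
        rw [show (-(1 / 2) + 1 : ℝ) = 1 / 2 by norm_num]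
        have : (0 : ℝ) ≤ 3 ^ (1 / 2 : ℝ) := by positivity
        rw [div_le_iff₀ (by norm_num)]; linarith
      calc _ ≤ j * H * C * Real.log x ^ (r - j) * x ^ (1 / 2 : ℝ) * (2 * x ^ (1 / 2 : ℝ)) := by gcongr
        _ = 2 * j * C * H * (x ^ (1 / 2 : ℝ) * x ^ (1 / 2 : ℝ)) * Real.log x ^ (r - j) := by ring
        _ = _ := by rw [e1]
  rw [hab]
  refine (norm_sub_le _ _).trans ?_
  have := norm_sub_le (f x * ∑ n ∈ Finset.Icc 0 ⌊x⌋₊, c n) (f 3 * ∑ n ∈ Finset.Icc 0 3, c n)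
  calc _ ≤ H * x * Real.log x ^ (r - j) + 3 * C * H * x * Real.log x ^ (r - j) +
      2 * j * C * H * x * Real.log x ^ (r - j) := by linarith
    _ = _ := by ring

/-- Tauberian theorem: for every A there is m -/
lemma tauber (m : ℕ) (hm : 1 ≤ m) : ∃ C : ℝ, 0 < C ∧ ∀ (a : ℕ → ℂ) (M : ℝ), 1 ≤ M →
    (∀ n : ℕ, ‖a n‖ ≤ 1 + Real.log n) → LSeries.abscissaOfAbsConv a ≤ (1 : ℝ) →
    (∀ s : ℂ, 1 < s.re → s.re ≤ 2 →
      ‖iteratedDeriv (2 * m - 1) (LSeries a) s‖ ≤ M * (2 + |s.im|) ^ (1 / 2 : ℝ)) →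
    ∀ x : ℝ, 3 ≤ x → ‖∑ n ∈ Finset.Icc 0 ⌊x⌋₊, a n‖ ≤ C * M * x / Real.log x ^ (m - 1) := by
  obtain ⟨C₁, hC₁, h₁⟩ := unsmooth m hm
  obtain ⟨C₂, hC₂, h₂⟩ := abel_log m (2 * m - 1) (by omega) (by exact_mod_cast (by omega : m ≤ 2 * m - 1))
  refine ⟨C₂ * C₁ + 12 * (m - 1).factorial, by positivity, ?_⟩
  intro a M hM ha hab hD x hx
  have hL := one_le_log hx
  have h := h₂ (fun n => ((Real.log n) ^ (2 * m - 1) : ℝ) * a n) (C₁ * M) (by positivity) (by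
    intro t ht
    rw [Real.rpow_natCast]
    exact h₁ a M hM ha hab hD t ht) x hx
  have e1 : ∑ n ∈ Finset.Ioc 3 ⌊x⌋₊, (((Real.log n ^ (2 * m - 1))⁻¹ : ℝ) : ℂ) * (((Real.log n) ^ (2 * m - 1) : ℝ) * a n) =
      ∑ n ∈ Finset.Ioc 3 ⌊x⌋₊, a n := by
    refine Finset.sum_congr rfl fun n hn => ?_
    rw [Finset.mem_Ioc] at hn
    have : 1 ≤ Real.log n := one_le_log (by exact_mod_cast hn.1.le)
    rw [← mul_assoc, ← Complex.ofReal_mul, inv_mul_cancel₀ (by positivity)]; simp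
  rw [e1] at h
  have e2 : Real.log x ^ ((m : ℝ) - (2 * m - 1 : ℕ)) = (Real.log x ^ (m - 1))⁻¹ := by
    rw [← Real.rpow_natCast, ← Real.rpow_neg (by linarith)]
    congr 1
    push_cast [hm, show 1 ≤ 2 * m by omega]; ring
  rw [e2] at h
  have hf3 : 3 ≤ ⌊x⌋₊ := Nat.le_floor (by exact_mod_cast hx)
  have e3 : ∑ n ∈ Finset.Icc 0 ⌊x⌋₊, a n = ∑ n ∈ Finset.Icc 0 3, a n + ∑ n ∈ Finset.Ioc 3 ⌊x⌋₊, a n := by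
    rw [← Finset.sum_union]
    · congr 1
      ext n
      simp only [Finset.mem_Icc, Finset.mem_union, Finset.mem_Ioc]; omega
    · rw [Finset.disjoint_left]; intro n
      simp only [Finset.mem_Icc, Finset.mem_Ioc]; omega
  have e4 : ‖∑ n ∈ Finset.Icc 0 3, a n‖ ≤ 12 := by
    refine (norm_sum_le_of_le (f := a) (n := fun _ => 3) _ ?_).trans ?_
    · intro n hn
      rw [Finset.mem_Icc] at hn
      refine (ha n).trans ?_
      have h3 : Real.log n ≤ 2 := by
        rcases Nat.eq_zero_or_pos n with h0 | h0
        · rw [h0]; simp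
        · have := Real.log_le_sub_one_of_pos (show (0 : ℝ) < n by exact_mod_cast h0)
          have : (n : ℝ) ≤ 3 := by exact_mod_cast hn.2
          linarith
      linarith
    · simp; norm_num
  have e5 : (12 : ℝ) ≤ 12 * (m - 1).factorial * M * x / Real.log x ^ (m - 1) := by
    rw [le_div_iff₀ (by positivity)]
    have := log_pow_le hx (m - 1)
    calc 12 * Real.log x ^ (m - 1) ≤ 12 * ((m - 1).factorial * x) * 1 := by rw [mul_one]; gcongr
      _ ≤ 12 * ((m - 1).factorial * x) * M := by gcongr
      _ = _ := by ring
  rw [e3]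
  refine (norm_add_le _ _).trans ?_
  calc _ ≤ 12 * (m - 1).factorial * M * x / Real.log x ^ (m - 1) + C₂ * (C₁ * M) * x * (Real.log x ^ (m - 1))⁻¹ :=
        add_le_add (e4.trans e5) h
    _ = _ := by ring

end ATR

namespace ATR

lemma vm_norm {q : ℕ} (χ : DirichletCharacter ℂ q) (n : ℕ) : ‖vm χ n‖ ≤ Real.log n := by
  simp only [vm, Pi.mul_apply]
  rw [norm_mul, Complex.norm_real, Real.norm_eq_abs, abs_of_nonneg ArithmeticFunction.vonMangoldt_nonneg]
  have h1 := χ.norm_le_one (n : ZMod q)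
  have h2 := ArithmeticFunction.vonMangoldt_le_log (n := n)
  have h3 := ArithmeticFunction.vonMangoldt_nonneg (n := n)
  nlinarith [norm_nonneg (χ (n : ZMod q))]

lemma psi_chi (A : ℕ) : ∃ K : ℝ, 0 < K ∧ ∀ (q : ℕ) [NeZero q] (χ : DirichletCharacter ℂ q), χ ≠ 1 →
    ∀ x : ℝ, 3 ≤ x → ‖∑ n ∈ Finset.Icc 0 ⌊x⌋₊, vm χ n‖ ≤ K * q * x / Real.log x ^ A := by
  obtain ⟨C, hC, h⟩ := tauber (A + 1) (by omega)
  obtain ⟨M, hM, hM'⟩ := iter_vm (2 * (A + 1) - 1)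
  refine ⟨C * M, by positivity, ?_⟩
  intro q _ χ hχ x hx
  have hq : (1 : ℝ) ≤ q := by exact_mod_cast NeZero.one_le
  have := h (vm χ) (M * q) (by nlinarith) (fun n => (vm_norm χ n).trans (by linarith)) (vm_abs χ) (by
    intro s hs1 hs2
    refine (hM' q χ hχ s hs1 hs2).trans ?_
    rw [Real.mul_rpow (by positivity) (by positivity), mul_assoc]
    have : (q : ℝ) ^ (1 / 2 : ℝ) ≤ q := by
      calc (q : ℝ) ^ (1 / 2 : ℝ) ≤ (q : ℝ) ^ (1 : ℝ) := by gcongr; norm_num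
        _ = _ := Real.rpow_one _
    gcongr) x hx
  rw [Nat.add_sub_cancel] at this
  refine this.trans (le_of_eq (by ring))

lemma lam1_norm (n : ℕ) : ‖lam1 n‖ ≤ 1 + Real.log n := by
  unfold lam1
  refine (norm_sub_le _ _).trans ?_
  rw [Complex.norm_real, Real.norm_eq_abs, abs_of_nonneg ArithmeticFunction.vonMangoldt_nonneg, norm_one]
  linarith [ArithmeticFunction.vonMangoldt_le_log (n := n)]

lemma lam1_abs : LSeries.abscissaOfAbsConv lam1 ≤ (1 : ℝ) := by
  apply LSeries.abscissaOfAbsConv_le_of_forall_lt_LSeriesSummable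
  intro y hy
  rw [lam1_eq]
  have hy' : 1 < ((y : ℝ) : ℂ).re := by simpa using hy
  have hsum1 : LSeriesSummable (fun n : ℕ => tr n) y := by
    apply LSeriesSummable_of_bounded_of_one_lt_re (m := 1) _ hy'
    intro n _; rw [tr_apply]; simp
  exact (DirichletCharacter.LSeriesSummable_twist_vonMangoldt tr hy').sub hsum1

lemma psi_main (A : ℕ) : ∃ K : ℝ, 0 < K ∧ ∀ x : ℝ, 3 ≤ x →
    |∑ n ∈ Finset.Icc 0 ⌊x⌋₊, ArithmeticFunction.vonMangoldt n - x| ≤ K * x / Real.log x ^ A := by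
  obtain ⟨C, hC, h⟩ := tauber (A + 1) (by omega)
  obtain ⟨M, hM, hM'⟩ := iter_lam1 (2 * (A + 1) - 1)
  refine ⟨C * M + A.factorial, by positivity, ?_⟩
  intro x hx
  have hL := one_le_log hx
  have h1 := h lam1 M hM lam1_norm lam1_abs hM' x hx
  rw [Nat.add_sub_cancel] at h1
  have e : ∑ n ∈ Finset.Icc 0 ⌊x⌋₊, lam1 n = ((∑ n ∈ Finset.Icc 0 ⌊x⌋₊, ArithmeticFunction.vonMangoldt n - (⌊x⌋₊ + 1) : ℝ) : ℂ) := by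
    unfold lam1
    rw [Finset.sum_sub_distrib]
    push_cast
    simp
  rw [e, Complex.norm_real, Real.norm_eq_abs] at h1
  have h2 : |((⌊x⌋₊ : ℝ) + 1) - x| ≤ 1 := by
    have a1 := Nat.floor_le (show 0 ≤ x by linarith)
    have a2 := Nat.lt_floor_add_one x
    rw [abs_le]; constructor <;> linarith
  have h3 : 1 ≤ A.factorial * x / Real.log x ^ A := by
    rw [one_le_div (by positivity)]; exact log_pow_le hx A
  have h4 := abs_add_le (∑ n ∈ Finset.Icc 0 ⌊x⌋₊, ArithmeticFunction.vonMangoldt n - (⌊x⌋₊ + 1)) (((⌊x⌋₊ : ℝ) + 1) - x)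
  rw [sub_add_sub_cancel] at h4
  calc _ ≤ C * M * x / Real.log x ^ A + A.factorial * x / Real.log x ^ A := by linarith
    _ = _ := by ring

lemma primepow_sum (p N : ℕ) (hp : p.Prime) (hN : 1 ≤ N) :
    ∑ n ∈ (Finset.Icc 0 N).filter (fun n => p ∣ n), ArithmeticFunction.vonMangoldt n ≤ Real.log N := by
  have h1 : ∑ n ∈ (Finset.Icc 0 N).filter (fun n => p ∣ n), ArithmeticFunction.vonMangoldt n ≤
      ∑ n ∈ (Finset.Icc 1 (Nat.log p N)).image (fun k => p ^ k), ArithmeticFunction.vonMangoldt n := by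
    rw [← Finset.sum_filter_ne_zero]
    apply Finset.sum_le_sum_of_subset_of_nonneg
    · intro n hn
      simp only [Finset.mem_filter, Finset.mem_Icc] at hn
      obtain ⟨⟨⟨_, hnN⟩, hpn⟩, hΛ⟩ := hn
      rw [ArithmeticFunction.vonMangoldt_ne_zero_iff, isPrimePow_nat_iff] at hΛ
      obtain ⟨r, k, hr, hk, rfl⟩ := hΛ
      have : p = r := (Nat.prime_dvd_prime_iff_eq hp hr).1 (hp.dvd_of_dvd_pow hpn)
      subst this
      rw [Finset.mem_image]
      exact ⟨k, Finset.mem_Icc.2 ⟨hk, Nat.le_log_of_pow_le hp.one_lt hnN⟩, rfl⟩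
    · intro n _ _; exact ArithmeticFunction.vonMangoldt_nonneg
  refine h1.trans ?_
  rw [Finset.sum_image (fun a _ b _ h => Nat.pow_right_injective hp.two_le h)]
  have h2 : ∀ k ∈ Finset.Icc 1 (Nat.log p N), ArithmeticFunction.vonMangoldt (p ^ k) = Real.log p := by
    intro k hk
    rw [Finset.mem_Icc] at hk
    rw [ArithmeticFunction.vonMangoldt_apply_pow (by omega), ArithmeticFunction.vonMangoldt_apply_prime hp]
  rw [Finset.sum_congr rfl h2, Finset.sum_const, nsmul_eq_mul, Nat.card_Icc, Nat.add_sub_cancel, ← Real.log_pow]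
  apply Real.log_le_log
  · have := hp.pos; positivity
  · exact_mod_cast Nat.pow_log_le_self p (by omega)

lemma noncoprime_sum (d N : ℕ) (hd : 1 ≤ d) (hN : 1 ≤ N) :
    ∑ n ∈ (Finset.Icc 0 N).filter (fun n => ¬ n.Coprime d), ArithmeticFunction.vonMangoldt n ≤ d * Real.log N := by
  have h1 : ∑ n ∈ (Finset.Icc 0 N).filter (fun n => ¬ n.Coprime d), ArithmeticFunction.vonMangoldt n ≤
      ∑ p ∈ d.primeFactors, ∑ n ∈ (Finset.Icc 0 N).filter (fun n => p ∣ n), ArithmeticFunction.vonMangoldt n := by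
    simp_rw [Finset.sum_filter]
    rw [Finset.sum_comm]
    apply Finset.sum_le_sum
    intro n _
    split_ifs with h
    · apply Finset.sum_nonneg
      intro i _
      split_ifs
      · exact ArithmeticFunction.vonMangoldt_nonneg
      · exact le_rfl
    · obtain ⟨p, hp, h1, h2⟩ := Nat.Prime.not_coprime_iff_dvd.1 h
      have hmem : p ∈ d.primeFactors := Nat.mem_primeFactors.2 ⟨hp, h2, by omega⟩
      refine le_trans ?_ (Finset.single_le_sum (f := fun p => if p ∣ n then ArithmeticFunction.vonMangoldt n else 0) ?_ hmem)
      · simp [h1]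
      · intro i _
        split_ifs
        · exact ArithmeticFunction.vonMangoldt_nonneg
        · exact le_rfl
  refine h1.trans ?_
  refine (Finset.sum_le_sum fun p hp => primepow_sum p N (Nat.prime_of_mem_primeFactors hp) hN).trans ?_
  rw [Finset.sum_const, nsmul_eq_mul]
  have hc : d.primeFactors.card ≤ d := by
    have : d.primeFactors ⊆ Finset.Icc 1 d := fun p hp =>
      Finset.mem_Icc.2 ⟨(Nat.prime_of_mem_primeFactors hp).pos, Nat.le_of_mem_primeFactors hp⟩
    simpa using Finset.card_le_card this
  have : 0 ≤ Real.log N := Real.log_natCast_nonneg N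
  gcongr

lemma log_pow_sqrt {x : ℝ} (hx : 3 ≤ x) (k : ℕ) : Real.log x ^ k ≤ 2 ^ k * k.factorial * √x := by
  have h1 := one_le_log hx
  have := Real.pow_div_factorial_le_exp (Real.log x / 2) (by linarith) k
  rw [div_le_iff₀ (by positivity), ← Real.log_sqrt (by linarith), Real.exp_log (by positivity),
    Real.log_sqrt (by linarith), div_pow, div_le_iff₀ (by positivity)] at this
  linarith

lemma psi_ap (A : ℕ) : ∃ K : ℝ, 0 < K ∧ ∀ d : ℕ, 1 ≤ d → ∀ x : ℝ, 3 ≤ x →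
    |∑ n ∈ (Finset.Icc 0 ⌊x⌋₊).filter (fun n : ℕ => (n : ZMod d) = 1), ArithmeticFunction.vonMangoldt n - x / d.totient| ≤
      K * d * x / Real.log x ^ A := by
  obtain ⟨K₁, hK₁, h₁⟩ := psi_chi A
  obtain ⟨K₂, hK₂, h₂⟩ := psi_main A
  refine ⟨K₁ + K₂ + (A + 1).factorial, by positivity, ?_⟩
  intro d hd x hx
  have hL := one_le_log hx
  have : NeZero d := ⟨by omega⟩
  have hd1 : (1 : ℝ) ≤ d := by exact_mod_cast hd
  set N := ⌊x⌋₊ with hN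
  have hN1 : 1 ≤ N := Nat.le_floor (by push_cast; linarith)
  have hNx : (N : ℝ) ≤ x := Nat.floor_le (by linarith)
  have hφ : (1 : ℝ) ≤ d.totient := by exact_mod_cast Nat.totient_pos.2 (by omega)
  set P := ∑ n ∈ (Finset.Icc 0 N).filter (fun n : ℕ => (n : ZMod d) = 1), ArithmeticFunction.vonMangoldt n with hP
  have hsum : ∑ χ : DirichletCharacter ℂ d, ∑ n ∈ Finset.Icc 0 N, vm χ n = ((d.totient * P : ℝ) : ℂ) := by
    rw [Finset.sum_comm, hP, Finset.sum_filter, Finset.mul_sum, Complex.ofReal_sum]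
    refine Finset.sum_congr rfl fun n _ => ?_
    simp only [vm, Pi.mul_apply]
    rw [← Finset.sum_mul, DirichletCharacter.sum_characters_eq]
    split_ifs <;> simp
  classical
  have hone : ∑ n ∈ Finset.Icc 0 N, vm (1 : DirichletCharacter ℂ d) n =
      ((∑ n ∈ Finset.Icc 0 N, ArithmeticFunction.vonMangoldt n - ∑ n ∈ (Finset.Icc 0 N).filter (fun n => ¬ n.Coprime d), ArithmeticFunction.vonMangoldt n : ℝ) : ℂ) := by
    rw [Finset.sum_filter, ← Finset.sum_sub_distrib, Complex.ofReal_sum]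
    refine Finset.sum_congr rfl fun n _ => ?_
    simp only [vm, Pi.mul_apply]
    by_cases h : n.Coprime d
    · rw [MulChar.one_apply ((ZMod.isUnit_iff_coprime n d).2 h)]; simp [h]
    · rw [MulChar.map_nonunit _ (fun h' => h ((ZMod.isUnit_iff_coprime n d).1 h'))]; simp [h]
  rw [← Finset.add_sum_erase _ _ (Finset.mem_univ (1 : DirichletCharacter ℂ d)), hone] at hsum
  set R := ∑ n ∈ (Finset.Icc 0 N).filter (fun n => ¬ n.Coprime d), ArithmeticFunction.vonMangoldt n with hR
  have hR1 : R ≤ d * Real.log x := by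
    refine (noncoprime_sum d N hd hN1).trans ?_
    have : (0 : ℝ) < N := by exact_mod_cast hN1
    gcongr
  have hR0 : 0 ≤ R := Finset.sum_nonneg fun n _ => ArithmeticFunction.vonMangoldt_nonneg
  have hE : ‖∑ χ ∈ Finset.univ.erase (1 : DirichletCharacter ℂ d), ∑ n ∈ Finset.Icc 0 N, vm χ n‖ ≤
      d.totient * (K₁ * d * x / Real.log x ^ A) := by
    refine (norm_sum_le_of_le _ (fun χ hχ => h₁ d χ (Finset.ne_of_mem_erase hχ) x hx)).trans ?_
    rw [Finset.sum_const, nsmul_eq_mul]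
    have : (Finset.univ.erase (1 : DirichletCharacter ℂ d)).card ≤ d.totient := by
      rw [← DirichletCharacter.card_eq_totient_of_hasEnoughRootsOfUnity ℂ d, Nat.card_eq_fintype_card]
      exact Finset.card_le_univ _
    gcongr
  have hE2 : |d.totient * P - (∑ n ∈ Finset.Icc 0 N, ArithmeticFunction.vonMangoldt n - R)| ≤ d.totient * (K₁ * d * x / Real.log x ^ A) := by
    rw [← Real.norm_eq_abs, ← Complex.norm_real, Complex.ofReal_sub, ← hsum, add_sub_cancel_left]
    exact hE
  have hM := h₂ x hx
  have hLx : d * Real.log x ≤ d * ((A + 1).factorial * x / Real.log x ^ A) := by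
    gcongr
    rw [le_div_iff₀ (by positivity), ← pow_succ']
    exact log_pow_le hx (A + 1)
  have hkey : |d.totient * P - x| ≤ d.totient * ((K₁ + K₂ + (A + 1).factorial) * d * x / Real.log x ^ A) := by
    have e : d.totient * P - x = (d.totient * P - (∑ n ∈ Finset.Icc 0 N, ArithmeticFunction.vonMangoldt n - R)) +
        ((∑ n ∈ Finset.Icc 0 N, ArithmeticFunction.vonMangoldt n - x) + (- R)) := by ring
    have b1 : |(-R)| ≤ d.totient * ((A + 1).factorial * d * x / Real.log x ^ A) := by
      rw [abs_neg, abs_of_nonneg hR0]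
      calc R ≤ _ := hR1.trans hLx
        _ = 1 * ((A + 1).factorial * d * x / Real.log x ^ A) := by ring
        _ ≤ _ := by gcongr
    have b2 : |∑ n ∈ Finset.Icc 0 N, ArithmeticFunction.vonMangoldt n - x| ≤ d.totient * (K₂ * d * x / Real.log x ^ A) := by
      refine hM.trans ?_
      calc K₂ * x / Real.log x ^ A = 1 * (K₂ * 1 * x / Real.log x ^ A) := by ring
        _ ≤ _ := by gcongr
    rw [e]
    refine (abs_add_le _ _).trans ((add_le_add hE2 ((abs_add_le _ _).trans (add_le_add b2 b1))).trans ?_)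
    apply le_of_eq; ring
  have hφ0 : (0 : ℝ) < d.totient := by linarith
  have e : P - x / d.totient = (d.totient * P - x) / d.totient := by field_simp
  rw [e, abs_div, abs_of_pos hφ0, div_le_iff₀ hφ0]
  linarith

/-- weighted count of primes p ≤ N with d ∣ p - 1 -/
noncomputable def thd (N d : ℕ) : ℝ :=
  ∑ p ∈ Finset.filter Nat.Prime (Finset.Iic N), if d ∣ p - 1 then Real.log p else 0

lemma theta_ap (A : ℕ) : ∃ K : ℝ, 0 < K ∧ ∀ d : ℕ, 1 ≤ d → ∀ x : ℝ, 3 ≤ x →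
    |thd ⌊x⌋₊ d - x / d.totient| ≤ K * d * x / Real.log x ^ A := by
  obtain ⟨K₁, hK₁, h₁⟩ := psi_ap A
  refine ⟨K₁ + 2 * (2 ^ (A + 1) * (A + 1).factorial), by positivity, ?_⟩
  intro d hd x hx
  have hL := one_le_log hx
  have hd1 : (1 : ℝ) ≤ d := by exact_mod_cast hd
  have h := h₁ d hd x hx
  set P := ∑ n ∈ (Finset.Icc 0 ⌊x⌋₊).filter (fun n : ℕ => (n : ZMod d) = 1), ArithmeticFunction.vonMangoldt n with hP
  have hth : thd ⌊x⌋₊ d = ∑ n ∈ ((Finset.Icc 0 ⌊x⌋₊).filter (fun n : ℕ => (n : ZMod d) = 1)).filter Nat.Prime, ArithmeticFunction.vonMangoldt n := by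
    unfold thd
    rw [← Finset.sum_filter, Finset.filter_filter, Finset.filter_filter]
    have hset : (Finset.Iic ⌊x⌋₊).filter (fun n => Nat.Prime n ∧ d ∣ n - 1) =
        (Finset.Icc 0 ⌊x⌋₊).filter (fun n : ℕ => (n : ZMod d) = 1 ∧ Nat.Prime n) := by
      ext n
      simp only [Finset.mem_filter, Finset.mem_Iic, Finset.mem_Icc, zero_le, true_and]
      refine and_congr_right fun _ => ?_
      rw [and_comm]
      refine and_congr_left fun hp => ?_
      rw [← ZMod.natCast_eq_zero_iff, Nat.cast_sub hp.pos, sub_eq_zero, Nat.cast_one]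
    rw [hset]
    refine Finset.sum_congr rfl fun n hn => ?_
    rw [ArithmeticFunction.vonMangoldt_apply_prime (Finset.mem_filter.1 hn).2.2]
  have hsplit := Finset.sum_filter_add_sum_filter_not ((Finset.Icc 0 ⌊x⌋₊).filter (fun n : ℕ => (n : ZMod d) = 1)) Nat.Prime (fun n => ArithmeticFunction.vonMangoldt n)
  rw [← hth, ← hP] at hsplit
  set Q := ∑ n ∈ ((Finset.Icc 0 ⌊x⌋₊).filter (fun n : ℕ => (n : ZMod d) = 1)).filter (fun n => ¬ Nat.Prime n), ArithmeticFunction.vonMangoldt n with hQ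
  have hQ0 : 0 ≤ Q := Finset.sum_nonneg fun n _ => ArithmeticFunction.vonMangoldt_nonneg
  have hQ1 : Q ≤ 2 * √x * Real.log x := by
    have h2 := Chebyshev.abs_psi_sub_theta_le_sqrt_mul_log (x := x) (by linarith)
    rw [Chebyshev.psi_sub_theta_eq_sum_not_prime] at h2
    refine le_trans ?_ ((le_abs_self _).trans h2)
    rw [hQ, ← Finset.sum_filter_ne_zero]
    apply Finset.sum_le_sum_of_subset_of_nonneg
    · intro n hn
      simp only [Finset.mem_filter, Finset.mem_Icc, Finset.mem_Ioc] at hn ⊢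
      refine ⟨⟨?_, hn.1.1.1.2⟩, hn.1.2⟩
      rcases Nat.eq_zero_or_pos n with h0 | h0
      · exfalso; apply hn.2; rw [h0]; simp
      · exact h0
    · intro n _ _; exact ArithmeticFunction.vonMangoldt_nonneg
  have hQ2 : 2 * √x * Real.log x ≤ 2 * (2 ^ (A + 1) * (A + 1).factorial) * d * x / Real.log x ^ A := by
    rw [le_div_iff₀ (by positivity)]
    have h3 := log_pow_sqrt hx (A + 1)
    have h4 : √x * √x = x := Real.mul_self_sqrt (by linarith)
    calc 2 * √x * Real.log x * Real.log x ^ A = 2 * √x * Real.log x ^ (A + 1) := by rw [pow_succ']; ring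
      _ ≤ 2 * √x * (2 ^ (A + 1) * (A + 1).factorial * √x) := by gcongr
      _ = 2 * (2 ^ (A + 1) * (A + 1).factorial) * 1 * (√x * √x) := by ring
      _ ≤ _ := by rw [h4]; gcongr
  have e : thd ⌊x⌋₊ d - x / d.totient = (P - x / d.totient) + (-Q) := by rw [← hsplit]; ring
  rw [e]
  refine (abs_add_le _ _).trans ?_
  rw [abs_neg, abs_of_nonneg hQ0]
  calc _ ≤ K₁ * d * x / Real.log x ^ A + 2 * (2 ^ (A + 1) * (A + 1).factorial) * d * x / Real.log x ^ A :=
        add_le_add h (hQ1.trans hQ2)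
    _ = _ := by ring

end ATR

namespace ATR

noncomputable def gp (k : ℝ) (p : Nat.Primes) : ℝ := (1 - 1 / ((p : ℕ) : ℝ)) ^ k - 1

/-- the product of the primes in S -/
def dS (S : Finset Nat.Primes) : ℕ := ∏ p ∈ S, (p : ℕ)

lemma abs_exp_sub_one_le_mul (u : ℝ) : |Real.exp u - 1| ≤ |u| * Real.exp |u| := by
  rcases le_total 0 u with h | h
  · rw [abs_of_nonneg h, abs_of_nonneg (by linarith [Real.one_le_exp h])]
    have h1 := Real.add_one_le_exp (-u)
    have h2 : Real.exp (-u) * Real.exp u = 1 := by rw [← Real.exp_add]; simp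
    nlinarith [Real.exp_pos u]
  · rw [abs_of_nonpos h, abs_of_nonpos (by linarith [Real.exp_le_one_iff.2 h])]
    have h1 := Real.add_one_le_exp u
    have h2 : 1 ≤ Real.exp (-u) := Real.one_le_exp (by linarith)
    nlinarith

lemma gp_le (k : ℝ) (p : Nat.Primes) :
    |gp k p| ≤ (2 * |k| * Real.exp |k|) / ((p : ℕ) : ℝ) := by
  have hp2 : (2 : ℝ) ≤ ((p : ℕ) : ℝ) := by exact_mod_cast p.2.two_le
  set P : ℝ := ((p : ℕ) : ℝ) with hP
  have hpos : 0 < 1 - 1 / P := by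
    rw [sub_pos, div_lt_one (by linarith)]; linarith
  unfold gp
  rw [← hP, Real.rpow_def_of_pos hpos]
  set u := Real.log (1 - 1 / P) * k with hu
  have hlog : |Real.log (1 - 1 / P)| ≤ 2 / P := by
    rw [abs_of_nonpos]
    · have h := Real.one_sub_inv_le_log_of_pos hpos
      have e : (1 - 1 / P)⁻¹ - 1 = 1 / (P - 1) := by
        have : P - 1 ≠ 0 := by linarith
        have : P ≠ 0 := by linarith
        rw [show 1 - 1 / P = (P - 1) / P by field_simp]
        field_simp
        ring
      have : 1 / (P - 1) ≤ 2 / P := by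
        rw [div_le_div_iff₀ (by linarith) (by linarith)]; linarith
      linarith
    · apply Real.log_nonpos hpos.le
      have : 0 < 1 / P := by positivity
      linarith
  have hu1 : |u| ≤ 2 * |k| / P := by
    rw [hu, abs_mul]
    calc _ ≤ 2 / P * |k| := by gcongr
      _ = _ := by ring
  have hu2 : |u| ≤ |k| := by
    refine hu1.trans ?_
    rw [div_le_iff₀ (by linarith)]
    nlinarith [abs_nonneg k]
  refine (abs_exp_sub_one_le_mul u).trans ?_
  calc |u| * Real.exp |u| ≤ 2 * |k| / P * Real.exp |k| := by gcongr
    _ = _ := by ring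

lemma dS_pos (S : Finset Nat.Primes) : 1 ≤ dS S :=
  Nat.succ_le_of_lt (Finset.prod_pos fun p _ => p.2.pos)

lemma dS_dvd (S : Finset Nat.Primes) (n : ℕ) (h : ∀ p ∈ S, (p : ℕ) ∣ n) : dS S ∣ n := by
  have e : dS S = ∏ q ∈ S.map ⟨fun p : Nat.Primes => (p : ℕ), Subtype.val_injective⟩, q := by
    rw [Finset.prod_map]; rfl
  rw [e]
  apply Finset.prod_primes_dvd
  · intro a ha
    rw [Finset.mem_map] at ha
    obtain ⟨p, _, rfl⟩ := ha
    exact p.2.prime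
  · intro a ha
    rw [Finset.mem_map] at ha
    obtain ⟨p, hp, rfl⟩ := ha
    exact h p hp

lemma dvd_dS {S : Finset Nat.Primes} {p : Nat.Primes} (hp : p ∈ S) : (p : ℕ) ∣ dS S :=
  Finset.dvd_prod_of_mem (fun p : Nat.Primes => (p : ℕ)) hp

lemma totient_dS (S : Finset Nat.Primes) :
    ((dS S).totient : ℝ) = ∏ p ∈ S, (((p : ℕ) : ℝ) - 1) := by
  induction S using Finset.induction_on with
  | empty => simp [dS]
  | insert p S hp ih =>
    have e : dS (insert p S) = (p : ℕ) * dS S := by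
      unfold dS; rw [Finset.prod_insert hp]
    have hc : Nat.Coprime (p : ℕ) (dS S) := by
      unfold dS
      apply Nat.Coprime.prod_right
      intro r hr
      rw [Nat.coprime_primes p.2 r.2]
      intro h
      exact hp (by rwa [Subtype.ext h])
    rw [e, Nat.totient_mul hc, Finset.prod_insert hp, ← ih, Nat.totient_prime p.2]
    push_cast [Nat.cast_sub p.2.one_le]
    ring

lemma G_hasSum (k : ℝ) (n : ℕ) (hn : 1 ≤ n) :
    HasSum (fun S : Finset Nat.Primes => if dS S ∣ n then ∏ p ∈ S, gp k p else 0)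
      (((n.totient : ℝ) / (n : ℝ)) ^ k) := by
  classical
  set T : Finset Nat.Primes := Finset.subtype Nat.Prime n.primeFactors with hT
  have hmem : ∀ p : Nat.Primes, p ∈ T ↔ (p : ℕ) ∣ n := by
    intro p
    have : p ∈ T ↔ (p : ℕ) ∈ n.primeFactors := Finset.mem_subtype
    rw [this, Nat.mem_primeFactors]
    constructor
    · exact fun h => h.2.1
    · exact fun h => ⟨p.2, h, by omega⟩
  have e : (((n.totient : ℝ) / (n : ℝ)) ^ k) =
      ∑ S ∈ T.powerset, (if dS S ∣ n then ∏ p ∈ S, gp k p else 0) := by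
    have h1 : ∀ S ∈ T.powerset, (if dS S ∣ n then ∏ p ∈ S, gp k p else 0) = ∏ p ∈ S, gp k p := by
      intro S hS
      rw [if_pos]
      apply dS_dvd
      intro p hp
      exact (hmem p).1 (Finset.mem_powerset.1 hS hp)
    rw [Finset.sum_congr rfl h1, ← Finset.prod_one_add]
    have h2 : ∀ p ∈ T, 1 + gp k p = (1 - (((p : ℕ) : ℝ))⁻¹) ^ k := by
      intro p _
      unfold gp
      rw [one_div]; ring
    rw [Finset.prod_congr rfl h2, Real.finsetProd_rpow]
    · congr 1
      have h3 := Nat.totient_eq_mul_prod_factors n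
      have h4 : (n.totient : ℝ) = (n : ℝ) * ∏ p ∈ n.primeFactors, (1 - (p : ℝ)⁻¹) := by
        have := congrArg (fun r : ℚ => (r : ℝ)) h3
        push_cast at this
        exact this
      have hn0 : (n : ℝ) ≠ 0 := by positivity
      rw [h4, mul_div_cancel_left₀ _ hn0]
      exact (Finset.prod_subtype_of_mem (fun p : ℕ => (1 - (p : ℝ)⁻¹))
        (fun x hx => Nat.prime_of_mem_primeFactors hx)).symm
    · intro p _
      rw [sub_nonneg]
      apply inv_le_one_of_one_le₀
      exact_mod_cast p.2.one_le
  rw [e]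
  apply hasSum_sum_of_ne_finset_zero
  intro S hS
  rw [if_neg]
  intro h
  apply hS
  rw [Finset.mem_powerset]
  intro p hp
  exact (hmem p).2 ((dvd_dS hp).trans h)

noncomputable def thG (k : ℝ) (N : ℕ) : ℝ :=
  ∑ p ∈ Finset.filter Nat.Prime (Finset.Iic N),
    Real.log p * (((p - 1).totient : ℝ) / ((p - 1 : ℕ) : ℝ)) ^ k

lemma thG_hasSum (k : ℝ) (N : ℕ) :
    HasSum (fun S : Finset Nat.Primes => (∏ p ∈ S, gp k p) * thd N (dS S)) (thG k N) := by
  have h := hasSum_sum (s := Finset.filter Nat.Prime (Finset.Iic N))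
    (f := fun (p : ℕ) S => Real.log p * (if dS S ∣ p - 1 then ∏ p ∈ S, gp k p else 0))
    (a := fun (p : ℕ) => Real.log p * (((p - 1).totient : ℝ) / ((p - 1 : ℕ) : ℝ)) ^ k) (L := .unconditional _)
    (by
      intro p hp
      apply HasSum.mul_left
      apply G_hasSum
      have := (Finset.mem_filter.1 hp).2.two_le
      omega)
  unfold thG
  refine h.congr_fun ?_
  intro S
  unfold thd
  rw [Finset.mul_sum]
  apply Finset.sum_congr rfl
  intro p _
  split_ifs
  · ring
  · ring

lemma thd_nonneg (N d : ℕ) : 0 ≤ thd N d := by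
  unfold thd
  apply Finset.sum_nonneg
  intro p hp
  split_ifs
  · exact Real.log_natCast_nonneg p
  · exact le_rfl

lemma thd_le (d : ℕ) (hd : 1 ≤ d) (x : ℝ) (hx : 3 ≤ x) :
    thd ⌊x⌋₊ d ≤ Real.log x * (x / d) := by
  unfold thd
  rw [← Finset.sum_filter]
  have hd0 : (0 : ℝ) < d := by exact_mod_cast hd
  have hL := one_le_log hx
  have h1 : ∀ p ∈ (Finset.filter Nat.Prime (Finset.Iic ⌊x⌋₊)).filter (fun p => d ∣ p - 1),
      Real.log p ≤ Real.log x := by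
    intro p hp
    simp only [Finset.mem_filter, Finset.mem_Iic] at hp
    apply Real.log_le_log
    · exact_mod_cast hp.1.2.pos
    · exact (Nat.le_floor_iff (by linarith)).1 hp.1.1
  refine (Finset.sum_le_card_nsmul _ _ _ h1).trans ?_
  rw [nsmul_eq_mul, mul_comm]
  gcongr
  have hc : ((Finset.filter Nat.Prime (Finset.Iic ⌊x⌋₊)).filter (fun p => d ∣ p - 1)).card ≤ ⌊x⌋₊ / d := by
    rw [← Nat.Ioc_filter_dvd_card_eq_div]
    apply Finset.card_le_card_of_injOn (fun p => p - 1)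
    · intro p hp
      simp only [Finset.mem_filter, Finset.mem_Iic, Finset.coe_filter, Set.mem_setOf_eq] at hp
      simp only [Finset.coe_filter, Finset.mem_Ioc, Set.mem_setOf_eq]
      have := hp.1.2.two_le
      exact ⟨⟨by omega, by omega⟩, hp.2⟩
    · intro p hp r hr h
      simp only [Finset.mem_filter, Finset.mem_Iic, Finset.coe_filter, Set.mem_setOf_eq] at hp hr
      have := hp.1.2.two_le
      have := hr.1.2.two_le
      simp only at h
      omega
  calc _ ≤ ((⌊x⌋₊ / d : ℕ) : ℝ) := by exact_mod_cast hc
    _ ≤ (⌊x⌋₊ : ℝ) / d := Nat.cast_div_le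
    _ ≤ x / d := by gcongr; exact Nat.floor_le (by linarith)

noncomputable def wt (p : Nat.Primes) : ℝ := 2 / √(((p : ℕ) : ℝ) - 1)

lemma wt_pos (p : Nat.Primes) : 0 < wt p := by
  have hp2 : (2 : ℝ) ≤ ((p : ℕ) : ℝ) := by exact_mod_cast p.2.two_le
  unfold wt
  have : 0 < √(((p : ℕ) : ℝ) - 1) := Real.sqrt_pos.2 (by linarith)
  positivity

lemma thd_err (A : ℕ) : ∃ K : ℝ, 0 < K ∧ ∀ S : Finset Nat.Primes, ∀ x : ℝ, 3 ≤ x →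
    |thd ⌊x⌋₊ (dS S) - x / (dS S).totient| ≤ K * (x / Real.log x ^ A) * ∏ p ∈ S, wt p := by
  obtain ⟨K, hK, h⟩ := theta_ap (4 * A + 3)
  refine ⟨1 + K, by linarith, ?_⟩
  intro S x hx
  have hL := one_le_log hx
  set L := Real.log x with hLdef
  have hd := dS_pos S
  have h1 := h _ hd x hx
  have ht0 : 0 < (dS S).totient := Nat.totient_pos.2 (by omega)
  have ht : (0 : ℝ) < (dS S).totient := by exact_mod_cast ht0
  have hle : ((dS S).totient : ℝ) ≤ dS S := by exact_mod_cast Nat.totient_le _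
  have h2 : |thd ⌊x⌋₊ (dS S) - x / (dS S).totient| ≤ x * L / (dS S).totient := by
    have a1 := thd_nonneg ⌊x⌋₊ (dS S)
    have a2 := thd_le (dS S) hd x hx
    have a3 : Real.log x * (x / dS S) ≤ x * L / (dS S).totient := by
      rw [← hLdef, show x * L / ((dS S).totient : ℝ) = L * (x / (dS S).totient) by ring]
      gcongr
    have a4 : x / ((dS S).totient : ℝ) ≤ x * L / (dS S).totient := by
      gcongr
      nlinarith
    have a5 : 0 ≤ x / ((dS S).totient : ℝ) := by positivity
    rw [abs_le]
    constructor <;> linarith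
  set X := |thd ⌊x⌋₊ (dS S) - x / (dS S).totient| with hX
  have hX0 : 0 ≤ X := abs_nonneg _
  have hw : (∏ p ∈ S, wt p) ^ 4 * ((dS S).totient : ℝ) ^ 3 ≥ dS S := by
    rw [totient_dS, ← Finset.prod_pow, ← Finset.prod_pow, ← Finset.prod_mul_distrib]
    unfold dS
    push_cast
    apply Finset.prod_le_prod
    · intro p _; positivity
    · intro p _
      have hp2 : (2 : ℝ) ≤ ((p : ℕ) : ℝ) := by exact_mod_cast p.2.two_le
      set P : ℝ := ((p : ℕ) : ℝ) with hP
      have e : wt p ^ 4 = 16 / (P - 1) ^ 2 := by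
        unfold wt
        rw [div_pow, show √(P - 1) ^ 4 = (√(P - 1) ^ 2) ^ 2 by ring, Real.sq_sqrt (by linarith)]
        norm_num
      have hne : P - 1 ≠ 0 := by linarith
      rw [e, show 16 / (P - 1) ^ 2 * (P - 1) ^ 3 = 16 * (P - 1) by field_simp]
      linarith
  have hW0 : 0 ≤ ∏ p ∈ S, wt p := Finset.prod_nonneg fun p _ => (wt_pos p).le
  set W := ∏ p ∈ S, wt p with hW
  have hL0 : 0 < L := by linarith
  rw [← pow_le_pow_iff_left₀ hX0 (by positivity) (n := 4) (by norm_num)]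
  calc X ^ 4 = X * X ^ 3 := by ring
    _ ≤ (K * dS S * x / L ^ (4 * A + 3)) * (x * L / (dS S).totient) ^ 3 := by gcongr
    _ = K * (x / L ^ A) ^ 4 * (dS S / ((dS S).totient : ℝ) ^ 3) := by
        rw [pow_add, pow_mul']
        field_simp
    _ ≤ K * (x / L ^ A) ^ 4 * W ^ 4 := by
        gcongr
        rw [div_le_iff₀ (by positivity)]
        exact hw
    _ ≤ (1 + K) ^ 4 * (x / L ^ A) ^ 4 * W ^ 4 := by
        gcongr
        nlinarith [sq_nonneg (K + 1), sq_nonneg K, mul_pos hK hK, mul_pos (mul_pos hK hK) hK, mul_pos (mul_pos hK hK) (mul_pos hK hK)]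
    _ = _ := by ring

noncomputable def Ak (k : ℝ) : ℝ :=
  ∏' p : Nat.Primes, (1 + ((1 - 1 / ((p : ℕ) : ℝ)) ^ k - 1) / (((p : ℕ) : ℝ) - 1))

lemma summable_gw (k : ℝ) : Summable (fun p : Nat.Primes => |gp k p * wt p|) := by
  have h : Summable (fun n : ℕ => ((n : ℝ) ^ (3 / 2 : ℝ))⁻¹) :=
    Real.summable_nat_rpow_inv.2 (by norm_num)
  have h1 : Summable (fun p : Nat.Primes => (((p : ℕ) : ℝ) ^ (3 / 2 : ℝ))⁻¹) :=
    h.comp_injective (i := fun p : Nat.Primes => (p : ℕ)) Subtype.val_injective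
  refine Summable.of_nonneg_of_le (fun p => abs_nonneg _) ?_ (h1.mul_left ((2 * |k| * Real.exp |k|) * 4))
  intro p
  have hp2 : (2 : ℝ) ≤ ((p : ℕ) : ℝ) := by exact_mod_cast p.2.two_le
  have hg := gp_le k p
  rw [abs_mul, abs_of_pos (wt_pos p)]
  set P : ℝ := ((p : ℕ) : ℝ) with hP
  have hw : wt p ≤ 4 / √P := by
    unfold wt
    rw [← hP]
    have h1 : √P ≤ 2 * √(P - 1) := by
      rw [Real.sqrt_le_left (by positivity), mul_pow, Real.sq_sqrt (by linarith)]
      linarith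
    have h2 : 0 < √(P - 1) := Real.sqrt_pos.2 (by linarith)
    have h3 : 0 < √P := Real.sqrt_pos.2 (by linarith)
    rw [div_le_div_iff₀ h2 h3]
    linarith
  calc |gp k p| * wt p ≤ ((2 * |k| * Real.exp |k|) / P) * (4 / √P) := by
        gcongr
        exact (wt_pos p).le
    _ = _ := by
        have e : P ^ (3 / 2 : ℝ) = P * √P := by
          rw [Real.sqrt_eq_rpow, ← Real.rpow_one_add' (by linarith) (by norm_num)]
          norm_num
        rw [e, mul_inv]
        field_simp

lemma summable_gphi (k : ℝ) : Summable (fun p : Nat.Primes => |gp k p / (((p : ℕ) : ℝ) - 1)|) := by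
  refine Summable.of_nonneg_of_le (fun p => abs_nonneg _) ?_ (summable_gw k)
  intro p
  have hp2 : (2 : ℝ) ≤ ((p : ℕ) : ℝ) := by exact_mod_cast p.2.two_le
  rw [abs_mul, abs_div, div_eq_mul_inv]
  gcongr
  rw [abs_of_pos (wt_pos p), abs_of_pos (by linarith : (0:ℝ) < ((p : ℕ) : ℝ) - 1)]
  unfold wt
  set P : ℝ := ((p : ℕ) : ℝ) - 1 with hP
  have h1 : 1 ≤ P := by linarith
  have h2 : √P ≤ P := by
    rw [Real.sqrt_le_left (by linarith)]; nlinarith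
  have h3 : 0 < √P := Real.sqrt_pos.2 (by linarith)
  rw [inv_eq_one_div, div_le_div_iff₀ (by linarith) h3]
  linarith

lemma Ak_hasSum (k : ℝ) :
    HasSum (fun S : Finset Nat.Primes => (∏ p ∈ S, gp k p) * (1 / (dS S).totient)) (Ak k) := by
  have hs : Summable (fun S : Finset Nat.Primes => ∏ p ∈ S, gp k p / (((p : ℕ) : ℝ) - 1)) := by
    apply summable_finsetProd_of_summable_norm
    exact summable_gphi k
  have e := tprod_one_add hs
  have : Ak k = ∑' S : Finset Nat.Primes, ∏ p ∈ S, gp k p / (((p : ℕ) : ℝ) - 1) := e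
  rw [this]
  refine hs.hasSum.congr_fun ?_
  intro S
  rw [totient_dS, Finset.prod_div_distrib]
  ring

lemma thG_main (k : ℝ) (A : ℕ) : ∃ K : ℝ, 0 < K ∧ ∀ x : ℝ, 3 ≤ x →
    |thG k ⌊x⌋₊ - Ak k * x| ≤ K * x / Real.log x ^ A := by
  obtain ⟨K, hK, h⟩ := thd_err A
  have hs : Summable (fun S : Finset Nat.Primes => ∏ p ∈ S, |gp k p * wt p|) := by
    apply summable_finsetProd_of_summable_norm
    simpa using summable_gw k
  set M := ∑' S : Finset Nat.Primes, ∏ p ∈ S, |gp k p * wt p| with hM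
  have hM0 : 0 ≤ M := tsum_nonneg fun S => Finset.prod_nonneg fun p _ => abs_nonneg _
  refine ⟨K * (M + 1), by positivity, ?_⟩
  intro x hx
  have hL := one_le_log hx
  have h1 := (thG_hasSum k ⌊x⌋₊).sub ((Ak_hasSum k).mul_right x)
  have h2 : ‖thG k ⌊x⌋₊ - Ak k * x‖ ≤ K * (x / Real.log x ^ A) * M := by
    rw [← h1.tsum_eq]
    apply tsum_of_norm_bounded (hs.hasSum.mul_left _)
    intro S
    have e : (∏ p ∈ S, gp k p) * thd ⌊x⌋₊ (dS S) - (∏ p ∈ S, gp k p) * (1 / (dS S).totient) * x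
        = (∏ p ∈ S, gp k p) * (thd ⌊x⌋₊ (dS S) - x / (dS S).totient) := by ring
    rw [e, norm_mul, Real.norm_eq_abs, Real.norm_eq_abs, Finset.abs_prod]
    calc _ ≤ (∏ p ∈ S, |gp k p|) * (K * (x / Real.log x ^ A) * ∏ p ∈ S, wt p) := by
          gcongr
          exact h S x hx
      _ = _ := by
          have : ∏ p ∈ S, |gp k p * wt p| = (∏ p ∈ S, |gp k p|) * ∏ p ∈ S, wt p := by
            rw [← Finset.prod_mul_distrib]
            apply Finset.prod_congr rfl
            intro p _
            rw [abs_mul, abs_of_pos (wt_pos p)]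
          rw [this]; ring
  rw [Real.norm_eq_abs] at h2
  refine h2.trans ?_
  have : 0 ≤ K * (x / Real.log x ^ A) := by positivity
  calc _ ≤ K * (x / Real.log x ^ A) * (M + 1) := by gcongr; linarith
    _ = _ := by ring

end ATR

namespace ATR

lemma li_anti : AntitoneOn (fun t : ℝ => 1 / Real.log t) (Set.Ici 2) := by
  intro a ha b hb hab
  rw [Set.mem_Ici] at ha hb
  apply one_div_le_one_div_of_le (Real.log_pos (by linarith))
  exact Real.log_le_log (by linarith) hab

lemma li_int (a b : ℝ) (ha : 2 ≤ a) (hb : 2 ≤ b) :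
    IntervalIntegrable (fun t : ℝ => 1 / Real.log t) volume a b := by
  apply AntitoneOn.intervalIntegrable
  apply li_anti.mono
  intro t ht
  rw [Set.mem_uIcc] at ht
  rw [Set.mem_Ici]
  rcases ht with h | h <;> linarith

lemma li_bd (a b : ℝ) (ha : 2 ≤ a) (hab : a ≤ b) :
    |∫ t in a..b, 1 / Real.log t| ≤ 2 * (b - a) := by
  have h := intervalIntegral.norm_integral_le_of_norm_le_const (a := a) (b := b) (C := 2)
    (f := fun t : ℝ => 1 / Real.log t) (by
      intro t ht
      rw [Set.uIoc_of_le hab] at ht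
      have h2 : Real.log 2 ≤ Real.log t := Real.log_le_log (by norm_num) (by linarith [ht.1])
      have h3 := Real.log_two_gt_d9
      rw [Real.norm_eq_abs, abs_of_nonneg (by apply one_div_nonneg.2; linarith),
        div_le_iff₀ (by linarith)]
      linarith)
  rw [Real.norm_eq_abs, abs_of_nonneg (by linarith : 0 ≤ b - a)] at h
  exact h

lemma li_sum (x : ℝ) (hx : 3 ≤ x) :
    |(∫ t in (2 : ℝ)..x, 1 / Real.log t) - ∑ n ∈ Finset.Ioc 3 ⌊x⌋₊, (Real.log n)⁻¹| ≤ 6 := by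
  set N := ⌊x⌋₊ with hN
  have hN3 : 3 ≤ N := Nat.le_floor (by exact_mod_cast hx)
  have hN3' : (3 : ℝ) ≤ N := by exact_mod_cast hN3
  have hNx : (N : ℝ) ≤ x := Nat.floor_le (by linarith)
  have hxN : x < N + 1 := Nat.lt_floor_add_one x
  have e1 : (∫ t in (2 : ℝ)..x, 1 / Real.log t) = (∫ t in (2 : ℝ)..3, 1 / Real.log t) +
      (∫ t in (3 : ℝ)..N, 1 / Real.log t) + ∫ t in (N : ℝ)..x, 1 / Real.log t := by
    rw [intervalIntegral.integral_add_adjacent_intervals, intervalIntegral.integral_add_adjacent_intervals]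
    all_goals apply li_int <;> linarith
  have b1 := li_bd 2 3 le_rfl (by norm_num)
  have b2 := li_bd N x (by linarith) hNx
  have hanti : AntitoneOn (fun t : ℝ => 1 / Real.log t) (Set.Icc ((3 : ℕ) : ℝ) (N : ℝ)) := by
    apply li_anti.mono
    intro t ht
    rw [Set.mem_Ici]
    have := ht.1
    push_cast at this
    linarith
  have c1 := AntitoneOn.sum_le_integral_Ico hN3 hanti
  have c2 := AntitoneOn.integral_le_sum_Ico hN3 hanti
  rw [Finset.sum_Ico_add' (fun i : ℕ => 1 / Real.log (i : ℝ)) 3 N 1] at c1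
  have s1 : ∑ n ∈ Finset.Ioc 3 N, (Real.log n)⁻¹ = ∑ n ∈ Finset.Ico (3 + 1) (N + 1), 1 / Real.log (n : ℝ) := by
    simp only [one_div]
    apply Finset.sum_congr _ fun _ _ => rfl
    ext n
    simp only [Finset.mem_Ioc, Finset.mem_Ico]
    omega
  have s2 : ∑ n ∈ Finset.Ico 3 N, 1 / Real.log (n : ℝ) + 1 / Real.log (N : ℝ) =
      1 / Real.log ((3 : ℕ) : ℝ) + ∑ n ∈ Finset.Ico (3 + 1) (N + 1), 1 / Real.log (n : ℝ) := by
    rw [← Finset.sum_Ico_succ_top hN3, Finset.sum_eq_sum_Ico_succ_bot (by omega)]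
  have l3 : 1 / Real.log ((3 : ℕ) : ℝ) ≤ 1 := by
    have := one_le_log (x := ((3 : ℕ) : ℝ)) (by norm_num)
    rw [div_le_one (by linarith)]
    exact this
  have lN : 0 ≤ 1 / Real.log (N : ℝ) := one_div_nonneg.2 (Real.log_natCast_nonneg N)
  push_cast at c1 c2 s2 l3
  rw [s1, e1]
  norm_num at c1 c2 s2 l3 lN b1 b2 ⊢
  rw [abs_le] at b1 b2 ⊢
  constructor <;> linarith [b1.1, b1.2, b2.1, b2.2, inv_nonneg.2 lN]

lemma final_large (k C : ℝ) : ∃ K : ℝ, 0 < K ∧ ∀ x : ℝ, 3 ≤ x →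
      |(∑ p ∈ Finset.filter Nat.Prime (Finset.Iic ⌊x⌋₊),
          (((p - 1).totient : ℝ) / ((p - 1 : ℕ) : ℝ)) ^ k) -
        Ak k * ∫ t in (2 : ℝ)..x, 1 / Real.log t| ≤ K * x / Real.log x ^ C := by
  set A := ⌈C⌉₊ with hA
  have hCA : C ≤ A := Nat.le_ceil C
  obtain ⟨K, hK, h⟩ := thG_main k A
  obtain ⟨C₁, hC₁, h₁⟩ := abel_log (-(A : ℝ)) 1 le_rfl (by
    have : (0 : ℝ) ≤ A := by positivity
    push_cast; linarith)
  set G : ℕ → ℝ := fun p => (((p - 1).totient : ℝ) / ((p - 1 : ℕ) : ℝ)) ^ k with hG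
  set c : ℕ → ℝ := fun n => (if n.Prime then Real.log n * G n else 0) - Ak k with hc
  set H := K + |Ak k| * A.factorial with hH
  have hH0 : 0 ≤ H := by positivity
  have hone : ∀ t : ℝ, 3 ≤ t → 1 ≤ A.factorial * t * Real.log t ^ (-(A : ℝ)) := by
    intro t ht
    have hL := one_le_log ht
    have := log_pow_le ht A
    rw [Real.rpow_neg (by linarith), Real.rpow_natCast, ← div_eq_mul_inv, le_div_iff₀ (by positivity)]
    linarith
  have hsum : ∀ N : ℕ, ∑ n ∈ Finset.Icc 0 N, c n = thG k N - Ak k * (N + 1) := by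
    intro N
    rw [hc, Finset.sum_sub_distrib, Finset.sum_const, Nat.card_Icc, nsmul_eq_mul, ← Finset.sum_filter]
    unfold thG
    have : Finset.Icc 0 N = Finset.Iic N := by ext; simp
    rw [this]
    push_cast
    ring
  have hpart : ∀ t : ℝ, 3 ≤ t → ‖∑ n ∈ Finset.Icc 0 ⌊t⌋₊, ((c n : ℝ) : ℂ)‖ ≤
      H * t * Real.log t ^ (-(A : ℝ)) := by
    intro t ht
    rw [← Complex.ofReal_sum, Complex.norm_real, hsum, Real.norm_eq_abs]
    have hL := one_le_log ht
    have a1 := h t ht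
    have a2 : |t - (⌊t⌋₊ + 1)| ≤ 1 := by
      have := Nat.floor_le (by linarith : 0 ≤ t)
      have := Nat.lt_floor_add_one t
      rw [abs_le]; constructor <;> linarith
    have e : thG k ⌊t⌋₊ - Ak k * (⌊t⌋₊ + 1) = (thG k ⌊t⌋₊ - Ak k * t) + Ak k * (t - (⌊t⌋₊ + 1)) := by ring
    rw [e]
    refine (abs_add_le _ _).trans ?_
    rw [abs_mul]
    have e2 : K * t / Real.log t ^ A = K * t * Real.log t ^ (-(A : ℝ)) := by
      rw [Real.rpow_neg (by linarith), Real.rpow_natCast, div_eq_mul_inv]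
    rw [e2] at a1
    have a3 : |Ak k| * |t - (⌊t⌋₊ + 1)| ≤ |Ak k| * (A.factorial * t * Real.log t ^ (-(A : ℝ))) := by
      gcongr
      exact a2.trans (hone t ht)
    calc _ ≤ K * t * Real.log t ^ (-(A : ℝ)) + |Ak k| * (A.factorial * t * Real.log t ^ (-(A : ℝ))) :=
          add_le_add a1 a3
      _ = _ := by rw [hH]; ring
  have h₂ := h₁ (fun n => ((c n : ℝ) : ℂ)) H hH0 hpart
  set E := |G 2 + G 3| + |Ak k| * 6 with hE
  have hE0 : 0 ≤ E := by positivity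
  refine ⟨C₁ * H + E * A.factorial + 1, by positivity, ?_⟩
  intro x hx
  have hL := one_le_log hx
  have hN3 : 3 ≤ ⌊x⌋₊ := Nat.le_floor (by exact_mod_cast hx)
  have h3 := h₂ x hx
  set N := ⌊x⌋₊ with hN
  have e1 : ∑ n ∈ Finset.Ioc 3 N, ((((Real.log n) ^ 1)⁻¹ : ℝ) : ℂ) * ((c n : ℝ) : ℂ) =
      ((∑ p ∈ (Finset.Ioc 3 N).filter Nat.Prime, G p - Ak k * ∑ n ∈ Finset.Ioc 3 N, (Real.log n)⁻¹ : ℝ) : ℂ) := by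
    have : ∑ p ∈ (Finset.Ioc 3 N).filter Nat.Prime, G p - Ak k * ∑ n ∈ Finset.Ioc 3 N, (Real.log n)⁻¹ =
        ∑ n ∈ Finset.Ioc 3 N, (Real.log n)⁻¹ * c n := by
      rw [Finset.sum_filter, Finset.mul_sum, ← Finset.sum_sub_distrib]
      apply Finset.sum_congr rfl
      intro n hn
      rw [Finset.mem_Ioc] at hn
      have hl : Real.log n ≠ 0 := by
        apply ne_of_gt
        apply Real.log_pos
        exact_mod_cast (by omega : 1 < n)
      rw [hc]
      dsimp only
      split_ifs
      · field_simp
      · ring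
    rw [this]
    push_cast
    simp
  rw [e1, Complex.norm_real, Real.norm_eq_abs] at h3
  have e2 : ∑ p ∈ Finset.filter Nat.Prime (Finset.Iic N), G p =
      G 2 + G 3 + ∑ p ∈ (Finset.Ioc 3 N).filter Nat.Prime, G p := by
    have : Finset.filter Nat.Prime (Finset.Iic N) = insert 2 (insert 3 ((Finset.Ioc 3 N).filter Nat.Prime)) := by
      ext n
      simp only [Finset.mem_filter, Finset.mem_Iic, Finset.mem_insert, Finset.mem_Ioc]
      constructor
      · rintro ⟨h1, h2⟩
        have := h2.two_le
        by_cases h4 : n ≤ 3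
        · omega
        · exact Or.inr (Or.inr ⟨⟨by omega, h1⟩, h2⟩)
      · rintro (rfl | rfl | h)
        · exact ⟨by omega, Nat.prime_two⟩
        · exact ⟨by omega, Nat.prime_three⟩
        · exact ⟨h.1.2, h.2⟩
    rw [this, Finset.sum_insert (by simp), Finset.sum_insert (by simp)]
    ring
  have h4 := li_sum x hx
  rw [← hN] at h4
  have e3 : ∑ p ∈ Finset.filter Nat.Prime (Finset.Iic N), G p - Ak k * ∫ t in (2 : ℝ)..x, 1 / Real.log t =
      (∑ p ∈ (Finset.Ioc 3 N).filter Nat.Prime, G p - Ak k * ∑ n ∈ Finset.Ioc 3 N, (Real.log n)⁻¹) +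
      ((G 2 + G 3) + Ak k * (-((∫ t in (2 : ℝ)..x, 1 / Real.log t) - ∑ n ∈ Finset.Ioc 3 N, (Real.log n)⁻¹))) := by
    rw [e2]; ring
  have h5 : |(G 2 + G 3) + Ak k * (-((∫ t in (2 : ℝ)..x, 1 / Real.log t) - ∑ n ∈ Finset.Ioc 3 N, (Real.log n)⁻¹))| ≤ E := by
    refine (abs_add_le _ _).trans ?_
    rw [abs_mul, abs_neg, hE]
    gcongr
  have hLC : ∀ r : ℝ, r ≤ -C → Real.log x ^ r ≤ Real.log x ^ (-C) := fun r hr =>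
    Real.rpow_le_rpow_of_exponent_le hL hr
  have hx0 : 0 ≤ x := by linarith
  have h6 : E ≤ E * A.factorial * x * Real.log x ^ (-C) := by
    calc E = E * 1 := by ring
      _ ≤ E * (A.factorial * x * Real.log x ^ (-(A : ℝ))) := by gcongr; exact hone x hx
      _ ≤ E * (A.factorial * x * Real.log x ^ (-C)) := by gcongr
      _ = _ := by ring
  have h7 : C₁ * H * x * Real.log x ^ (-(A : ℝ) - ((1 : ℕ) : ℝ)) ≤ C₁ * H * x * Real.log x ^ (-C) := by
    have := hLC (-(A : ℝ) - ((1 : ℕ) : ℝ)) (by push_cast; linarith)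
    gcongr
  have h8 : 0 ≤ x * Real.log x ^ (-C) := by positivity
  rw [e3, div_eq_mul_inv, ← Real.rpow_neg (by linarith)]
  refine (abs_add_le _ _).trans ?_
  calc _ ≤ C₁ * H * x * Real.log x ^ (-C) + E * A.factorial * x * Real.log x ^ (-C) :=
        add_le_add (h3.trans h7) (h5.trans h6)
    _ ≤ _ := by nlinarith

lemma final_small (k C : ℝ) (hC : 0 < C) (x : ℝ) (hx : 2 ≤ x) (hx3 : x < 3) :
      |(∑ p ∈ Finset.filter Nat.Prime (Finset.Iic ⌊x⌋₊),
          (((p - 1).totient : ℝ) / ((p - 1 : ℕ) : ℝ)) ^ k) -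
        Ak k * ∫ t in (2 : ℝ)..x, 1 / Real.log t| ≤ ((1 + |Ak k| * 2) * 2 ^ C) * x / Real.log x ^ C := by
  have hf : ⌊x⌋₊ = 2 := by
    rw [Nat.floor_eq_iff (by linarith)]
    push_cast
    constructor <;> linarith
  have hset : Finset.filter Nat.Prime (Finset.Iic 2) = {2} := by decide
  rw [hf, hset, Finset.sum_singleton]
  norm_num only [Nat.totient_one]
  have hl : 0 < Real.log x := Real.log_pos (by linarith)
  have hl2 : Real.log x ≤ 2 := by
    have := Real.log_le_sub_one_of_pos (by linarith : 0 < x)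
    linarith
  have hp : Real.log x ^ C ≤ 2 ^ C := Real.rpow_le_rpow hl.le hl2 hC.le
  have hp0 : 0 < Real.log x ^ C := Real.rpow_pos_of_pos hl C
  have h1 := li_bd 2 x le_rfl hx
  have h2 : |∫ t in (2 : ℝ)..x, 1 / Real.log t| ≤ 2 := by linarith
  have h3 : |(1 : ℝ) - Ak k * ∫ t in (2 : ℝ)..x, 1 / Real.log t| ≤ 1 + |Ak k| * 2 := by
    refine (abs_sub _ _).trans ?_
    rw [abs_mul, abs_one]
    gcongr
  have h4 : 1 + |Ak k| * 2 ≤ ((1 + |Ak k| * 2) * 2 ^ C) * x / Real.log x ^ C := by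
    rw [le_div_iff₀ hp0]
    have h0 : 0 ≤ 1 + |Ak k| * 2 := by positivity
    calc _ ≤ (1 + |Ak k| * 2) * 2 ^ C * 1 := by rw [mul_one]; gcongr
      _ ≤ _ := by gcongr; linarith
  simpa using h3.trans h4

end ATR

theorem averaged_totient_ratio_power (k C : ℝ) (hC : 0 < C) :
    ∃ K : ℝ, ∀ x : ℝ, 2 ≤ x →
      |(∑ p ∈ Finset.filter Nat.Prime (Finset.Iic ⌊x⌋₊),
          (((p - 1).totient : ℝ) / ((p - 1 : ℕ) : ℝ)) ^ k) -
        (∏' p : Nat.Primes, (1 + ((1 - 1 / ((p : ℕ) : ℝ)) ^ k - 1) / (((p : ℕ) : ℝ) - 1))) *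
          ∫ t in (2 : ℝ)..x, 1 / Real.log t| ≤ K * x / Real.log x ^ C := by
  obtain ⟨K, hK, h⟩ := ATR.final_large k C
  refine ⟨K + ((1 + |ATR.Ak k| * 2) * 2 ^ C), ?_⟩
  intro x hx
  have hl : 0 < Real.log x := Real.log_pos (by linarith)
  have hp0 : 0 < Real.log x ^ C := Real.rpow_pos_of_pos hl C
  have hx0 : 0 ≤ x := by linarith
  rcases lt_or_ge x 3 with h3 | h3
  · refine (ATR.final_small k C hC x hx h3).trans ?_
    gcongr
    linarith
  · refine (h x h3).trans ?_
    gcongr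
    have : 0 ≤ (1 + |ATR.Ak k| * 2) * (2 : ℝ) ^ C := by positivity
    linarith
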